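/- Let χ be an extreme unipotent trace of A(GLB), normalized so that χ(I_B) = 1. Then there exists a unique Borel probability measure ϱ on 𝔹 such that for every n and every invertible upper-triangular matrix g ∈ GL(n,q), χ(I_g) = ϱ(Cyl_g). (Theorem 4.1: identification of unipotent traces with probability measures on the Borel subgroup.) -/

import Mathlib

/-!
STATEMENT 0 (Theorem 3.3, multiplicativity of extreme unipotent traces of A(GLB)).
-/

open scoped ComplexOrder

variable (F : Type) [Field F] [Fintype F] [DecidableEq F]

/-- `GL(n,q)`, the group of invertible `n × n` matrices over the finite field `F` (`q = |F|`). -/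
abbrev GLn (n : ℕ) := GL (Fin n) F

/-- The complex group algebra `ℂ[GL(n,q)]`. -/
abbrev GA (n : ℕ) := MonoidAlgebra ℂ (GLn F n)

/-- `b` is an invertible upper-triangular matrix, i.e. an element of the Borel subgroup `B_n`. -/
def IsUT {n : ℕ} (b : GLn F n) : Prop :=
  ∀ i j : Fin n, j < i → (b : Matrix (Fin n) (Fin n) F) i j = 0

open scoped Classical in
/-- `Ext(g)`: the set of `h ∈ GL(n+1,q)` whose top-left `n × n` corner is `g` and whose last
row vanishes except possibly at the `(n+1,n+1)` entry. -/
noncomputable def ExtSet {n : ℕ} (g : GLn F n) : Finset (GLn F (n + 1)) :=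
  Finset.univ.filter (fun h =>
    (∀ i j : Fin n, (h : Matrix (Fin (n + 1)) (Fin (n + 1)) F) i.castSucc j.castSucc
        = (g : Matrix (Fin n) (Fin n) F) i j) ∧
    (∀ j : Fin n, (h : Matrix (Fin (n + 1)) (Fin (n + 1)) F) (Fin.last n) j.castSucc = 0))

/-- The parabolic embedding `i_n : ℂ[GL(n,q)] → ℂ[GL(n+1,q)]`,
`e_g ↦ (1/((q-1)q^n)) ∑_{h ∈ Ext(g)} e_h`. -/
noncomputable def paraEmb (n : ℕ) : GA F n →ₗ[ℂ] GA F (n + 1) :=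
  (Finsupp.lsum ℂ (fun g => LinearMap.toSpanSingleton ℂ (GA F (n + 1))
    ((((Fintype.card F : ℂ) - 1) * (Fintype.card F : ℂ) ^ n)⁻¹ •
      ∑ h ∈ ExtSet F g, MonoidAlgebra.single h (1 : ℂ)))).comp
    (MonoidAlgebra.coeffLinearEquiv ℂ).toLinearMap

/-- Character of a matrix representation, as a linear functional on the group algebra. -/
noncomputable def charFun {n d : ℕ} (ρ : Representation ℂ (GLn F n) (Fin d → ℂ))
    (a : GA F n) : ℂ :=
  Finsupp.sum a.coeff (fun g c => c * LinearMap.trace ℂ (Fin d → ℂ) (ρ g))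

/-- `ρ` is an irreducible representation of `GL(n,q)` which is unipotent, i.e. possesses a
nonzero `B_n`-invariant vector. -/
def IsUnipotentIrrep {n d : ℕ} (ρ : Representation ℂ (GLn F n) (Fin d → ℂ)) : Prop :=
  (∀ W : Submodule ℂ (Fin d → ℂ), (∀ (g : GLn F n), ∀ v ∈ W, ρ g v ∈ W) → W = ⊥ ∨ W = ⊤) ∧
  (∃ v : Fin d → ℂ, v ≠ 0 ∧ ∀ b : GLn F n, IsUT F b → ρ b v = v)

/-- A functional on `ℂ[GL(n,q)]` is unipotent if it is a linear combination of characters of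
irreducible unipotent representations of `GL(n,q)`. -/
def IsUnipotentFunctional {n : ℕ} (φ : GA F n → ℂ) : Prop :=
  ∃ (k : ℕ) (c : Fin k → ℂ) (d : Fin k → ℕ)
    (ρ : (i : Fin k) → Representation ℂ (GLn F n) (Fin (d i) → ℂ)),
    (∀ i, IsUnipotentIrrep F (ρ i)) ∧ ∀ a : GA F n, φ a = ∑ i, c i * charFun F (ρ i) a

section Abstract
variable {A : Type} [NonUnitalRing A] [Module ℂ A] [SMulCommClass ℂ A A] [IsScalarTower ℂ A A]
  [StarRing A] [StarModule ℂ A]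

/-- A trace of a non-unital `*`-algebra: a central positive-definite linear functional. -/
def IsTrace (χ : A →ₗ[ℂ] ℂ) : Prop :=
  (∀ x y : A, χ (x * y) = χ (y * x)) ∧ (∀ x : A, 0 ≤ χ (star x * x))

/-- A nonzero trace is extreme if any decomposition into a sum of two traces is trivial. -/
def IsExtremeTrace (χ : A →ₗ[ℂ] ℂ) : Prop :=
  IsTrace χ ∧ χ ≠ 0 ∧ ∀ χ₁ χ₂ : A →ₗ[ℂ] ℂ, IsTrace χ₁ → IsTrace χ₂ → χ = χ₁ + χ₂ →
    ∃ c₁ c₂ : ℝ, 0 ≤ c₁ ∧ 0 ≤ c₂ ∧ χ₁ = (c₁ : ℂ) • χ ∧ χ₂ = (c₂ : ℂ) • χ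
end Abstract


open MeasureTheory

/-- The group `𝔹` of infinite upper-triangular matrices over `F` with nonzero diagonal
entries (indexed by `ℕ`). -/
def BB : Type := {X : ℕ → ℕ → F // (∀ i j : ℕ, j < i → X i j = 0) ∧ ∀ i : ℕ, X i i ≠ 0}

/-- The Borel σ-algebra of `𝔹` (the product σ-algebra of the discrete finite field `F`,
which coincides with the Borel σ-algebra of the compact product topology). -/
noncomputable instance : MeasurableSpace (BB F) := by
  letI : MeasurableSpace F := ⊤
  exact Subtype.instMeasurableSpace

/-- The cylinder set `Cyl_g ⊆ 𝔹` of the matrix `g ∈ GL(n,q)`: infinite matrices whose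
top-left `n × n` corner equals `g`. -/
def Cyl {n : ℕ} (g : GLn F n) : Set (BB F) :=
  {X | ∀ i j : Fin n, X.1 i j = (g : Matrix (Fin n) (Fin n) F) i j}

namespace OV

/-- An abstract version of the set of content sequences. -/
structure GoodSet (N : ℕ) (S : Set (ℕ → ℂ)) : Prop where
  zero : ∀ a ∈ S, 0 < N → a 0 = 0
  ne : ∀ a ∈ S, ∀ i, i + 1 < N → a i ≠ a (i + 1)
  swap : ∀ a ∈ S, ∀ i, i + 1 < N → a (i + 1) - a i ≠ 1 → a (i + 1) - a i ≠ -1 →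
    (a ∘ Equiv.swap i (i + 1)) ∈ S
  braid : ∀ a ∈ S, ∀ i, i + 2 < N → a i = a (i + 2) →
    a (i + 1) - a i ≠ 1 ∧ a (i + 1) - a i ≠ -1

variable {N : ℕ} {S : Set (ℕ → ℂ)}

lemma GoodSet.between (h : GoodSet N S) : ∀ d : ℕ, ∀ a ∈ S, ∀ i j : ℕ, i + d = j → 0 < d → j < N →
    a i = a j → (∃ k, i < k ∧ k < j ∧ a k = a i + 1) ∧ (∃ k, i < k ∧ k < j ∧ a k = a i - 1) := by
  intro d
  induction d using Nat.strong_induction_on with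
  | _ d ih =>
  intro a ha i j hij hd hj hc
  -- the case of adjacent positions
  rcases Nat.lt_or_ge d 2 with h2 | h2
  · have : d = 1 := by omega
    subst this; subst hij
    exact absurd hc (h.ne a ha i hj)
  by_cases hL : a (i + 1) - a i = 1 ∨ a (i + 1) - a i = -1
  swap
  · push Not at hL
    have hs := h.swap a ha i (by omega) hL.1 hL.2
    have e1 : (a ∘ Equiv.swap i (i + 1)) (i + 1) = a i := by simp
    have e2 : ∀ k, i + 1 < k → (a ∘ Equiv.swap i (i + 1)) k = a k := by
      intro k hk
      simp only [Function.comp]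
      rw [Equiv.swap_apply_of_ne_of_ne (by omega) (by omega)]
    obtain ⟨⟨k, hk1, hk2, hk3⟩, ⟨l, hl1, hl2, hl3⟩⟩ :=
      ih (d - 1) (by omega) _ hs (i + 1) j (by omega) (by omega) hj
        (by rw [e1, e2 j (by omega)]; exact hc)
    rw [e1, e2 k (by omega)] at hk3
    rw [e1, e2 l (by omega)] at hl3
    exact ⟨⟨k, by omega, hk2, hk3⟩, ⟨l, by omega, hl2, hl3⟩⟩
  obtain ⟨j', rfl⟩ : ∃ j', j = j' + 1 := ⟨j - 1, by omega⟩
  by_cases hR : a (j' + 1) - a j' = 1 ∨ a (j' + 1) - a j' = -1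
  swap
  · push Not at hR
    have hs := h.swap a ha j' (by omega) hR.1 hR.2
    have e1 : (a ∘ Equiv.swap j' (j' + 1)) j' = a (j' + 1) := by simp
    have e2 : ∀ k, k < j' → (a ∘ Equiv.swap j' (j' + 1)) k = a k := by
      intro k hk
      simp only [Function.comp]
      rw [Equiv.swap_apply_of_ne_of_ne (by omega) (by omega)]
    obtain ⟨⟨k, hk1, hk2, hk3⟩, ⟨l, hl1, hl2, hl3⟩⟩ :=
      ih (d - 1) (by omega) _ hs i j' (by omega) (by omega) (by omega)
        (by rw [e1, e2 i (by omega)]; exact hc)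
    rw [e2 i (by omega), e2 k (by omega)] at hk3
    rw [e2 i (by omega), e2 l (by omega)] at hl3
    exact ⟨⟨k, hk1, by omega, hk3⟩, ⟨l, hl1, by omega, hl3⟩⟩
  rcases Nat.lt_or_ge d 3 with h3 | h3
  · have : j' = i + 1 := by omega
    subst this
    have := h.braid a ha i (by omega) hc
    tauto
  by_cases he : a (i + 1) = a j'
  · obtain ⟨⟨k, hk1, hk2, hk3⟩, ⟨l, hl1, hl2, hl3⟩⟩ :=
      ih (d - 2) (by omega) a ha (i + 1) j' (by omega) (by omega) (by omega) he
    obtain ⟨m, hm1, hm2, hm3⟩ : ∃ m, i < m ∧ m < j' ∧ a m = a i := by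
      rcases hL with hL | hL
      · exact ⟨l, by omega, hl2, by rw [hl3]; linear_combination hL⟩
      · exact ⟨k, by omega, hk2, by rw [hk3]; linear_combination hL⟩
    obtain ⟨⟨k, hk1, hk2, hk3⟩, ⟨l, hl1, hl2, hl3⟩⟩ :=
      ih (m - i) (by omega) a ha i m (by omega) (by omega) (by omega) hm3.symm
    exact ⟨⟨k, hk1, by omega, hk3⟩, ⟨l, hl1, by omega, hl3⟩⟩
  · rcases hL with hL | hL <;> rcases hR with hR | hR
    · exact ⟨⟨i + 1, by omega, by omega, by linear_combination hL⟩,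
        ⟨j', by omega, by omega, by linear_combination -hR - hc⟩⟩
    · exact absurd (by linear_combination hL + hR + hc) he
    · exact absurd (by linear_combination hL + hR + hc) he
    · exact ⟨⟨j', by omega, by omega, by linear_combination -hR - hc⟩,
        ⟨i + 1, by omega, by omega, by linear_combination hL⟩⟩

lemma GoodSet.before (h : GoodSet N S) : ∀ j : ℕ, ∀ a ∈ S, 0 < j → j < N →
    ∃ i < j, a i = a j + 1 ∨ a i = a j - 1 := by
  intro j
  induction j with
  | zero => intro a _ h0; omega
  | succ j ih =>
  intro a ha _ hj
  by_cases hR : a (j + 1) - a j = 1 ∨ a (j + 1) - a j = -1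
  · refine ⟨j, by omega, ?_⟩
    rcases hR with hR | hR
    · right; linear_combination -hR
    · left; linear_combination -hR
  push Not at hR
  have hs := h.swap a ha j hj hR.1 hR.2
  have e1 : (a ∘ Equiv.swap j (j + 1)) j = a (j + 1) := by simp
  have e2 : ∀ k, k < j → (a ∘ Equiv.swap j (j + 1)) k = a k := by
    intro k hk
    simp only [Function.comp]
    rw [Equiv.swap_apply_of_ne_of_ne (by omega) (by omega)]
  rcases Nat.eq_zero_or_pos j with rfl | hpos
  · have h1 := h.zero _ hs (by omega)
    have h2 := h.zero _ ha (by omega)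
    rw [e1] at h1
    exact absurd (h2.trans h1.symm) (h.ne a ha 0 hj)
  · obtain ⟨i, hi, hi'⟩ := ih _ hs hpos (by omega)
    rw [e1, e2 i hi] at hi'
    exact ⟨i, by omega, hi'⟩

lemma GoodSet.int (h : GoodSet N S) (a : ℕ → ℂ) (ha : a ∈ S) : ∀ j : ℕ, j < N → ∃ z : ℤ, a j = z := by
  intro j
  induction j using Nat.strong_induction_on with
  | _ j ih =>
  intro hj
  rcases Nat.eq_zero_or_pos j with rfl | hpos
  · exact ⟨0, by simpa using h.zero a ha hj⟩
  · obtain ⟨i, hi, hi'⟩ := h.before j a ha hpos hj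
    obtain ⟨z, hz⟩ := ih i hi (by omega)
    rcases hi' with hi' | hi'
    · exact ⟨z - 1, by push_cast; linear_combination hz - hi'⟩
    · exact ⟨z + 1, by push_cast; linear_combination hz - hi'⟩

lemma GoodSet.interval (h : GoodSet N S) (a : ℕ → ℂ) (ha : a ∈ S) (z : ℕ → ℤ)
    (hz : ∀ j < N, a j = z j) : ∀ j : ℕ, j < N → ∀ b : ℤ, (0 ≤ b ∧ b ≤ z j) ∨ (z j ≤ b ∧ b ≤ 0) →
    ∃ i ≤ j, z i = b := by
  intro j
  induction j using Nat.strong_induction_on with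
  | _ j ih =>
  intro hj b hb
  by_cases hbz : z j = b
  · exact ⟨j, le_rfl, hbz⟩
  rcases Nat.eq_zero_or_pos j with rfl | hpos
  · have : z 0 = 0 := by
      have := h.zero a ha hj
      rw [hz 0 hj] at this
      exact_mod_cast this
    omega
  · obtain ⟨i, hi, hi'⟩ := h.before j a ha hpos hj
    have hi2 : z i = z j + 1 ∨ z i = z j - 1 := by
      rw [hz i (by omega), hz j hj] at hi'
      exact_mod_cast hi'
    obtain ⟨k, hk, hk'⟩ := ih i hi (by omega) b (by omega)
    exact ⟨k, by omega, hk'⟩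

lemma card_le_of_interlace (A B : Finset ℕ) (h1 : ∀ b ∈ B, ∃ a ∈ A, a < b)
    (h2 : ∀ b ∈ B, ∀ b' ∈ B, b < b' → ∃ a ∈ A, b < a ∧ a < b') : B.card ≤ A.card := by
  classical
  have hne : ∀ b ∈ B, (A.filter (· < b)).Nonempty := by
    intro b hb
    obtain ⟨a, ha, hab⟩ := h1 b hb
    exact ⟨a, by simp [ha, hab]⟩
  let f : ℕ → ℕ := fun b => if hb : b ∈ B then (A.filter (· < b)).max' (hne b hb) else 0
  refine Finset.card_le_card_of_injOn f ?_ ?_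
  · intro b hb
    have hb' : b ∈ B := hb
    simp only [f, hb', dif_pos]
    have := Finset.max'_mem _ (hne b hb')
    exact (Finset.mem_filter.1 this).1
  · have key : ∀ b ∈ B, ∀ b' ∈ B, b < b' → f b < f b' := by
      intro b hb b' hb' hlt
      obtain ⟨a, ha, hba, hab'⟩ := h2 b hb b' hb' hlt
      simp only [f, hb, hb', dif_pos]
      have h3 := Finset.max'_mem _ (hne b hb)
      have h4 := (Finset.mem_filter.1 h3).2
      have h5 := Finset.le_max' (A.filter (· < b')) a (by simp [ha, hab'])
      omega
    intro b hb b' hb' heq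
    rcases lt_trichotomy b b' with hlt | heq' | hlt
    · have := key b hb b' hb' hlt; omega
    · exact heq'
    · have := key b' hb' b hb hlt; omega

lemma GoodSet.mono_pos (h : GoodSet N S) (a : ℕ → ℂ) (ha : a ∈ S) (z : ℕ → ℤ)
    (hz : ∀ j < N, a j = z j) (c : ℕ) :
    ((Finset.range N).filter (fun j => z j = (c : ℤ) + 1)).card ≤
      ((Finset.range N).filter (fun j => z j = (c : ℤ))).card := by
  apply card_le_of_interlace
  · intro b hb
    simp only [Finset.mem_filter, Finset.mem_range] at hb
    obtain ⟨i, hi, hi'⟩ := h.interval a ha z hz b hb.1 c (by omega)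
    have : i ≠ b := by rintro rfl; omega
    exact ⟨i, by simp only [Finset.mem_filter, Finset.mem_range]; omega, by omega⟩
  · intro b hb b' hb' hlt
    simp only [Finset.mem_filter, Finset.mem_range] at hb hb'
    obtain ⟨_, k, h1, h2, h3⟩ := h.between (b' - b) a ha b b' (by omega) (by omega) hb'.1
      (by rw [hz b hb.1, hz b' hb'.1, hb.2, hb'.2])
    rw [hz k (by omega), hz b hb.1] at h3
    have h3' : z k = z b - 1 := by exact_mod_cast h3
    exact ⟨k, by simp only [Finset.mem_filter, Finset.mem_range]; omega, h1, h2⟩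

lemma GoodSet.mono_neg (h : GoodSet N S) (a : ℕ → ℂ) (ha : a ∈ S) (z : ℕ → ℤ)
    (hz : ∀ j < N, a j = z j) (c : ℕ) :
    ((Finset.range N).filter (fun j => z j = -(c : ℤ) - 1)).card ≤
      ((Finset.range N).filter (fun j => z j = -(c : ℤ))).card := by
  apply card_le_of_interlace
  · intro b hb
    simp only [Finset.mem_filter, Finset.mem_range] at hb
    obtain ⟨i, hi, hi'⟩ := h.interval a ha z hz b hb.1 (-c) (by omega)
    have : i ≠ b := by rintro rfl; omega
    exact ⟨i, by simp only [Finset.mem_filter, Finset.mem_range]; omega, by omega⟩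
  · intro b hb b' hb' hlt
    simp only [Finset.mem_filter, Finset.mem_range] at hb hb'
    obtain ⟨⟨k, h1, h2, h3⟩, _⟩ := h.between (b' - b) a ha b b' (by omega) (by omega) hb'.1
      (by rw [hz b hb.1, hz b' hb'.1, hb.2, hb'.2])
    rw [hz k (by omega), hz b hb.1] at h3
    have h3' : z k = z b + 1 := by exact_mod_cast h3
    exact ⟨k, by simp only [Finset.mem_filter, Finset.mem_range]; omega, h1, h2⟩

end OV

namespace OV

/-- signed power sums: `true` marks a plus weight, `false` a minus weight -/
noncomputable def psum (k : ℕ) (ws : List (Bool × ℝ)) : ℝ :=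
  (ws.map fun p => if p.1 then p.2 ^ k else (-1) ^ (k + 1) * p.2 ^ k).sum

lemma pow_diff_lower (c : ℝ) (hc : 0 ≤ c) (e : ℕ) : (e + 1) * c ^ e ≤ (c + 1) ^ (e + 1) - c ^ (e + 1) := by
  induction e with
  | zero => simp
  | succ e ih =>
    have h1 : (c + 1) ^ (e + 1 + 1) = (c + 1) * (c + 1) ^ (e + 1) := by ring
    have h2 : (c + 1) * ((e + 1) * c ^ e + c ^ (e + 1)) ≤ (c + 1) * (c + 1) ^ (e + 1) :=
      mul_le_mul_of_nonneg_left (by linarith) (by linarith)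
    have h3 : 0 ≤ c ^ e := pow_nonneg hc e
    have h4 : 0 ≤ (e : ℝ) := Nat.cast_nonneg e
    push_cast
    rw [h1]
    have h5 : (c + 1) * ((e + 1) * c ^ e + c ^ (e + 1)) = ((e : ℝ) + 1 + 1) * c ^ (e + 1) + c ^ (e + 1 + 1) + (e + 1) * c ^ e := by ring
    nlinarith [mul_nonneg h4 h3]

lemma pow_diff_upper (c : ℝ) (hc : 0 ≤ c) (e : ℕ) : (c + 1) ^ (e + 1) - c ^ (e + 1) ≤ (e + 1) * (c + 1) ^ e := by
  induction e with
  | zero => simp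
  | succ e ih =>
    have h2 : c * ((c + 1) ^ (e + 1) - c ^ (e + 1)) ≤ c * ((e + 1) * (c + 1) ^ e) :=
      mul_le_mul_of_nonneg_left ih hc
    have h3 : 0 ≤ (c + 1) ^ e := pow_nonneg (by linarith) e
    have h4 : 0 ≤ (e : ℝ) := Nat.cast_nonneg e
    push_cast
    have h5 : (c + 1) ^ (e + 1 + 1) - c ^ (e + 1 + 1) = (c+1)^(e+1) + c * ((c + 1) ^ (e + 1) - c ^ (e + 1)) := by ring
    have h6 : ((e:ℝ) + 1 + 1) * (c + 1) ^ (e + 1) = (c+1)^(e+1) + c * ((e + 1) * (c + 1) ^ e) + (e+1) * (c+1)^e := by ring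
    rw [h5, h6]
    nlinarith [mul_nonneg h4 h3]

lemma sum_pow_bounds (A e : ℕ) :
    ((e : ℝ) + 1) * ∑ c ∈ Finset.range A, (c : ℝ) ^ e ≤ (A : ℝ) ^ (e + 1) ∧
    (A : ℝ) ^ (e + 1) ≤ ((e : ℝ) + 1) * ∑ c ∈ Finset.range A, ((c : ℝ) + 1) ^ e := by
  induction A with
  | zero => simp
  | succ A ih =>
    rw [Finset.sum_range_succ, Finset.sum_range_succ, mul_add, mul_add]
    push_cast
    have h1 := pow_diff_lower A (Nat.cast_nonneg A) e
    have h2 := pow_diff_upper A (Nat.cast_nonneg A) e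
    constructor <;> linarith [ih.1, ih.2]

lemma sum_pow_shift (A e : ℕ) : ∑ c ∈ Finset.range A, ((c : ℝ) + 1) ^ e ≤
    ∑ c ∈ Finset.range A, (c : ℝ) ^ e + (A : ℝ) ^ e := by
  have h1 := Finset.sum_range_succ (fun c : ℕ => (c : ℝ) ^ e) A
  have h2 := Finset.sum_range_succ' (fun c : ℕ => (c : ℝ) ^ e) A
  push_cast at h2
  have : (0:ℝ) ≤ 0 ^ e := by positivity
  linarith

lemma sum_pow_err (A e N : ℕ) (hA : A ≤ N) :
    |((e : ℝ) + 1) * ∑ c ∈ Finset.range A, (c : ℝ) ^ e - (A : ℝ) ^ (e + 1)| * N ≤ (e + 1) * (A * N ^ e) ∧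
    |((e : ℝ) + 1) * ∑ c ∈ Finset.range A, ((c : ℝ) + 1) ^ e - (A : ℝ) ^ (e + 1)| * N ≤ (e + 1) * (A * N ^ e) := by
  have hAN : (A : ℝ) ≤ N := by exact_mod_cast hA
  have hA0 : (0:ℝ) ≤ A := Nat.cast_nonneg _
  rcases Nat.eq_zero_or_pos e with rfl | he
  · simp
  obtain ⟨e, rfl⟩ : ∃ e', e = e' + 1 := ⟨e - 1, by omega⟩
  obtain ⟨h1, h2⟩ := sum_pow_bounds A (e + 1)
  have h3 := sum_pow_shift A (e + 1)
  have h4 : (A : ℝ) ^ (e + 1) * N ≤ A * N ^ (e + 1) := by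
    have : (A : ℝ) ^ e ≤ N ^ e := pow_le_pow_left₀ hA0 hAN e
    calc (A : ℝ) ^ (e + 1) * N = A * N * A ^ e := by ring
      _ ≤ A * N * N ^ e := mul_le_mul_of_nonneg_left this (by positivity)
      _ = _ := by ring
  have hpos : (0:ℝ) ≤ ((e+1 : ℕ) : ℝ) + 1 := by positivity
  have h5 := mul_le_mul_of_nonneg_left h3 hpos
  have h6 := mul_le_mul_of_nonneg_left h4 hpos
  constructor
  · refine le_trans ?_ h6
    rw [← mul_assoc]
    refine mul_le_mul_of_nonneg_right ?_ (Nat.cast_nonneg N)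
    rw [abs_le]; constructor <;> nlinarith
  · refine le_trans ?_ h6
    rw [← mul_assoc]
    refine mul_le_mul_of_nonneg_right ?_ (Nat.cast_nonneg N)
    rw [abs_le]; constructor <;> nlinarith

lemma layer (m : ℕ → ℕ) (hm : Antitone m) (M K : ℕ) (hK : ∀ c, m c ≤ K) (f : ℕ → ℝ) :
    ∑ c ∈ Finset.range M, (m c : ℝ) * f c =
      ∑ i ∈ Finset.range K, ∑ c ∈ Finset.range ((Finset.range M).filter (fun c => i < m c)).card, f c := by
  have h1 : ∀ i, Finset.range ((Finset.range M).filter (fun c => i < m c)).card =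
      (Finset.range M).filter (fun c => i < m c) := by
    intro i
    have hlow : ∀ c ∈ (Finset.range M).filter (fun c => i < m c), ∀ b < c,
        b ∈ (Finset.range M).filter (fun c => i < m c) := by
      intro c hc b hb
      simp only [Finset.mem_filter, Finset.mem_range] at hc ⊢
      exact ⟨by omega, lt_of_lt_of_le hc.2 (hm hb.le)⟩
    generalize (Finset.range M).filter (fun c => i < m c) = s at hlow
    have hsub : s ⊆ Finset.range s.card := by
      intro c hc
      have : Finset.range (c + 1) ⊆ s := by
        intro b hb
        rw [Finset.mem_range] at hb
        rcases Nat.lt_succ_iff_lt_or_eq.1 hb with h | h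
        · exact hlow c hc b h
        · rwa [h]
      have := Finset.card_le_card this
      rw [Finset.card_range] at this
      exact Finset.mem_range.2 this
    exact (Finset.eq_of_subset_of_card_le hsub (by simp)).symm
  simp only [h1, Finset.sum_filter]
  rw [Finset.sum_comm]
  refine Finset.sum_congr rfl fun c _ => ?_
  rw [← Finset.sum_filter, Finset.sum_const, nsmul_eq_mul]
  congr 2
  have : (Finset.range K).filter (fun i => i < m c) = Finset.range (m c) := by
    ext i; simp only [Finset.mem_filter, Finset.mem_range]; have := hK c; omega
  rw [this, Finset.card_range]

lemma exists_weights (N : ℕ) (hN : 0 < N) (z : ℕ → ℤ)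
    (hp : ∀ c : ℕ, ((Finset.range N).filter (fun j => z j = (c : ℤ) + 1)).card ≤
      ((Finset.range N).filter (fun j => z j = (c : ℤ))).card)
    (hn : ∀ c : ℕ, ((Finset.range N).filter (fun j => z j = -(c : ℤ) - 1)).card ≤
      ((Finset.range N).filter (fun j => z j = -(c : ℤ))).card) :
    ∃ ws : List (Bool × ℝ), (∀ p ∈ ws, 0 ≤ p.2) ∧ (ws.map Prod.snd).sum = 1 ∧
      ∀ e : ℕ, |((e : ℝ) + 1) * (∑ j ∈ Finset.range N, (z j : ℝ) ^ e) / N ^ (e + 1) - psum (e + 1) ws|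
        ≤ (e + 1) / N := by
  classical
  set mp : ℕ → ℕ := fun c => ((Finset.range N).filter (fun j => z j = (c : ℤ))).card with hmp
  set mn : ℕ → ℕ := fun c => ((Finset.range N).filter (fun j => z j = -(c : ℤ) - 1)).card with hmn
  have hmpa : Antitone mp := antitone_nat_of_succ_le (by intro c; simpa [hmp] using hp c)
  have hmna : Antitone mn := antitone_nat_of_succ_le (by
    intro c
    have := hn (c + 1)
    push_cast at this
    rw [show -((c:ℤ) + 1) = -(c:ℤ) - 1 by ring] at this
    show ((Finset.range N).filter (fun j => z j = -((c + 1 : ℕ) : ℤ) - 1)).card ≤ _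
    push_cast
    rw [show -((c:ℤ) + 1) = -(c:ℤ) - 1 by ring]
    exact this)
  have hmpK : ∀ c, mp c ≤ N := fun c => (Finset.card_filter_le _ _).trans (by simp)
  have hmnK : ∀ c, mn c ≤ N := fun c => (Finset.card_filter_le _ _).trans (by simp)
  set M := (Finset.range N).sup (fun j => (z j).natAbs) + 1 with hM
  have hbd : ∀ j ∈ Finset.range N, (z j).natAbs < M := by
    intro j hj
    have := Finset.le_sup (f := fun j => (z j).natAbs) hj
    omega
  have hsplit : ∀ e : ℕ, ∑ j ∈ Finset.range N, (z j : ℝ) ^ e =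
      ∑ c ∈ Finset.range M, (mp c : ℝ) * (c : ℝ) ^ e +
      ∑ c ∈ Finset.range M, (mn c : ℝ) * ((-1) ^ e * ((c : ℝ) + 1) ^ e) := by
    intro e
    have h1 : ∀ c, (mp c : ℝ) * (c : ℝ) ^ e = ∑ j ∈ Finset.range N, if z j = (c : ℤ) then (c : ℝ) ^ e else 0 := by
      intro c
      rw [← Finset.sum_filter, Finset.sum_const, nsmul_eq_mul]
    have h2 : ∀ c : ℕ, (mn c : ℝ) * ((-1) ^ e * ((c : ℝ) + 1) ^ e) =
        ∑ j ∈ Finset.range N, if z j = -(c : ℤ) - 1 then ((-1) ^ e * ((c : ℝ) + 1) ^ e) else 0 := by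
      intro c
      rw [← Finset.sum_filter, Finset.sum_const, nsmul_eq_mul]
    simp only [h1, h2]
    rw [Finset.sum_comm, Finset.sum_comm (s := Finset.range M) (t := Finset.range N), ← Finset.sum_add_distrib]
    refine Finset.sum_congr rfl fun j hj => ?_
    have hb := hbd j hj
    rcases le_or_gt 0 (z j) with h0 | h0
    · obtain ⟨c, hc⟩ := Int.eq_ofNat_of_zero_le h0
      rw [Finset.sum_eq_single_of_mem c (Finset.mem_range.2 (by omega)), Finset.sum_eq_zero]
      · simp [hc]
      · intro b _; rw [if_neg (by omega)]
      · intro b _ hbc; rw [if_neg (by omega)]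
    · obtain ⟨c, hc⟩ := Int.eq_ofNat_of_zero_le (show 0 ≤ -z j - 1 by omega)
      have hc' : z j = -(c : ℤ) - 1 := by omega
      rw [Finset.sum_eq_zero, Finset.sum_eq_single_of_mem c (Finset.mem_range.2 (by omega))]
      · simp only [hc', if_true, zero_add]
        push_cast
        rw [← mul_pow]; congr 1; ring
      · intro b _ hbc; rw [if_neg (by omega)]
      · intro b _; rw [if_neg (by omega)]
  set A : ℕ → ℕ := fun i => ((Finset.range M).filter (fun c => i < mp c)).card with hA
  set B : ℕ → ℕ := fun i => ((Finset.range M).filter (fun c => i < mn c)).card with hB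
  have hlay : ∀ e : ℕ, ∑ j ∈ Finset.range N, (z j : ℝ) ^ e =
      ∑ i ∈ Finset.range N, ∑ c ∈ Finset.range (A i), (c : ℝ) ^ e +
      ∑ i ∈ Finset.range N, (-1) ^ e * ∑ c ∈ Finset.range (B i), ((c : ℝ) + 1) ^ e := by
    intro e
    rw [hsplit e, layer mp hmpa M N hmpK, layer mn hmna M N hmnK]
    simp only [Finset.mul_sum]; rfl
  have htot : ∑ i ∈ Finset.range N, (A i : ℝ) + ∑ i ∈ Finset.range N, (B i : ℝ) = N := by
    have := hlay 0
    simp at this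
    linarith
  have htot' : ∑ i ∈ Finset.range N, A i + ∑ i ∈ Finset.range N, B i = N := by exact_mod_cast htot
  have hAN : ∀ i ∈ Finset.range N, A i ≤ N := fun i hi => by
    have := Finset.single_le_sum (f := A) (fun _ _ => Nat.zero_le _) hi; omega
  have hBN : ∀ i ∈ Finset.range N, B i ≤ N := fun i hi => by
    have := Finset.single_le_sum (f := B) (fun _ _ => Nat.zero_le _) hi; omega
  have hN' : (0:ℝ) < N := by exact_mod_cast hN
  refine ⟨(List.range N).map (fun i => (true, (A i : ℝ) / N)) ++
    (List.range N).map (fun i => (false, (B i : ℝ) / N)), ?_, ?_, ?_⟩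
  · intro p hp'
    simp only [List.mem_append, List.mem_map] at hp'
    rcases hp' with ⟨i, _, rfl⟩ | ⟨i, _, rfl⟩ <;> positivity
  · simp only [List.map_append, List.map_map, List.sum_append, Function.comp_def]
    have e1 : ∀ f : ℕ → ℝ, ((List.range N).map f).sum = ∑ i ∈ Finset.range N, f i := by
      intro f; rfl
    rw [e1, e1, ← Finset.sum_div, ← Finset.sum_div, ← add_div, htot, div_self hN'.ne']
  · intro e
    have e1 : ∀ f : ℕ → ℝ, ((List.range N).map f).sum = ∑ i ∈ Finset.range N, f i := by
      intro f; rfl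
    have hps : psum (e + 1) ((List.range N).map (fun i => (true, (A i : ℝ) / N)) ++
        (List.range N).map (fun i => (false, (B i : ℝ) / N))) =
        (∑ i ∈ Finset.range N, (A i : ℝ) ^ (e + 1) + ∑ i ∈ Finset.range N, (-1) ^ e * (B i : ℝ) ^ (e + 1)) / N ^ (e + 1) := by
      simp only [psum, List.map_append, List.map_map, List.sum_append, Function.comp_def, e1,
        if_true, div_pow]
      rw [add_div, Finset.sum_div, Finset.sum_div]
      congr 1
      refine Finset.sum_congr rfl fun i _ => ?_
      simp only [Bool.false_eq_true, if_false, pow_succ]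
      ring
    rw [hps, ← sub_div, abs_div, abs_of_pos (pow_pos hN' (e + 1)), div_le_div_iff₀ (pow_pos hN' _) hN', hlay e]
    have e2 : ((e : ℝ) + 1) * (∑ i ∈ Finset.range N, ∑ c ∈ Finset.range (A i), (c : ℝ) ^ e +
          ∑ i ∈ Finset.range N, (-1) ^ e * ∑ c ∈ Finset.range (B i), ((c : ℝ) + 1) ^ e) -
        (∑ i ∈ Finset.range N, (A i : ℝ) ^ (e + 1) + ∑ i ∈ Finset.range N, (-1) ^ e * (B i : ℝ) ^ (e + 1)) =
        ∑ i ∈ Finset.range N, (((e : ℝ) + 1) * ∑ c ∈ Finset.range (A i), (c : ℝ) ^ e - (A i : ℝ) ^ (e + 1)) +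
        ∑ i ∈ Finset.range N, (-1) ^ e * (((e : ℝ) + 1) * ∑ c ∈ Finset.range (B i), ((c : ℝ) + 1) ^ e - (B i : ℝ) ^ (e + 1)) := by
      simp only [mul_sub, Finset.sum_sub_distrib, mul_add, Finset.mul_sum]
      have h3 : ∀ c : ℕ, ((e:ℝ) + 1) * ((-1) ^ e * ((c : ℝ) + 1) ^ e) = (-1) ^ e * (((e:ℝ) + 1) * ((c : ℝ) + 1) ^ e) := by
        intros; ring
      simp only [h3]
      ring
    rw [e2]
    calc _ ≤ (∑ i ∈ Finset.range N, |((e : ℝ) + 1) * ∑ c ∈ Finset.range (A i), (c : ℝ) ^ e - (A i : ℝ) ^ (e + 1)| +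
        ∑ i ∈ Finset.range N, |((e : ℝ) + 1) * ∑ c ∈ Finset.range (B i), ((c : ℝ) + 1) ^ e - (B i : ℝ) ^ (e + 1)|) * N := by
          refine mul_le_mul_of_nonneg_right ?_ hN'.le
          refine (abs_add_le _ _).trans (add_le_add (Finset.abs_sum_le_sum_abs _ _) ?_)
          refine (Finset.abs_sum_le_sum_abs _ _).trans (le_of_eq ?_)
          refine Finset.sum_congr rfl fun i _ => ?_
          rw [abs_mul, abs_pow, abs_neg, abs_one, one_pow, one_mul]
      _ ≤ ∑ i ∈ Finset.range N, ((e : ℝ) + 1) * (A i * N ^ e) + ∑ i ∈ Finset.range N, ((e : ℝ) + 1) * (B i * N ^ e) := by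
          rw [add_mul, Finset.sum_mul, Finset.sum_mul]
          exact add_le_add (Finset.sum_le_sum fun i hi => (sum_pow_err _ _ _ (hAN i hi)).1)
            (Finset.sum_le_sum fun i hi => (sum_pow_err _ _ _ (hBN i hi)).2)
      _ = ((e : ℝ) + 1) * N ^ (e + 1) := by
          rw [← Finset.mul_sum, ← Finset.mul_sum, ← mul_add, ← Finset.sum_mul, ← Finset.sum_mul, ← add_mul, htot]
          ring

lemma psum_abs_le (k : ℕ) (hk : 0 < k) (ws : List (Bool × ℝ)) (h0 : ∀ p ∈ ws, 0 ≤ p.2)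
    (h1 : (ws.map Prod.snd).sum ≤ 1) : |psum k ws| ≤ 1 := by
  have key : ∀ ws : List (Bool × ℝ), (∀ p ∈ ws, 0 ≤ p.2) → (ws.map Prod.snd).sum ≤ 1 →
      |psum k ws| ≤ (ws.map Prod.snd).sum := by
    intro ws
    induction ws with
    | nil => intro _ _; simp [psum]
    | cons p ws ih =>
      intro h0 h1
      simp only [List.mem_cons, forall_eq_or_imp] at h0
      simp only [List.map_cons, List.sum_cons] at h1 ⊢
      have hs : 0 ≤ (ws.map Prod.snd).sum := List.sum_nonneg (by
        intro x hx; obtain ⟨p, hp, rfl⟩ := List.mem_map.1 hx; exact h0.2 p hp)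
      have ih' := ih h0.2 (by linarith [h0.1])
      have e : psum k (p :: ws) = (if p.1 then p.2 ^ k else (-1) ^ (k + 1) * p.2 ^ k) + psum k ws := by
        simp [psum]
      rw [e]
      refine (abs_add_le _ _).trans (add_le_add ?_ ih')
      have h2 : |p.2 ^ k| ≤ p.2 := by
        rw [abs_of_nonneg (pow_nonneg h0.1 k)]
        exact pow_le_of_le_one h0.1 (by linarith) hk.ne'
      split
      · exact h2
      · rw [abs_mul, abs_pow, abs_neg, abs_one, one_pow, one_mul]; exact h2
  exact (key ws h0 h1).trans h1
end OV

namespace OV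
open Equiv

section JM
variable {N : ℕ} {V : Type*} [AddCommGroup V] [Module ℂ V] (ρ : Representation ℂ (Perm (Fin N)) V)

/-- Jucys–Murphy operators -/
noncomputable def JM (j : Fin N) : Module.End ℂ V := ∑ b ∈ Finset.Iio j, ρ (swap b j)

lemma JM_conj (σ : Perm (Fin N)) (i j : Fin N) :
    ρ σ * (∑ b ∈ Finset.Iio j, ρ (swap b i)) = (∑ b ∈ (Finset.Iio j).map σ.toEmbedding, ρ (swap b (σ i))) * ρ σ := by
  rw [Finset.mul_sum, Finset.sum_mul, Finset.sum_map]
  refine Finset.sum_congr rfl fun b _ => ?_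
  rw [← map_mul, ← map_mul]
  congr 1
  have := Equiv.swap_apply_apply σ b i
  simp only [Equiv.coe_toEmbedding]
  rw [this]; group

lemma JM_comm (σ : Perm (Fin N)) (j : Fin N) (h1 : σ j = j) (h2 : ∀ b, b < j → σ b < j) :
    Commute (ρ σ) (JM ρ j) := by
  unfold Commute SemiconjBy JM
  rw [JM_conj, h1]
  congr 2
  apply Finset.eq_of_subset_of_card_le
  · intro b hb
    simp only [Finset.mem_map, Finset.mem_Iio] at hb ⊢
    obtain ⟨a, ha, rfl⟩ := hb
    exact h2 a ha
  · simp

lemma JM_comm_JM (i j : Fin N) : Commute (JM ρ i) (JM ρ j) := by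
  have key : ∀ i j : Fin N, i < j → Commute (JM ρ i) (JM ρ j) := by
    intro i j hij
    conv_lhs => unfold JM
    refine Commute.sum_left _ _ _ fun b hb => JM_comm ρ _ _ ?_ ?_
    · rw [Finset.mem_Iio] at hb
      exact swap_apply_of_ne_of_ne (hb.trans hij).ne' hij.ne'
    · rw [Finset.mem_Iio] at hb
      intro c hc
      rcases Equiv.swap_apply_eq_iff.1 (rfl : swap b i c = _) with h
      rw [swap_apply_def]
      split_ifs
      · exact hij
      · exact hb.trans hij
      · exact hc
  rcases lt_trichotomy i j with h | rfl | h
  · exact key _ _ h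
  · exact Commute.refl _
  · exact (key _ _ h).symm

lemma JM_step (i i' : Fin N) (h : (i' : ℕ) = i + 1) :
    ρ (swap i i') * JM ρ i = JM ρ i' * ρ (swap i i') - 1 := by
  have hii : i < i' := by rw [Fin.lt_def]; omega
  have h1 : Finset.Iio i' = insert i (Finset.Iio i) := by
    ext b; simp only [Finset.mem_Iio, Finset.mem_insert, Fin.lt_def, Fin.ext_iff]; omega
  have h2 : (Finset.Iio i).map (swap i i').toEmbedding = Finset.Iio i := by
    apply Finset.eq_of_subset_of_card_le
    · intro b hb
      simp only [Finset.mem_map, Finset.mem_Iio] at hb ⊢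
      obtain ⟨a, ha, rfl⟩ := hb
      simp only [Equiv.coe_toEmbedding]
      rw [swap_apply_of_ne_of_ne ha.ne (ha.trans hii).ne]; exact ha
    · simp
  unfold JM
  rw [JM_conj, h2, swap_apply_left, h1, Finset.sum_insert (by simp), add_mul, ← map_mul, swap_mul_self,
    map_one]
  abel

lemma JM_step' (i i' : Fin N) (h : (i' : ℕ) = i + 1) :
    JM ρ i * ρ (swap i i') = ρ (swap i i') * JM ρ i' - 1 := by
  have h1 := JM_step ρ i i' h
  have h2 : ρ (swap i i') * ρ (swap i i') = 1 := by rw [← map_mul, swap_mul_self, map_one]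
  have h3 : ρ (swap i i') * (ρ (swap i i') * JM ρ i) * ρ (swap i i') = ρ (swap i i') * (JM ρ i' * ρ (swap i i') - 1) * ρ (swap i i') := by
    rw [h1]
  rw [← mul_assoc, h2, one_mul, mul_sub, sub_mul, mul_one, h2] at h3
  rw [h3, mul_assoc, mul_assoc, h2, mul_one]

lemma JM_comm_swap (i i' j : Fin N) (h : (i' : ℕ) = i + 1) (h1 : j ≠ i) (h2 : j ≠ i') :
    Commute (ρ (swap i i')) (JM ρ j) := by
  apply JM_comm
  · exact swap_apply_of_ne_of_ne h1 h2
  · intro b hb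
    rw [swap_apply_def]
    rw [Ne, Fin.ext_iff] at h1 h2
    rw [Fin.lt_def] at *
    split_ifs <;> simp_all [Fin.ext_iff] <;> omega

/-- power sums in two JM elements commute with the simple transposition -/
lemma JM_pow_sum_comm (i i' : Fin N) (h : (i' : ℕ) = i + 1) (e : ℕ) :
    Commute (ρ (swap i i')) (JM ρ i ^ e + JM ρ i' ^ e) := by
  have h1 := JM_step ρ i i' h
  have h2 := JM_step' ρ i i' h
  have hc := JM_comm_JM ρ i i'
  set s := ρ (swap i i')
  set x := JM ρ i
  set y := JM ρ i'
  have c1 : Commute s (x + y) := by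
    unfold Commute SemiconjBy
    have h3 : s * y = x * s + 1 := by rw [h2]; abel
    rw [mul_add, add_mul, h1, h3]; abel
  have c2 : Commute s (x * y) := by
    unfold Commute SemiconjBy
    have h3 : s * y = x * s + 1 := by rw [h2]; abel
    rw [← mul_assoc, h1, sub_mul, one_mul, mul_assoc, h3, mul_add, mul_one, ← mul_assoc, hc.eq]
    abel
  have hxy : x * y = y * x := hc.eq
  have key : ∀ e, Commute s (x ^ e + y ^ e) ∧ Commute s (x ^ (e + 1) + y ^ (e + 1)) := by
    intro e
    induction e with
    | zero =>
      refine ⟨?_, ?_⟩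
      · rw [pow_zero, pow_zero]; exact (Commute.one_right s).add_right (Commute.one_right s)
      · rw [zero_add, pow_one, pow_one]; exact c1
    | succ e ih =>
      refine ⟨ih.2, ?_⟩
      have : x ^ (e + 1 + 1) + y ^ (e + 1 + 1) = (x + y) * (x ^ (e + 1) + y ^ (e + 1)) - (x * y) * (x ^ e + y ^ e) := by
        have e1 : x * y * x ^ e = y * x ^ (e + 1) := by rw [hxy, mul_assoc, pow_succ']
        have e2 : x * y * y ^ e = x * y ^ (e + 1) := by rw [mul_assoc, pow_succ']
        rw [mul_add, add_mul, add_mul, mul_add (x * y), e1, e2, pow_succ' x (e+1), pow_succ' y (e+1)]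
        abel
      rw [this]
      exact (c1.mul_right ih.2).sub_right (c2.mul_right ih.1)
  exact (key e).1

end JM

section central
variable {n : ℕ} {V : Type*} [AddCommGroup V] [Module ℂ V] (ρ : Representation ℂ (Perm (Fin (n + 1))) V)

lemma JM_central (e : ℕ) (σ : Perm (Fin (n + 1))) : Commute (ρ σ) (∑ j, JM ρ j ^ e) := by
  have hσ : σ ∈ Submonoid.closure (Set.range fun i : Fin n ↦ swap i.castSucc i.succ) := by
    rw [Perm.mclosure_swap_castSucc_succ]; trivial
  induction hσ using Submonoid.closure_induction with
  | mem σ h =>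
    obtain ⟨i, rfl⟩ := h
    have hne : i.castSucc ≠ i.succ := by simp [Fin.ext_iff]
    have hsplit : ∑ j, JM ρ j ^ e = (JM ρ i.castSucc ^ e + JM ρ i.succ ^ e) +
        ∑ j ∈ (Finset.univ.erase i.castSucc).erase i.succ, JM ρ j ^ e := by
      rw [add_assoc, Finset.add_sum_erase _ (fun j => JM ρ j ^ e) (by simp [hne.symm]),
        Finset.add_sum_erase _ (fun j => JM ρ j ^ e) (by simp)]
    simp only
    rw [hsplit]
    refine (JM_pow_sum_comm ρ _ _ (by simp) e).add_right (Commute.sum_right _ _ _ fun j hj => ?_)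
    simp only [Finset.mem_erase] at hj
    exact (JM_comm_swap ρ _ _ j (by simp) hj.2.1 hj.1).pow_right e
  | one => rw [map_one]; exact Commute.one_left _
  | mul x y _ _ hx hy => rw [map_mul]; exact hx.mul_left hy

end central

/-- Schur: an operator commuting with an irreducible representation is a scalar as soon as it has an
eigenvector. -/
lemma schur_scalar {G V : Type*} [Group G] [AddCommGroup V] [Module ℂ V] (ρ : Representation ℂ G V)
    (hirr : ∀ W : Submodule ℂ V, (∀ g, ∀ v ∈ W, ρ g v ∈ W) → W = ⊥ ∨ W = ⊤)
    (T : Module.End ℂ V) (hT : ∀ g, Commute (ρ g) T) (c : ℂ) (v : V) (hv : v ≠ 0) (hTv : T v = c • v) :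
    T = c • 1 := by
  rcases hirr (Module.End.eigenspace T c) (by
    intro g w hw
    rw [Module.End.mem_eigenspace_iff] at hw ⊢
    have := congrArg (fun f => f w) (hT g).eq
    simp only [Module.End.mul_apply] at this
    rw [← this, hw, map_smul]) with h | h
  · have : v ∈ Module.End.eigenspace T c := by rw [Module.End.mem_eigenspace_iff, hTv]
    rw [h] at this
    exact absurd this hv
  · ext w
    have : w ∈ Module.End.eigenspace T c := by rw [h]; trivial
    rw [Module.End.mem_eigenspace_iff] at this
    simpa using this

section unitary
variable {N : ℕ} {V : Type*} [NormedAddCommGroup V] [InnerProductSpace ℂ V] 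
  (ρ : Representation ℂ (Perm (Fin N)) V)

/-- set of content sequences -/
def contents : Set (ℕ → ℂ) := {a | ∃ v : V, v ≠ 0 ∧ ∀ j : Fin N, JM ρ j v = a j • v}

lemma swap_symm (hu : ∀ σ v w, inner ℂ (ρ σ v) (ρ σ w) = inner ℂ v w) (i j : Fin N) (v w : V) :
    inner ℂ (ρ (swap i j) v) w = inner ℂ v (ρ (swap i j) w) := by
  rw [← hu (swap i j) v, ← Module.End.mul_apply, ← map_mul, swap_mul_self, map_one]; rfl

lemma JM_symm (hu : ∀ σ v w, inner ℂ (ρ σ v) (ρ σ w) = inner ℂ v w) (j : Fin N) :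
    (JM ρ j).IsSymmetric := by
  intro v w
  simp only [JM, LinearMap.sum_apply, sum_inner, inner_sum, swap_symm ρ hu]

lemma contents_inner (hu : ∀ σ v w, inner ℂ (ρ σ v) (ρ σ w) = inner ℂ v w) (i i' : Fin N)
    (h : (i' : ℕ) = i + 1) (v : V) (a b : ℂ) (ha : JM ρ i v = a • v) (hb : JM ρ i' v = b • v) :
    (b - a) * inner ℂ v (ρ (swap i i') v) = inner ℂ v v := by
  have h1 := congrArg (fun f => f v) (JM_step ρ i i' h)
  simp only [Module.End.mul_apply, LinearMap.sub_apply, ha, map_smul, Module.End.one_apply] at h1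
  have h2 : inner ℂ v (JM ρ i' (ρ (swap i i') v)) = b * inner ℂ v (ρ (swap i i') v) := by
    have h0 : b * inner ℂ v v = (starRingEnd ℂ) b * inner ℂ v v := by
      have := JM_symm ρ hu i' v v
      rw [hb, inner_smul_left, inner_smul_right] at this
      exact this.symm
    rw [← JM_symm ρ hu i', hb, inner_smul_left]
    by_cases hv : v = 0
    · simp [hv]
    · rw [mul_right_cancel₀ (inner_self_ne_zero.2 hv) h0.symm]
  have h3 : JM ρ i' (ρ (swap i i') v) = a • ρ (swap i i') v + v := by rw [h1]; abel
  rw [h3, inner_add_right, inner_smul_right] at h2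
  linear_combination -h2

lemma contents_good (hu : ∀ σ v w, inner ℂ (ρ σ v) (ρ σ w) = inner ℂ v w) :
    GoodSet N (contents ρ) := by
  have hpm : ∀ (i i' : Fin N) (h : (i' : ℕ) = i + 1) (v : V) (a b ε : ℂ), JM ρ i v = a • v →
      JM ρ i' v = b • v → b - a = ε → (ε = 1 ∨ ε = -1) → ρ (swap i i') v = ε • v := by
    intro i i' h v a b ε ha hb hab hε
    have h1 := contents_inner ρ hu i i' h v a b ha hb
    rw [hab] at h1
    have h2 : inner ℂ v (ρ (swap i i') v) = ε * inner ℂ v v := by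
      rcases hε with rfl | rfl
      · linear_combination h1
      · linear_combination -h1
    have h2' : inner ℂ (ρ (swap i i') v) v = ε * inner ℂ v v := by rw [swap_symm ρ hu, h2]
    have hc : (starRingEnd ℂ) ε = ε := by rcases hε with rfl | rfl <;> simp
    have h3 : inner ℂ (ρ (swap i i') v - ε • v) (ρ (swap i i') v - ε • v) = 0 := by
      simp only [inner_sub_left, inner_sub_right, inner_smul_left, inner_smul_right, hu, h2, h2', hc]
      rcases hε with rfl | rfl <;> ring
    exact sub_eq_zero.1 (inner_self_eq_zero.1 h3)
  refine ⟨?_, ?_, ?_, ?_⟩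
  · rintro a ⟨v, hv, h⟩ hN
    have := h ⟨0, hN⟩
    have h0 : JM ρ ⟨0, hN⟩ = 0 := by
      unfold JM
      rw [Finset.sum_eq_zero]
      intro b hb
      rw [Finset.mem_Iio, Fin.lt_def] at hb
      exact absurd hb (by simp)
    rw [h0] at this
    simp only [LinearMap.zero_apply] at this
    rcases smul_eq_zero.1 this.symm with h | h
    · exact h
    · exact absurd h hv
  · rintro a ⟨v, hv, h⟩ i hi heq
    have h1 := contents_inner ρ hu ⟨i, by omega⟩ ⟨i + 1, hi⟩ rfl v _ _ (h _) (h _)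
    simp only [heq, sub_self, zero_mul] at h1
    exact hv (inner_self_eq_zero.1 h1.symm)
  · rintro a ⟨v, hv, h⟩ i hi hp hm
    set i0 : Fin N := ⟨i, by omega⟩
    set i1 : Fin N := ⟨i + 1, hi⟩
    have hii : (i1 : ℕ) = i0 + 1 := rfl
    have h1 := contents_inner ρ hu i0 i1 rfl v _ _ (h _) (h _)
    have ha : JM ρ i0 v = a i • v := h i0
    have hb : JM ρ i1 v = a (i + 1) • v := h i1
    have hd : a (i + 1) - a i ≠ 0 := by
      intro h0
      have : (a i1 - a i0) = 0 := h0
      rw [this, zero_mul] at h1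
      exact hv (inner_self_eq_zero.1 h1.symm)
    set d := a (i + 1) - a i with hdd
    have hinv : ρ (swap i0 i1) (ρ (swap i0 i1) v) = v := by
      rw [← Module.End.mul_apply, ← map_mul, swap_mul_self, map_one]; rfl
    refine ⟨ρ (swap i0 i1) v - d⁻¹ • v, ?_, ?_⟩
    · intro h0
      have h2 : ρ (swap i0 i1) v = d⁻¹ • v := sub_eq_zero.1 h0
      rw [h2, map_smul, h2, smul_smul] at hinv
      have h3 : d⁻¹ * d⁻¹ = 1 := by
        have : (d⁻¹ * d⁻¹ - 1) • v = 0 := by rw [sub_smul, hinv, one_smul, sub_self]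
        rcases smul_eq_zero.1 this with h | h
        · exact sub_eq_zero.1 h
        · exact absurd h hv
      have h4 : (d - 1) * (d + 1) = 0 := by
        field_simp at h3
        linear_combination -h3
      rcases mul_eq_zero.1 h4 with h | h
      · exact hp (sub_eq_zero.1 h)
      · exact hm (eq_neg_of_add_eq_zero_left h)
    · intro j
      by_cases hj0 : j = i0
      · subst hj0
        have e1 : (a ∘ swap i (i + 1)) (i0 : ℕ) = a (i + 1) := by simp [i0]
        have h2 := congrArg (fun f => f v) (JM_step' ρ i0 i1 rfl)
        simp only [Module.End.mul_apply, LinearMap.sub_apply, hb, map_smul, Module.End.one_apply] at h2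
        have e2 : d⁻¹ * a (i + 1) = 1 + d⁻¹ * a i := by
          rw [← sub_eq_iff_eq_add, ← mul_sub, ← hdd, inv_mul_cancel₀ hd]
        rw [e1, map_sub, map_smul, ha, h2, smul_sub, smul_smul, smul_smul, mul_comm (a (i+1)), e2, add_smul, one_smul]
        abel
      by_cases hj1 : j = i1
      · subst hj1
        have e1 : (a ∘ swap i (i + 1)) (i1 : ℕ) = a i := by simp [i1]
        have h2 := congrArg (fun f => f v) (JM_step ρ i0 i1 rfl)
        simp only [Module.End.mul_apply, LinearMap.sub_apply, ha, map_smul, Module.End.one_apply] at h2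
        have h3 : JM ρ i1 (ρ (swap i0 i1) v) = a i • ρ (swap i0 i1) v + v := by rw [h2]; abel
        have e2 : d⁻¹ * a (i + 1) = 1 + d⁻¹ * a i := by
          rw [← sub_eq_iff_eq_add, ← mul_sub, ← hdd, inv_mul_cancel₀ hd]
        rw [e1, map_sub, map_smul, hb, h3, smul_sub, smul_smul, smul_smul, e2, add_smul, one_smul, mul_comm (a i)]
        abel
      · have e1 : (a ∘ swap i (i + 1)) (j : ℕ) = a j := by
          simp only [Function.comp]
          rw [swap_apply_of_ne_of_ne]
          · intro h'; exact hj0 (Fin.ext h')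
          · intro h'; exact hj1 (Fin.ext h')
        have h2 := congrArg (fun f => f v) (JM_comm_swap ρ i0 i1 j rfl hj0 hj1).eq
        simp only [Module.End.mul_apply, h j, map_smul] at h2
        rw [e1, map_sub, map_smul, ← h2, h j, smul_sub, smul_comm]
  · rintro a ⟨v, hv, h⟩ i hi heq
    have key : ∀ ε : ℂ, (ε = 1 ∨ ε = -1) → a (i + 1) - a i ≠ ε := by
      intro ε hε hd
      set i0 : Fin N := ⟨i, by omega⟩
      set i1 : Fin N := ⟨i + 1, by omega⟩
      set i2 : Fin N := ⟨i + 2, hi⟩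
      have h1 := hpm i0 i1 rfl v _ _ ε (h _) (h _) hd hε
      have h2 := hpm i1 i2 rfl v _ _ (-ε) (h _) (h _) (by
        show a (i + 2) - a (i + 1) = -ε
        rw [← heq, ← hd]; ring) (by rcases hε with rfl | rfl <;> simp)
      have hbr : swap i0 i1 * swap i1 i2 * swap i0 i1 = swap i1 i2 * swap i0 i1 * swap i1 i2 := by
        have a1 : i0 ≠ i1 := by simp [i0, i1]
        have a2 : i0 ≠ i2 := by simp [i0, i2]
        have a3 : i1 ≠ i2 := by simp [i1, i2]
        have b1 := swap_mul_swap_mul_swap (x := i0) (y := i1) (z := i2) a1 a2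
        have b2 := swap_mul_swap_mul_swap (x := i2) (y := i1) (z := i0) a3.symm a2.symm
        rw [swap_comm i1 i2] at *
        rw [swap_comm i0 i1] at *
        rw [b1, b2, swap_comm]
      have h3 := congrArg (fun σ => ρ σ v) hbr
      simp only [map_mul, Module.End.mul_apply, h1, h2, map_smul, smul_smul] at h3
      have h4 : (ε * (-ε * ε) - (-ε) * (ε * (-ε))) • v = 0 := by
        rw [sub_smul, h3, sub_self]
      rcases smul_eq_zero.1 h4 with h5 | h5
      · rcases hε with rfl | rfl <;> norm_num at h5
      · exact hv h5
    exact ⟨key 1 (Or.inl rfl), key (-1) (Or.inr rfl)⟩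

end unitary
end OV

namespace OV
set_option linter.unusedSectionVars false
open Equiv

/-- product of star transpositions -/
def starP {N : ℕ} (j : Fin N) (bs : List (Fin N)) : Perm (Fin N) := (bs.map (fun b => swap b j)).prod

lemma starP_eq {N : ℕ} (j : Fin N) (bs : List (Fin N)) (h : (j :: bs).Nodup) :
    starP j bs = List.formPerm (j :: bs.reverse) := by
  induction bs with
  | nil => simp [starP]
  | cons b bs ih =>
    have h1 : (j :: bs).Nodup := by
      simp only [List.nodup_cons, List.mem_cons] at h ⊢
      tauto
    have h2 : starP j (b :: bs) = swap b j * starP j bs := by simp [starP]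
    rw [h2, ih h1, ← List.formPerm_cons_cons]
    have hnd : (b :: j :: bs.reverse).Nodup := by
      simp only [List.nodup_cons, List.mem_cons, List.mem_reverse, List.nodup_reverse] at h ⊢
      refine ⟨?_, ?_, h.2.2⟩
      · rintro (rfl | h3)
        · exact h.1 (Or.inl rfl)
        · exact h.2.1 h3
      · exact fun h3 => h.1 (Or.inr h3)
    rw [← List.formPerm_rotate_one _ hnd]
    simp

lemma starP_isCycle {N : ℕ} (j : Fin N) (bs : List (Fin N)) (h : (j :: bs).Nodup) (hb : bs ≠ []) :
    (starP j bs).IsCycle ∧ (starP j bs).support = (j :: bs).toFinset := by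
  rw [starP_eq j bs h]
  have hnd : (j :: bs.reverse).Nodup := by simpa using h
  have hlen : 1 ≤ bs.length := by
    rcases bs with _ | ⟨b, bs⟩
    · exact absurd rfl hb
    · simp
  refine ⟨List.isCycle_formPerm hnd (by simp; omega), ?_⟩
  rw [List.support_formPerm_of_nodup _ hnd]
  · ext x; simp
  · intro x hx
    have := congrArg List.length hx
    simp at this
    exact hb this

lemma starP_conj {N : ℕ} (j : Fin N) (bs : List (Fin N)) (h : (j :: bs).Nodup) (hb : bs ≠ [])
    (c τ : Perm (Fin N)) (hc : c.IsCycle) (hcard : c.support.card = bs.length + 1) (hd : c.Disjoint τ)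
    (hτ : ∀ x ∈ j :: bs, x ∉ τ.support) : IsConj (starP j bs * τ) (c * τ) := by
  obtain ⟨h1, h2⟩ := starP_isCycle j bs h hb
  rw [Perm.isConj_iff_cycleType_eq, Perm.Disjoint.cycleType_mul, Perm.Disjoint.cycleType_mul hd,
    h1.cycleType, hc.cycleType, hcard, h2, List.toFinset_card_of_nodup h]
  · simp
  · rw [Perm.disjoint_iff_disjoint_support, h2, Finset.disjoint_left]
    intro x hx
    exact hτ x (by simpa using hx)

section trace
variable {N : ℕ} {V : Type*} [AddCommGroup V] [Module ℂ V] (ρ : Representation ℂ (Perm (Fin N)) V)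

lemma JM_pow (j : Fin N) (e : ℕ) : JM ρ j ^ e =
    ∑ f : Fin e → Fin N, if ∀ i, f i < j then ρ (starP j (List.ofFn f)) else 0 := by
  induction e with
  | zero => simp [starP]
  | succ e ih =>
    rw [pow_succ', ih, ← (Fin.consEquiv (fun _ : Fin (e+1) => Fin N)).sum_comp, Fintype.sum_prod_type]
    have hJ : JM ρ j = ∑ b, if b < j then ρ (swap b j) else 0 := by
      unfold JM
      rw [← Finset.sum_filter]
      congr 1
      ext b; simp
    rw [hJ, Finset.sum_mul]
    refine Finset.sum_congr rfl fun b _ => ?_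
    rw [Finset.mul_sum]
    refine Finset.sum_congr rfl fun f _ => ?_
    have : (∀ i, (Fin.consEquiv (fun _ : Fin (e+1) => Fin N)) (b, f) i < j) ↔ (b < j ∧ ∀ i, f i < j) := by
      simp [Fin.forall_fin_succ]
    simp only [this]
    by_cases h1 : b < j <;> by_cases h2 : ∀ i, f i < j <;> simp only [h1, h2, if_true, if_false, and_true, and_false, implies_true, mul_zero, zero_mul]
    rw [← map_mul]
    simp [starP]

lemma JM_pow_sum (e : ℕ) : ∑ j, JM ρ j ^ e =
    ∑ g : Fin (e + 1) → Fin N, if ∀ i : Fin e, g i.succ < g 0 then ρ (starP (g 0) (List.ofFn fun i : Fin e => g i.succ)) else 0 := by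
  rw [← (Fin.consEquiv (fun _ : Fin (e+1) => Fin N)).sum_comp, Fintype.sum_prod_type]
  refine Finset.sum_congr rfl fun b _ => ?_
  rw [JM_pow]
  simp

lemma count_lt (e : ℕ) : (∑ g : Fin (e + 1) → Fin N, if ∀ i : Fin e, g i.succ < g 0 then (1:ℝ) else 0) =
    ∑ c ∈ Finset.range N, (c : ℝ) ^ e := by
  rw [← (Fin.consEquiv (fun _ : Fin (e+1) => Fin N)).sum_comp, Fintype.sum_prod_type, Finset.sum_range]
  refine Finset.sum_congr rfl fun b _ => ?_
  simp only [Fin.consEquiv_apply, Fin.cons_succ, Fin.cons_zero]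
  rw [← Finset.sum_filter, Finset.sum_const, nsmul_eq_mul, mul_one]
  have : (Finset.univ.filter fun f : Fin e → Fin N => ∀ i, f i < b) = Fintype.piFinset (fun _ => Finset.Iio b) := by
    ext f; simp [Fintype.mem_piFinset]
  rw [this, Fintype.card_piFinset]
  simp

end trace

lemma card_det {N e : ℕ} (S : Finset (Fin (e + 1) → Fin N)) (a : Fin (e + 1))
    (h : ∀ g ∈ S, ∀ g' ∈ S, (∀ b, b ≠ a → g b = g' b) → g a = g' a) : S.card ≤ N ^ e := by
  have : S.card ≤ (Finset.univ : Finset (Fin e → Fin N)).card := by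
    apply Finset.card_le_card_of_injOn (fun g i => g (a.succAbove i)) (fun _ _ => Finset.mem_univ _)
    intro g hg g' hg' hgg
    have h1 : ∀ b, b ≠ a → g b = g' b := by
      intro b hb
      obtain ⟨i, rfl⟩ := Fin.exists_succAbove_eq hb
      exact congrFun hgg i
    funext b
    by_cases hb : b = a
    · rw [hb]; exact h g hg g' hg' h1
    · exact h1 b hb
  simpa using this

lemma card_bad {N e : ℕ} (T : Finset (Fin N)) :
    (Finset.univ.filter fun g : Fin (e + 1) → Fin N => ¬ (Function.Injective g ∧ ∀ i, g i ∉ T)).card ≤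
      ((e + 1) * T.card + (e + 1) ^ 2) * N ^ e := by
  classical
  have hsub : (Finset.univ.filter fun g : Fin (e + 1) → Fin N => ¬ (Function.Injective g ∧ ∀ i, g i ∉ T)) ⊆
      ((Finset.univ ×ˢ T).biUnion fun p : Fin (e + 1) × Fin N => Finset.univ.filter fun g : Fin (e + 1) → Fin N => g p.1 = p.2) ∪
      ((Finset.univ : Finset (Fin (e + 1) × Fin (e + 1))).biUnion fun p => Finset.univ.filter fun g : Fin (e + 1) → Fin N => p.1 ≠ p.2 ∧ g p.1 = g p.2) := by
    intro g hg
    simp only [Finset.mem_filter, Finset.mem_univ, true_and, not_and_or, Finset.mem_union, Finset.mem_biUnion,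
      Finset.mem_product, Prod.exists] at hg ⊢
    rcases hg with hg | hg
    · right
      simp only [Function.Injective] at hg
      push Not at hg
      obtain ⟨a, b, h1, h2⟩ := hg
      exact ⟨a, b, h2, h1⟩
    · left
      push Not at hg
      obtain ⟨i, hi⟩ := hg
      exact ⟨i, g i, hi, rfl⟩
  refine (Finset.card_le_card hsub).trans ((Finset.card_union_le _ _).trans ?_)
  rw [add_mul]
  refine Nat.add_le_add ?_ ?_
  · refine (Finset.card_biUnion_le_card_mul _ _ (N ^ e) ?_).trans (by simp)
    intro p _
    apply card_det _ p.1
    intro g hg g' hg' _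
    simp only [Finset.mem_filter, Finset.mem_univ, true_and] at hg hg'
    rw [hg, hg']
  · refine (Finset.card_biUnion_le_card_mul _ _ (N ^ e) ?_).trans (by simp [sq])
    intro p _
    apply card_det _ p.1
    intro g hg g' hg' h
    simp only [Finset.mem_filter, Finset.mem_univ, true_and] at hg hg'
    rw [hg.2, hg'.2, h _ hg.1.symm]

section final
variable {V : Type*} [NormedAddCommGroup V] [InnerProductSpace ℂ V] [FiniteDimensional ℂ V]

lemma trace_le {G : Type*} [Group G] (ρ : Representation ℂ G V)
    (hu : ∀ σ v w, inner ℂ (ρ σ v) (ρ σ w) = inner ℂ v w) (σ : G) :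
    ‖LinearMap.trace ℂ V (ρ σ)‖ ≤ Module.finrank ℂ V := by
  have b := stdOrthonormalBasis ℂ V
  rw [LinearMap.trace_eq_sum_inner _ b]
  refine (norm_sum_le _ _).trans ?_
  refine (Finset.sum_le_card_nsmul _ _ 1 ?_).trans (by simp)
  intro i _
  refine (norm_inner_le_norm _ _).trans ?_
  have h1 : ‖ρ σ (b i)‖ = ‖b i‖ := by
    have := hu σ (b i) (b i)
    rw [inner_self_eq_norm_sq_to_K, inner_self_eq_norm_sq_to_K] at this
    have h2 : ‖ρ σ (b i)‖ ^ 2 = ‖b i‖ ^ 2 := by exact_mod_cast this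
    exact (pow_left_inj₀ (norm_nonneg _) (norm_nonneg _) two_ne_zero).1 h2
  rw [h1]; simp

/-- normalized character -/
noncomputable def nchar {G : Type*} [Group G] (ρ : Representation ℂ G V) (σ : G) : ℂ :=
  LinearMap.trace ℂ V (ρ σ) / Module.finrank ℂ V

lemma nchar_le {G : Type*} [Group G] (ρ : Representation ℂ G V)
    (hu : ∀ σ v w, inner ℂ (ρ σ v) (ρ σ w) = inner ℂ v w) (σ : G) : ‖nchar ρ σ‖ ≤ 1 := by
  unfold nchar
  rw [norm_div, Complex.norm_natCast]
  exact div_le_one_of_le₀ (trace_le ρ hu σ) (Nat.cast_nonneg _)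

lemma nchar_conj {G : Type*} [Group G] (ρ : Representation ℂ G V) (σ τ : G) (h : IsConj σ τ) :
    nchar ρ σ = nchar ρ τ := by
  obtain ⟨c, rfl⟩ := isConj_iff.1 h
  unfold nchar
  have e1 : ρ (c * σ * c⁻¹) = ρ c * ρ σ * ρ c⁻¹ := by simp only [map_mul]
  have e2 : ρ c⁻¹ * ρ c = 1 := by rw [← map_mul]; simp
  rw [e1, LinearMap.trace_mul_comm, ← mul_assoc, e2, one_mul]

variable {N : ℕ} (ρ : Representation ℂ (Perm (Fin N)) V)


lemma JM_central' (e : ℕ) (σ : Perm (Fin N)) : Commute (ρ σ) (∑ j, JM ρ j ^ e) := by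
  cases N with
  | zero => simp
  | succ n => exact JM_central ρ e σ


lemma joint_eigen [Nontrivial V] (hu : ∀ σ v w, inner ℂ (ρ σ v) (ρ σ w) = inner ℂ v w) :
    ∃ a, a ∈ contents ρ := by
  have h := LinearMap.IsSymmetric.iSup_iInf_eq_top_of_commute (T := JM ρ) (JM_symm ρ hu)
    (fun i j _ => JM_comm_JM ρ i j)
  have : ∃ χ : Fin N → ℂ, (⨅ i, Module.End.eigenspace (JM ρ i) (χ i)) ≠ ⊥ := by
    by_contra hcon
    push Not at hcon
    rw [iSup_congr hcon] at h
    simp at h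
  obtain ⟨χ, hχ⟩ := this
  obtain ⟨v, hv, hv0⟩ := Submodule.exists_mem_ne_zero_of_ne_bot hχ
  refine ⟨fun j => if hj : j < N then χ ⟨j, hj⟩ else 0, v, hv0, fun j => ?_⟩
  rw [Submodule.mem_iInf] at hv
  have := hv j
  rw [Module.End.mem_eigenspace_iff] at this
  rw [this]; congr 1; simp

theorem weights_of_irrep (hN : 0 < N) [Nontrivial V] (hu : ∀ σ v w, inner ℂ (ρ σ v) (ρ σ w) = inner ℂ v w)
    (hirr : ∀ W : Submodule ℂ V, (∀ g, ∀ v ∈ W, ρ g v ∈ W) → W = ⊥ ∨ W = ⊤) :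
    ∃ ws : List (Bool × ℝ), (∀ p ∈ ws, 0 ≤ p.2) ∧ (ws.map Prod.snd).sum = 1 ∧
      ∀ (m : ℕ) (σ : Perm (Fin N)), σ.support.card ≤ m →
        ‖nchar ρ σ - ((σ.cycleType.map (fun k => psum k ws)).prod : ℝ)‖ ≤ 
          (4 * (m:ℝ) ^ 3 + 2 * m) * m / N := by
  obtain ⟨a, ha⟩ := joint_eigen ρ hu
  have hgood := contents_good ρ hu
  choose! z hz using hgood.int a ha
  obtain ⟨ws, hw0, hw1, hws⟩ := exists_weights N hN z (hgood.mono_pos a ha z hz)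
    (hgood.mono_neg a ha z hz)
  refine ⟨ws, hw0, hw1, ?_⟩
  obtain ⟨v, hv0, hv⟩ := ha
  have hNpos : (0:ℝ) < N := by exact_mod_cast hN
  have hd0 : (Module.finrank ℂ V : ℂ) ≠ 0 := by
    have : 0 < Module.finrank ℂ V := Module.finrank_pos
    exact_mod_cast this.ne'
  -- scalar action
  have hZ : ∀ e : ℕ, ∑ j, JM ρ j ^ e = (((∑ j ∈ Finset.range N, (z j : ℝ) ^ e : ℝ) : ℂ)) • 1 := by
    intro e
    apply schur_scalar ρ hirr _ (JM_central' ρ e) _ v hv0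
    have h1 : ∀ (j : Fin N) (e : ℕ), (JM ρ j ^ e) v = (a j) ^ e • v := by
      intro j e
      induction e with
      | zero => simp
      | succ e ih => rw [pow_succ', Module.End.mul_apply, ih, map_smul, hv, smul_smul, pow_succ]
    rw [LinearMap.sum_apply, Finset.sum_congr rfl (fun j _ => h1 j e), ← Finset.sum_smul]
    congr 1
    rw [Finset.sum_range]
    push_cast
    refine Finset.sum_congr rfl fun j _ => ?_
    rw [hz j j.2]
  -- main step
  have hstep : ∀ (c τ : Perm (Fin N)) (e : ℕ), c.IsCycle → c.support.card = e + 1 → c.Disjoint τ →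
      ‖(((∑ j ∈ Finset.range N, (z j : ℝ) ^ e : ℝ) : ℂ)) * nchar ρ τ -
        (((∑ c ∈ Finset.range N, (c : ℝ) ^ e : ℝ) : ℂ)) * nchar ρ (c * τ)‖ ≤
        2 * (((e + 1) * τ.support.card + (e + 1) ^ 2) * N ^ e : ℕ) := by
    intro c τ e hc hcard hdis
    have he : e ≠ 0 := by
      have := hc.two_le_card_support
      omega
    have h1 : (((∑ j ∈ Finset.range N, (z j : ℝ) ^ e : ℝ) : ℂ)) * nchar ρ τ = 
        ∑ g : Fin (e + 1) → Fin N, if ∀ i : Fin e, g i.succ < g 0 then nchar ρ (starP (g 0) (List.ofFn fun i : Fin e => g i.succ) * τ) else 0 := by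
      have h2 := congrArg (fun T => LinearMap.trace ℂ V (T * ρ τ) / (Module.finrank ℂ V : ℂ)) (hZ e)
      simp only [smul_mul_assoc, one_mul, map_smul, smul_eq_mul] at h2
      rw [mul_div_assoc] at h2
      unfold nchar
      rw [← h2, JM_pow_sum, Finset.sum_mul, map_sum, Finset.sum_div]
      refine Finset.sum_congr rfl fun g _ => ?_
      split_ifs
      · rw [← map_mul ρ]
      · simp
    rw [h1, ← count_lt]
    push_cast
    rw [Finset.sum_mul, ← Finset.sum_sub_distrib]
    refine (norm_sum_le _ _).trans ?_
    have h3 : ∀ g : Fin (e + 1) → Fin N, 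
        ‖(if ∀ i : Fin e, g i.succ < g 0 then nchar ρ (starP (g 0) (List.ofFn fun i : Fin e => g i.succ) * τ) else 0) -
          ((if ∀ i : Fin e, g i.succ < g 0 then (1:ℝ) else 0 : ℝ) : ℂ) * nchar ρ (c * τ)‖ ≤
        if ¬ (Function.Injective g ∧ ∀ i, g i ∉ τ.support) then 2 else 0 := by
      intro g
      by_cases hlt : ∀ i : Fin e, g i.succ < g 0
      · simp only [hlt, implies_true, if_true, Complex.ofReal_one, one_mul]
        by_cases hgood : ¬ (Function.Injective g ∧ ∀ i, g i ∉ τ.support)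
        · rw [if_pos hgood]
          refine (norm_sub_le _ _).trans ?_
          have := nchar_le ρ hu (starP (g 0) (List.ofFn fun i : Fin e => g i.succ) * τ)
          have := nchar_le ρ hu (c * τ)
          linarith
        · rw [if_neg hgood]
          rw [not_not] at hgood
          rw [nchar_conj ρ _ (c * τ), sub_self, norm_zero]
          have hl : (g 0 :: List.ofFn fun i : Fin e => g i.succ) = List.ofFn g := by rw [List.ofFn_succ]
          apply starP_conj _ _ _ _ c τ hc _ hdis
          · rw [hl]
            intro x hx
            rw [List.mem_ofFn] at hx
            obtain ⟨i, rfl⟩ := hx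
            exact hgood.2 i
          · rw [hl]
            exact List.nodup_ofFn.2 hgood.1
          · intro h
            have := congrArg List.length h
            simp at this
            exact he this
          · simpa using hcard
      · simp only [hlt, if_false, Complex.ofReal_zero, zero_mul, sub_zero, norm_zero]
        split_ifs <;> norm_num
    refine (Finset.sum_le_sum fun g _ => h3 g).trans ?_
    rw [← Finset.sum_filter, Finset.sum_const, nsmul_eq_mul, mul_comm]
    have := card_bad (N := N) (e := e) τ.support
    have h4 : ((Finset.univ.filter fun g : Fin (e + 1) → Fin N => ¬ (Function.Injective g ∧ ∀ i, g i ∉ τ.support)).card : ℝ) ≤ (((e + 1) * τ.support.card + (e + 1) ^ 2) * N ^ e : ℕ) := by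
      exact_mod_cast this
    push_cast at h4 ⊢
    linarith
  have hstep2 : ∀ (c τ : Perm (Fin N)) (m : ℕ), c.IsCycle → c.Disjoint τ → c.support.card ≤ m → τ.support.card ≤ m →
      ‖nchar ρ (c * τ) - ((psum c.support.card ws : ℝ) : ℂ) * nchar ρ τ‖ ≤ (4 * (m:ℝ) ^ 3 + 2 * m) / N := by
    intro c τ m hc hdis hcm hτm
    obtain ⟨e, he⟩ : ∃ e, c.support.card = e + 1 := ⟨c.support.card - 1, by have := hc.two_le_card_support; omega⟩
    have h1 := hstep c τ e hc he hdis
    have h2 := hws e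
    have h3 := (sum_pow_err N e N le_rfl).1
    rw [he] at hcm ⊢
    have hem : (e : ℝ) + 1 ≤ m := by exact_mod_cast hcm
    have hτm' : (τ.support.card : ℝ) ≤ m := by exact_mod_cast hτm
    set Z := (∑ j ∈ Finset.range N, (z j : ℝ) ^ e : ℝ)
    set S := ∑ c ∈ Finset.range N, (c : ℝ) ^ e
    set P : ℝ := (N:ℝ) ^ (e + 1) with hP
    have hPpos : 0 < P := by positivity
    have hPe : (N:ℝ) ^ e = P / N := by rw [hP, pow_succ]; field_simp
    have h4 : nchar ρ (c * τ) - ((psum (e+1) ws : ℝ) : ℂ) * nchar ρ τ =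
        ((((e:ℝ) + 1) * Z / P - psum (e+1) ws : ℝ) : ℂ) * nchar ρ τ
        - ((((e:ℝ) + 1) / P : ℝ) : ℂ) * ((Z : ℂ) * nchar ρ τ - (S : ℂ) * nchar ρ (c * τ))
        - (((((e:ℝ) + 1) * S - P) / P : ℝ) : ℂ) * nchar ρ (c * τ) := by
      have hP0 : (P : ℂ) ≠ 0 := by exact_mod_cast hPpos.ne'
      push_cast
      field_simp
      ring
    rw [h4]
    refine (norm_sub_le _ _).trans ((add_le_add (norm_sub_le _ _) le_rfl).trans ?_)
    rw [norm_mul, norm_mul, norm_mul, Complex.norm_real, Complex.norm_real, Complex.norm_real, Real.norm_eq_abs, Real.norm_eq_abs, Real.norm_eq_abs]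
    have n1 := nchar_le ρ hu τ
    have n2 := nchar_le ρ hu (c * τ)
    have b1 : |((e:ℝ) + 1) * Z / P - psum (e+1) ws| * ‖nchar ρ τ‖ ≤ m / N := by
      refine (mul_le_of_le_one_right (abs_nonneg _) n1).trans (h2.trans ?_)
      gcongr
    have b3 : |(((e:ℝ) + 1) * S - P) / P| * ‖nchar ρ (c * τ)‖ ≤ m / N := by
      refine (mul_le_of_le_one_right (abs_nonneg _) n2).trans ?_
      rw [abs_div, abs_of_pos hPpos, div_le_div_iff₀ hPpos hNpos]
      refine h3.trans ?_
      rw [← pow_succ', ← hP]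
      gcongr
    have b2 : |((e:ℝ) + 1) / P| * ‖(Z : ℂ) * nchar ρ τ - (S : ℂ) * nchar ρ (c * τ)‖ ≤ 4 * (m:ℝ) ^ 3 / N := by
      rw [abs_of_nonneg (by positivity)]
      refine (mul_le_mul_of_nonneg_left h1 (by positivity)).trans ?_
      push_cast
      rw [hPe]
      have : ((e:ℝ) + 1) / P * (2 * ((((e:ℝ) + 1) * τ.support.card + ((e:ℝ) + 1) ^ 2) * (P / N))) =
          (2 * ((e:ℝ) + 1) * (((e:ℝ) + 1) * τ.support.card + ((e:ℝ) + 1) ^ 2)) / N := by field_simp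
      rw [this]
      refine div_le_div_of_nonneg_right ?_ hNpos.le
      calc 2 * ((e:ℝ) + 1) * (((e:ℝ) + 1) * τ.support.card + ((e:ℝ) + 1) ^ 2) ≤ 
          2 * (m:ℝ) * ((m:ℝ) * m + (m:ℝ) ^ 2) := by gcongr
        _ = _ := by ring
    calc _ ≤ (m:ℝ) / N + 4 * (m:ℝ) ^ 3 / N + m / N := by linarith
      _ = _ := by ring
  have hpsum1 : ∀ c : Perm (Fin N), c.IsCycle → |psum c.support.card ws| ≤ 1 := fun c hc =>
    psum_abs_le _ (by have := hc.two_le_card_support; omega) ws hw0 hw1.le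
  have hone : nchar ρ 1 = 1 := by
    unfold nchar
    rw [map_one, LinearMap.trace_one, div_self hd0]
  intro m σ hσ
  set K := (4 * (m:ℝ) ^ 3 + 2 * m) with hK
  have hK0 : 0 ≤ K := by positivity
  have key : σ.support.card ≤ m → ‖nchar ρ σ - ((σ.cycleType.map (fun k => psum k ws)).prod : ℝ)‖ ≤ K * σ.support.card / N := by
    induction σ using Perm.cycle_induction_on with
    | base_one => intro _; simp [hone]
    | base_cycles c hc =>
      intro hcm
      have := hstep2 c 1 m hc (Perm.disjoint_one_right c) hcm (by simp)
      rw [mul_one, hone, mul_one] at this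
      rw [hc.cycleType]
      simp only [Multiset.map_singleton, Multiset.prod_singleton]
      refine this.trans ?_
      gcongr
      have := hc.two_le_card_support
      have h : (1:ℝ) ≤ c.support.card := by exact_mod_cast (by omega : 1 ≤ c.support.card)
      nlinarith
    | induction_disjoint c τ hdis hc _ ih =>
      intro hcm
      have hcard := hdis.card_support_mul
      rw [hcard] at hcm ⊢
      have h1 := hstep2 c τ m hc hdis (by omega) (by omega)
      have h2 := ih (le_trans (by rw [hdis.card_support_mul]; omega) hσ) (by omega)
      rw [hdis.cycleType_mul, hc.cycleType]
      simp only [Multiset.map_add, Multiset.map_singleton, Multiset.prod_add, Multiset.prod_singleton]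
      set Q := (τ.cycleType.map (fun k => psum k ws)).prod
      set p := psum c.support.card ws with hp
      have h3 : nchar ρ (c * τ) - ((p * Q : ℝ) : ℂ) = (nchar ρ (c * τ) - (p : ℂ) * nchar ρ τ) + (p : ℂ) * (nchar ρ τ - (Q : ℂ)) := by
        push_cast; ring
      rw [h3]
      refine (norm_add_le _ _).trans ?_
      rw [norm_mul, Complex.norm_real, Real.norm_eq_abs]
      have h4 := mul_le_mul (hpsum1 c hc) h2 (norm_nonneg _) zero_le_one
      have := hc.two_le_card_support
      have h : (1:ℝ) ≤ c.support.card := by exact_mod_cast (by omega : 1 ≤ c.support.card)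
      have h5 : K / N ≤ K * c.support.card / N := by gcongr; nlinarith
      calc _ ≤ K / N + 1 * (K * τ.support.card / N) := add_le_add h1 h4
        _ ≤ K * c.support.card / N + K * τ.support.card / N := by linarith
        _ = _ := by push_cast; ring
  refine (key hσ).trans ?_
  gcongr

end final
end OV

open scoped ComplexOrder
namespace OV
set_option linter.unusedSectionVars false
section M3
open Matrix

lemma unitarize_mat {G : Type} [Group G] [Fintype G] {d : Type} [Fintype d] [DecidableEq d]
    (R : G →* Matrix d d ℂ) :
    ∃ M : G → Matrix d d ℂ, (∀ g h, M (g * h) = M g * M h) ∧ (∀ g, M g⁻¹ = (M g)ᴴ) ∧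
      ∀ g, (R g).trace = (M g).trace := by
  classical
  set H : Matrix d d ℂ := ∑ g, (R g)ᴴ * R g with hH
  have hps : H.PosSemidef := Matrix.posSemidef_sum _ (fun g _ => posSemidef_conjTranspose_mul_self _)
  have hpd : H.PosDef := by
    rw [hH, ← Finset.add_sum_erase _ _ (Finset.mem_univ (1 : G))]
    apply Matrix.PosDef.add_posSemidef
    · simp [Matrix.PosDef.one]
    · exact Matrix.posSemidef_sum _ (fun g _ => posSemidef_conjTranspose_mul_self _)
  have hinv : ∀ h, (R h)ᴴ * H * R h = H := by
    intro h
    rw [hH, Finset.mul_sum, Finset.sum_mul]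
    apply Fintype.sum_equiv (Equiv.mulRight h)
    intro g
    simp [conjTranspose_mul, Matrix.mul_assoc]
  obtain ⟨S, hS⟩ : ∃ S : Matrix d d ℂ, H = Sᴴ * S := by
    open scoped MatrixOrder in
    obtain ⟨S, hS⟩ := CStarAlgebra.nonneg_iff_eq_star_mul_self.mp hps.nonneg
    exact ⟨S, hS⟩
  have hSd : IsUnit S.det := by
    have := hpd.det_pos.ne'
    rw [hS, det_mul] at this
    exact (right_ne_zero_of_mul this).isUnit
  have h1 : S⁻¹ * S = 1 := nonsing_inv_mul _ hSd
  have h2 : S * S⁻¹ = 1 := mul_nonsing_inv _ hSd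
  have hM : ∀ g h, S * R (g * h) * S⁻¹ = (S * R g * S⁻¹) * (S * R h * S⁻¹) := by
    intro g h
    calc S * R (g * h) * S⁻¹ = S * R g * 1 * R h * S⁻¹ := by simp [Matrix.mul_assoc]
      _ = _ := by rw [← h1]; simp only [Matrix.mul_assoc]
  refine ⟨fun g => S * R g * S⁻¹, hM, ?_, ?_⟩
  · intro g
    have h3 : (S * R g * S⁻¹)ᴴ * (S * R g * S⁻¹) = 1 := by
      have h4 : S⁻¹ᴴ * Sᴴ = 1 := by rw [← conjTranspose_mul, h2, conjTranspose_one]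
      calc (S * R g * S⁻¹)ᴴ * (S * R g * S⁻¹) = S⁻¹ᴴ * ((R g)ᴴ * (Sᴴ * S) * R g) * S⁻¹ := by
            simp only [conjTranspose_mul, Matrix.mul_assoc]
        _ = (S⁻¹ᴴ * Sᴴ) * (S * S⁻¹) := by rw [← hS, hinv, hS]; simp only [Matrix.mul_assoc]
        _ = 1 := by rw [h4, h2, one_mul]
    have h5 : (S * R g * S⁻¹) * (S * R g⁻¹ * S⁻¹) = 1 := by
      rw [← hM]; simp [h2]
    calc S * R g⁻¹ * S⁻¹ = 1 * (S * R g⁻¹ * S⁻¹) := by rw [one_mul]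
      _ = _ := by rw [← h3, Matrix.mul_assoc, h5, mul_one]
  · intro g
    rw [Matrix.trace_mul_comm (S * R g), ← Matrix.mul_assoc, h1, one_mul]

variable {G : Type} [Group G] [Fintype G] {V : Type} [AddCommGroup V] [Module ℂ V] [FiniteDimensional ℂ V]

lemma unitarize (ρ : Representation ℂ G V) :
    ∃ (d : ℕ) (M : G → Matrix (Fin d) (Fin d) ℂ), (∀ g h, M (g * h) = M g * M h) ∧ (∀ g, M g⁻¹ = (M g)ᴴ) ∧
      ∀ g, ρ.character g = (M g).trace := by
  set b := Module.finBasis ℂ V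
  obtain ⟨M, h1, h2, h3⟩ := unitarize_mat
    (((LinearMap.toMatrixAlgEquiv b).toMulEquiv.toMonoidHom).comp ρ)
  refine ⟨_, M, h1, h2, fun g => ?_⟩
  rw [← h3, Representation.character, LinearMap.trace_eq_matrix_trace ℂ b]
  rfl

lemma char_star (ρ : Representation ℂ G V) (g : G) : star (ρ.character g) = ρ.character g⁻¹ := by
  obtain ⟨d, M, h1, h2, h3⟩ := unitarize ρ
  rw [h3, h3, h2, trace_conjTranspose]

/-- hermitian form on functions -/
noncomputable def cip (f g : G → ℂ) : ℂ := (Fintype.card G : ℂ)⁻¹ * ∑ x, f x * star (g x)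

lemma cip_add_left (f f' g : G → ℂ) : cip (f + f') g = cip f g + cip f' g := by
  simp [cip, add_mul, Finset.sum_add_distrib, mul_add]
lemma cip_add_right (f g g' : G → ℂ) : cip f (g + g') = cip f g + cip f g' := by
  simp [cip, add_mul, Finset.sum_add_distrib, mul_add]
lemma cip_smul_left (c : ℂ) (f g : G → ℂ) : cip (c • f) g = c * cip f g := by
  simp only [cip, Pi.smul_apply, smul_eq_mul, mul_assoc, ← Finset.mul_sum]; ring
lemma cip_smul_right (c : ℂ) (f g : G → ℂ) : cip f (c • g) = star c * cip f g := by
  simp only [cip, Pi.smul_apply, smul_eq_mul, star_mul', mul_left_comm _ (star c), ← Finset.mul_sum]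
lemma cip_sum_left {ι : Type*} (s : Finset ι) (f : ι → G → ℂ) (g : G → ℂ) :
    cip (∑ i ∈ s, f i) g = ∑ i ∈ s, cip (f i) g := by
  classical
  induction s using Finset.induction_on with
  | empty => simp [cip]
  | insert a s ha ih => rw [Finset.sum_insert ha, Finset.sum_insert ha, cip_add_left, ih]
lemma cip_sum_right {ι : Type*} (s : Finset ι) (f : ι → G → ℂ) (g : G → ℂ) :
    cip g (∑ i ∈ s, f i) = ∑ i ∈ s, cip g (f i) := by
  classical
  induction s using Finset.induction_on with
  | empty => simp [cip]
  | insert a s ha ih => rw [Finset.sum_insert ha, Finset.sum_insert ha, cip_add_right, ih]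
lemma cip_star (f g : G → ℂ) : star (cip f g) = cip g f := by
  simp only [cip, star_mul', star_sum, star_star, star_inv₀, star_natCast]
  congr 1
  exact Finset.sum_congr rfl fun x _ => mul_comm _ _
lemma cip_self_re (f : G → ℂ) : cip f f = (((Fintype.card G : ℝ)⁻¹ * ∑ x, ‖f x‖ ^ 2 : ℝ) : ℂ) := by
  simp only [cip]
  push_cast
  congr 1
  refine Finset.sum_congr rfl fun x _ => ?_
  have := Complex.mul_conj (f x)
  rw [Complex.normSq_eq_norm_sq] at this
  simpa using this
lemma cip_self_nonneg (f : G → ℂ) : 0 ≤ cip f f := by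
  rw [cip_self_re]; exact_mod_cast by positivity
lemma cip_self_eq_zero (f : G → ℂ) (h : cip f f ≤ 0) : f = 0 := by
  rw [cip_self_re] at h
  have h1 : (Fintype.card G : ℝ)⁻¹ * ∑ x, ‖f x‖ ^ 2 ≤ 0 := by exact_mod_cast h
  have hc : (0:ℝ) < (Fintype.card G : ℝ)⁻¹ := by
    have := Fintype.card_pos (α := G)
    positivity
  have h2 : ∑ x, ‖f x‖ ^ 2 = 0 := le_antisymm (by nlinarith) (by positivity)
  rw [Finset.sum_eq_zero_iff_of_nonneg (fun _ _ => by positivity)] at h2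
  funext x
  simpa using h2 x (Finset.mem_univ x)

/-- norm one plus nonzero integer coefficient -/
lemma cip_int_eq (ψ χ : G → ℂ) (hψ : cip ψ ψ = 1) (hχ : cip χ χ = 1) (m : ℤ) (hm : cip ψ χ = m) (h0 : m ≠ 0) :
    ψ = (m : ℂ) • χ := by
  have h1 : cip χ ψ = m := by rw [← cip_star, hm]; simp
  have h2 : cip (ψ + (-(m : ℂ)) • χ) (ψ + (-(m : ℂ)) • χ) = ((1 - m ^ 2 : ℤ) : ℂ) := by
    simp only [cip_add_left, cip_add_right, cip_smul_left, cip_smul_right, hψ, hχ, hm, h1]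
    simp; ring
  have h3 : ψ + (-(m : ℂ)) • χ = 0 := by
    apply cip_self_eq_zero
    rw [h2]
    have : 1 - m ^ 2 ≤ 0 := by
      have : 0 < m ^ 2 := by positivity
      linarith
    exact_mod_cast this
  rw [neg_smul] at h3
  exact (add_neg_eq_zero.mp h3)

lemma irr_of {ρ : Representation ℂ G V} [Nontrivial V]
    (hirr : ∀ W : Submodule ℂ V, (∀ g, ∀ v ∈ W, ρ g v ∈ W) → W = ⊥ ∨ W = ⊤) : ρ.IsIrreducible := by
  have : Nontrivial (Subrepresentation ρ) := by
    refine ⟨⊥, ⊤, fun h => ?_⟩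
    have h2 : (⊥ : Submodule ℂ V) = ⊤ := congrArg Subrepresentation.toSubmodule h
    exact bot_ne_top h2
  refine ⟨fun W => ?_⟩
  rcases hirr W.toSubmodule (fun g v hv => W.apply_mem_toSubmodule g hv) with h | h
  · left; exact Subrepresentation.toSubmodule_injective h
  · right; exact Subrepresentation.toSubmodule_injective h

lemma cip_irr {W : Type} [AddCommGroup W] [Module ℂ W] [FiniteDimensional ℂ W]
    (ρ : Representation ℂ G V) (σ : Representation ℂ G W) [ρ.IsIrreducible] [σ.IsIrreducible] :
    cip ρ.character σ.character = 0 ∨ (ρ.character = σ.character ∧ cip ρ.character σ.character = 1) := by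
  classical
  haveI : Invertible (Nat.card G : ℂ) := invertibleOfNonzero (by simp)
  have h := Representation.char_orthonormal ρ σ
  rw [Nat.card_eq_fintype_card] at h
  have h2 : cip ρ.character σ.character = if Nonempty (σ.Equiv ρ) then 1 else 0 := by
    rw [← h]; simp only [cip, char_star]
  by_cases h3 : Nonempty (σ.Equiv ρ)
  · right
    obtain ⟨e⟩ := h3
    refine ⟨(Representation.char_iso e).symm, ?_⟩
    rw [h2, if_pos ⟨e⟩]
  · left; rw [h2, if_neg h3]

lemma cip_irr_self (ρ : Representation ℂ G V) [ρ.IsIrreducible] : cip ρ.character ρ.character = 1 := by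
  classical
  haveI : Invertible (Nat.card G : ℂ) := invertibleOfNonzero (by simp)
  have h := Representation.char_orthonormal ρ ρ
  rw [if_pos ⟨Representation.Equiv.refl ρ⟩, Nat.card_eq_fintype_card] at h
  simp only [cip, char_star]
  exact_mod_cast h

lemma cip_posdef (φ : G → ℂ) (hφ : ∀ x : G → ℂ, 0 ≤ ∑ g, ∑ h, star (x g) * x h * φ (g⁻¹ * h))
    (ρ : Representation ℂ G V) : 0 ≤ cip φ ρ.character := by
  obtain ⟨d, M, h1, h2, h3⟩ := unitarize ρ
  have key : ∑ i, ∑ j, ∑ g, ∑ h, star (star (M g i j)) * star (M h i j) * φ (g⁻¹ * h) =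
      (Fintype.card G : ℂ) * ∑ x, φ x * star (ρ.character x) := by
    have : ∀ g h : G, star (ρ.character (g⁻¹ * h)) = ∑ i, ∑ j, star (star (M g i j)) * star (M h i j) := by
      intro g h
      rw [h3, h1, h2, Matrix.trace]
      simp only [Matrix.diag, Matrix.mul_apply, star_sum, star_mul', conjTranspose_apply]
      rw [Finset.sum_comm]
    calc _ = ∑ g, ∑ h, φ (g⁻¹ * h) * star (ρ.character (g⁻¹ * h)) := by
          simp_rw [this, Finset.mul_sum]
          rw [Finset.sum_comm' (t' := Finset.univ) (s' := fun _ => Finset.univ) (by simp)]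
          rw [Finset.sum_congr rfl (fun _ _ => Finset.sum_comm)]
          rw [Finset.sum_comm]
          refine Finset.sum_congr rfl fun g _ => ?_
          rw [Finset.sum_congr rfl (fun _ _ => Finset.sum_comm)]
          rw [Finset.sum_comm]
          refine Finset.sum_congr rfl fun h _ => ?_
          rw [Finset.sum_comm]
          refine Finset.sum_congr rfl fun i _ => Finset.sum_congr rfl fun j _ => ?_
          ring
      _ = ∑ g : G, ∑ x, φ x * star (ρ.character x) := by
          refine Finset.sum_congr rfl fun g _ => ?_
          exact Fintype.sum_equiv (Equiv.mulLeft g⁻¹) _ _ (fun x => rfl)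
      _ = _ := by simp
  have h4 : 0 ≤ (Fintype.card G : ℂ) * ∑ x, φ x * star (ρ.character x) := by
    rw [← key]
    exact Finset.sum_nonneg fun i _ => Finset.sum_nonneg fun j _ => hφ (fun g => star (M g i j))
  have hc : (0:ℂ) < (Fintype.card G : ℂ)⁻¹ := by
    have : 0 < (Fintype.card G : ℝ)⁻¹ := by
      have := Fintype.card_pos (α := G)
      positivity
    have h := Complex.zero_lt_real.mpr this
    simpa using h
  have h5 := mul_nonneg (mul_nonneg hc.le hc.le) h4
  have h6 : (Fintype.card G : ℂ) ≠ 0 := by simp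
  rw [cip]
  convert h5 using 1
  field_simp

lemma avg_nat (ρ : Representation ℂ G V) (H : Subgroup G) [Fintype H] :
    ∃ k : ℕ, (Fintype.card H : ℂ)⁻¹ * ∑ h : H, ρ.character h = k ∧
     ((∃ v : V, v ≠ 0 ∧ ∀ h ∈ H, ρ h v = v) → 0 < k) := by
  haveI : Invertible (Nat.card H : ℂ) := invertibleOfNonzero (by simp)
  have h := Representation.card_inv_mul_sum_char_eq_finrank (ρ.comp H.subtype : Representation ℂ H V)
  rw [Nat.card_eq_fintype_card] at h
  refine ⟨_, h, ?_⟩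
  rintro ⟨v, hv, hh⟩
  have : Nontrivial (Representation.invariants (ρ.comp H.subtype : Representation ℂ H V)) := by
    refine ⟨⟨v, fun h => hh h h.2⟩, 0, fun h => hv ?_⟩
    exact congrArg Subtype.val h
  exact Module.finrank_pos
end M3
end OV

open scoped ComplexOrder
namespace OV
set_option linter.unusedSectionVars false
section M3b
variable {G : Type} [Group G] [Fintype G]

/-- characters of irreducible unitary representations -/
def IsIrrChar (f : G → ℂ) : Prop :=
  ∃ (V : Type) (_ : NormedAddCommGroup V) (_ : InnerProductSpace ℂ V) (_ : FiniteDimensional ℂ V)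
    (_ : Nontrivial V) (ρ : Representation ℂ G V),
    (∀ g v w, inner ℂ (ρ g v) (ρ g w) = inner ℂ v w) ∧
    (∀ W : Submodule ℂ V, (∀ g, ∀ v ∈ W, ρ g v ∈ W) → W = ⊥ ∨ W = ⊤) ∧ f = ρ.character

lemma IsIrrChar.norm_one {f : G → ℂ} (hf : IsIrrChar f) : cip f f = 1 := by
  obtain ⟨V, _, _, _, _, ρ, h1, h2, rfl⟩ := hf
  haveI := irr_of h2
  exact cip_irr_self ρ

lemma IsIrrChar.avg {f : G → ℂ} (hf : IsIrrChar f) (H : Subgroup G) [Fintype H] :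
    ∃ k : ℕ, (Fintype.card H : ℂ)⁻¹ * ∑ h : H, f h = k := by
  obtain ⟨V, _, _, _, _, ρ, h1, h2, rfl⟩ := hf
  obtain ⟨k, hk, _⟩ := avg_nat ρ H
  exact ⟨k, hk⟩

lemma IsIrrChar.one_pos {f : G → ℂ} (hf : IsIrrChar f) : ∃ k : ℕ, 0 < k ∧ f 1 = k := by
  obtain ⟨V, _, _, _, _, ρ, h1, h2, rfl⟩ := hf
  exact ⟨_, Module.finrank_pos, Representation.char_one ρ⟩

lemma IsIrrChar.conj {f : G → ℂ} (hf : IsIrrChar f) (g h : G) : f (h * g * h⁻¹) = f g := by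
  obtain ⟨V, _, _, _, _, ρ, h1, h2, rfl⟩ := hf
  exact Representation.char_conj ..

/-- restriction to an invariant submodule -/
noncomputable def subRep {V : Type} [AddCommGroup V] [Module ℂ V] (ρ : Representation ℂ G V) (W : Submodule ℂ V)
    (hW : ∀ g, ∀ v ∈ W, ρ g v ∈ W) : Representation ℂ G W where
  toFun g := (ρ g).restrict (hW g)
  map_one' := by ext; simp
  map_mul' g h := by ext; simp

lemma decompose (n : ℕ) : ∀ (V : Type) [NormedAddCommGroup V] [InnerProductSpace ℂ V] [FiniteDimensional ℂ V]
    (ρ : Representation ℂ G V) (_ : ∀ g v w, inner ℂ (ρ g v) (ρ g w) = inner ℂ v w)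
    (_ : Module.finrank ℂ V = n),
    ∃ s : Multiset (G → ℂ), (∀ f ∈ s, IsIrrChar f) ∧ ρ.character = s.sum := by
  induction n using Nat.strong_induction_on with
  | _ n ih =>
    intro V _ _ _ ρ hu hn
    rcases subsingleton_or_nontrivial V with hV | hV
    · refine ⟨0, by simp, ?_⟩
      funext g
      have : ρ g = 0 := Subsingleton.elim _ _
      simp [Representation.character, this]
    by_cases hirr : ∀ W : Submodule ℂ V, (∀ g, ∀ v ∈ W, ρ g v ∈ W) → W = ⊥ ∨ W = ⊤
    · refine ⟨{ρ.character}, ?_, by simp⟩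
      intro f hf
      rw [Multiset.mem_singleton] at hf
      exact ⟨V, _, _, inferInstance, hV, ρ, hu, hirr, hf⟩
    · push Not at hirr
      obtain ⟨W, hW, hb, ht⟩ := hirr
      have hW' : ∀ g, ∀ v ∈ Wᗮ, ρ g v ∈ Wᗮ := by
        intro g v hv
        rw [Submodule.mem_orthogonal] at hv ⊢
        intro u hu'
        have h1 := hv _ (hW g⁻¹ u hu')
        rw [← hu g] at h1
        simpa using h1
      have hlt : Module.finrank ℂ W < n := hn ▸ Submodule.finrank_lt ht
      have hlt' : Module.finrank ℂ Wᗮ < n := by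
        have h1 := Submodule.finrank_add_finrank_orthogonal W
        have h2 : 0 < Module.finrank ℂ W := by
          rw [Nat.pos_iff_ne_zero]
          intro h
          exact hb (Submodule.finrank_eq_zero.mp h)
        omega
      obtain ⟨s, hs, hs'⟩ := ih _ hlt W (subRep ρ W hW) (fun g v w => hu g v w) rfl
      obtain ⟨t, ht, ht'⟩ := ih _ hlt' (Wᗮ : Submodule ℂ V) (subRep ρ Wᗮ hW') (fun g v w => hu g v w) rfl
      refine ⟨s + t, ?_, ?_⟩
      · intro f hf
        rcases Multiset.mem_add.mp hf with h | h
        · exact hs f h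
        · exact ht f h
      · rw [Multiset.sum_add, ← hs', ← ht']
        funext g
        have hInteg : DirectSum.IsInternal (fun b : Bool => if b then W else Wᗮ) := by
          rw [DirectSum.isInternal_submodule_iff_isCompl (i := true) (j := false) _ (by simp)
            (by ext b; cases b <;> simp)]
          simpa using Submodule.isCompl_orthogonal_of_hasOrthogonalProjection
        have hf : ∀ b : Bool, Set.MapsTo (ρ g) ((if b then W else Wᗮ : Submodule ℂ V) : Set V) 
            ((if b then W else Wᗮ : Submodule ℂ V) : Set V) := by
          intro b
          cases b
          · exact hW' g
          · exact hW g
        have := LinearMap.trace_eq_sum_trace_restrict hInteg hf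
        rw [Fintype.sum_bool] at this
        exact this

/-- the regular character -/
lemma regular_decomp : ∃ s : Multiset (G → ℂ), (∀ f ∈ s, IsIrrChar f) ∧
    ∀ g, s.sum g = open scoped Classical in if g = 1 then (Fintype.card G : ℂ) else 0 := by
  classical
  let ρ : Representation ℂ G (EuclideanSpace ℂ G) :=
    { toFun := fun g => (LinearIsometryEquiv.piLpCongrLeft 2 ℂ ℂ (Equiv.mulLeft g)).toLinearEquiv.toLinearMap
      map_one' := by ext x i; simp [LinearIsometryEquiv.piLpCongrLeft_apply, Equiv.piCongrLeft']; rfl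
      map_mul' := by
        intro g h; ext x i
        simp [LinearIsometryEquiv.piLpCongrLeft_apply, Equiv.piCongrLeft', mul_assoc]
        rfl }
  have hρ : ∀ g x i, ρ g x i = x (g⁻¹ * i) := by
    intro g x i
    simp [ρ, LinearIsometryEquiv.piLpCongrLeft_apply, Equiv.piCongrLeft']
  obtain ⟨s, hs, hs'⟩ := decompose _ (EuclideanSpace ℂ G) ρ (fun g v w =>
    (LinearIsometryEquiv.piLpCongrLeft 2 ℂ ℂ (Equiv.mulLeft g)).inner_map_map v w) rfl
  refine ⟨s, hs, fun g => ?_⟩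
  rw [← hs', Representation.character,
    LinearMap.trace_eq_matrix_trace ℂ (EuclideanSpace.basisFun G ℂ).toBasis, Matrix.trace]
  have : ∀ i, LinearMap.toMatrix (EuclideanSpace.basisFun G ℂ).toBasis (EuclideanSpace.basisFun G ℂ).toBasis (ρ g) i i
      = if g = 1 then 1 else 0 := by
    intro i
    rw [LinearMap.toMatrix_apply]
    simp [hρ]
  simp only [Matrix.diag, this]
  by_cases h : g = 1 <;> simp [h]
end M3b
end OV

open scoped ComplexOrder
open MeasureTheory
namespace OV
section M1
open Topology Filter TopologicalSpace

variable {F : Type} [Field F] [Fintype F] [DecidableEq F]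
section

lemma ut_diag {n : ℕ} (g : GLn F n) (h : IsUT F g) (i : Fin n) : (g : Matrix (Fin n) (Fin n) F) i i ≠ 0 := by
  have h1 : (g : Matrix (Fin n) (Fin n) F).det = ∏ i, (g : Matrix (Fin n) (Fin n) F) i i :=
    Matrix.det_of_isUpperTriangular (fun i j hij => h i j hij)
  have h2 : (g : Matrix (Fin n) (Fin n) F).det ≠ 0 := by
    have := (Matrix.isUnit_iff_isUnit_det _).1 g.isUnit
    exact this.ne_zero
  rw [h1, Finset.prod_ne_zero_iff] at h2
  exact h2 i (Finset.mem_univ _)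

lemma ut_exists {n : ℕ} (M : Matrix (Fin n) (Fin n) F) (h : ∀ i j, j < i → M i j = 0) (hd : ∀ i, M i i ≠ 0) :
    ∃ g : GLn F n, (g : Matrix (Fin n) (Fin n) F) = M := by
  have h1 : M.det ≠ 0 := by
    rw [Matrix.det_of_isUpperTriangular (fun i j hij => h i j hij), Finset.prod_ne_zero_iff]
    exact fun i _ => hd i
  exact ⟨Matrix.GeneralLinearGroup.mkOfDetNeZero M h1, rfl⟩

lemma mem_ExtSet {n : ℕ} (g : GLn F n) (h : GLn F (n + 1)) : h ∈ ExtSet F g ↔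
    (∀ i j : Fin n, (h : Matrix (Fin (n + 1)) (Fin (n + 1)) F) i.castSucc j.castSucc
        = (g : Matrix (Fin n) (Fin n) F) i j) ∧
    (∀ j : Fin n, (h : Matrix (Fin (n + 1)) (Fin (n + 1)) F) (Fin.last n) j.castSucc = 0) := by
  classical
  simp [ExtSet]

lemma gl_ext {n : ℕ} (g g' : GLn F n) (h : ∀ i j, (g : Matrix (Fin n) (Fin n) F) i j = (g' : Matrix (Fin n) (Fin n) F) i j) : g = g' := by
  apply Units.ext
  ext i j
  exact h i j

open scoped Classical in
/-- finite Borel subgroup as a finset -/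
noncomputable def UTset (F : Type) [Field F] [Fintype F] [DecidableEq F] (n : ℕ) : Finset (GLn F n) := Finset.univ.filter (IsUT F)

lemma mem_UTset {n : ℕ} (g : GLn F n) : g ∈ UTset F n ↔ IsUT F g := by simp [UTset]

open scoped Classical in
lemma UTset_succ (n : ℕ) : UTset F (n + 1) = (UTset F n).biUnion (ExtSet F) := by
  ext h
  simp only [Finset.mem_biUnion, mem_UTset, mem_ExtSet]
  constructor
  · intro hh
    obtain ⟨g, hg⟩ := ut_exists (fun i j : Fin n => (h : Matrix (Fin (n + 1)) (Fin (n + 1)) F) i.castSucc j.castSucc)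
      (fun i j hij => hh _ _ (by simpa using hij)) (fun i => ut_diag h hh _)
    refine ⟨g, ?_, ?_, ?_⟩
    · intro i j hij
      rw [hg]
      exact hh _ _ (by simpa using hij)
    · intro i j; rw [hg]
    · intro j; exact hh _ _ (Fin.castSucc_lt_last j)
  · rintro ⟨g, hg, h1, h2⟩ i j hij
    induction j using Fin.lastCases with
    | last => exact absurd hij (not_lt.2 (Fin.le_last i))
    | cast j =>
      induction i using Fin.lastCases with
      | last => exact h2 j
      | cast i => rw [h1]; exact hg i j (by simpa using hij)

lemma sum_UTset_succ {M : Type*} [AddCommMonoid M] (n : ℕ) (f : GLn F (n + 1) → M) :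
    ∑ h ∈ UTset F (n + 1), f h = ∑ g ∈ UTset F n, ∑ h ∈ ExtSet F g, f h := by
  classical
  rw [UTset_succ, Finset.sum_biUnion]
  intro g _ g' _ hne
  rw [Function.onFun, Finset.disjoint_left]
  intro h h1 h2
  rw [mem_ExtSet] at h1 h2
  exact hne (gl_ext _ _ fun i j => by rw [← h1.1, h2.1])

/-- extension by the identity -/
def padM {n : ℕ} (g : GLn F n) (i j : ℕ) : F :=
  if h : i < n ∧ j < n then (g : Matrix (Fin n) (Fin n) F) ⟨i, h.1⟩ ⟨j, h.2⟩ else if i = j then 1 else 0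

open scoped Classical in
noncomputable def pad {n : ℕ} (g : GLn F n) : BB F :=
  if h : IsUT F g then ⟨padM g, by
    refine ⟨fun i j hij => ?_, fun i => ?_⟩
    · unfold padM
      split_ifs with h1 h2
      · exact h _ _ hij
      · omega
      · rfl
    · unfold padM
      split_ifs with h1
      · exact ut_diag g h _
      · exact one_ne_zero
      · exact absurd rfl ‹_›⟩
  else ⟨fun i j => if i = j then 1 else 0, by
    refine ⟨fun i j hij => ?_, fun i => ?_⟩
    · exact if_neg (by omega)
    · simp⟩

lemma pad_apply {n : ℕ} (g : GLn F n) (h : IsUT F g) (i j : Fin n) : (pad g).1 i j = (g : Matrix (Fin n) (Fin n) F) i j := by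
  simp [pad, h, padM]

/-- `C` depends only on the `m`-corner -/
def Corner (m : ℕ) (C : Set (BB F)) : Prop := ∀ X Y : BB F, (∀ i j, i < m → j < m → X.1 i j = Y.1 i j) → (X ∈ C ↔ Y ∈ C)

lemma Corner.mono {m m' : ℕ} {C : Set (BB F)} (h : Corner m C) (hm : m ≤ m') : Corner m' C :=
  fun X Y hXY => h X Y fun i j hi hj => hXY i j (hi.trans_le hm) (hj.trans_le hm)

lemma corner_Cyl {n : ℕ} (g : GLn F n) : Corner n (Cyl F g) := by
  intro X Y h
  simp only [Cyl, Set.mem_setOf_eq]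
  exact forall_congr' fun i => forall_congr' fun j => by rw [h i j i.2 j.2]

open scoped Classical in
lemma s_step (p : ∀ n, GLn F n → ℝ) (hcons : ∀ n g, IsUT F g → p n g = ∑ h ∈ ExtSet F g, p (n+1) h)
    (C : Set (BB F)) (m : ℕ) (hC : Corner m C) :
    ∑ h ∈ UTset F (m + 1), (if pad h ∈ C then p (m + 1) h else 0) = ∑ h ∈ UTset F m, (if pad h ∈ C then p m h else 0) := by
  rw [sum_UTset_succ]
  refine Finset.sum_congr rfl fun g hg => ?_
  have hg' := (mem_UTset g).1 hg
  have : ∀ h ∈ ExtSet F g, (pad h ∈ C ↔ pad g ∈ C) := by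
    intro h hh
    have hu : IsUT F h := by
      rw [← mem_UTset, UTset_succ, Finset.mem_biUnion]; exact ⟨g, hg, hh⟩
    rw [mem_ExtSet] at hh
    apply hC
    intro i j hi hj
    have a := pad_apply h hu (⟨i, hi⟩ : Fin m).castSucc (⟨j, hj⟩ : Fin m).castSucc
    have b := pad_apply g hg' ⟨i, hi⟩ ⟨j, hj⟩
    simp only [Fin.val_castSucc] at a b
    rw [a, b, hh.1]
  rw [Finset.sum_congr rfl (fun h hh => by rw [if_congr (this h hh) rfl rfl])]
  split_ifs
  · exact (hcons m g hg').symm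
  · simp

open scoped Classical in
lemma s_eq (p : ∀ n, GLn F n → ℝ) (hcons : ∀ n g, IsUT F g → p n g = ∑ h ∈ ExtSet F g, p (n+1) h)
    (C : Set (BB F)) (m : ℕ) (hC : Corner m C) (m' : ℕ) (hm : m ≤ m') :
    ∑ h ∈ UTset F m', (if pad h ∈ C then p m' h else 0) = ∑ h ∈ UTset F m, (if pad h ∈ C then p m h else 0) := by
  induction m', hm using Nat.le_induction with
  | base => rfl
  | succ k hk ih => rw [s_step p hcons C k (hC.mono hk), ih]

open scoped Classical in
lemma s_Cyl (p : ∀ n, GLn F n → ℝ) {n : ℕ} (g : GLn F n) (hg : IsUT F g) :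
    ∑ h ∈ UTset F n, (if pad h ∈ Cyl F g then p n h else 0) = p n g := by
  rw [Finset.sum_eq_single g]
  · rw [if_pos]
    intro i j; exact pad_apply g hg i j
  · intro h hh hne
    rw [if_neg]
    intro hmem
    exact hne (gl_ext _ _ fun i j => by rw [← pad_apply h ((mem_UTset h).1 hh), hmem i j])
  · intro h; exact absurd ((mem_UTset g).2 hg) h

/-- topology on `BB` -/
instance topBB : TopologicalSpace (BB F) := by
  letI : TopologicalSpace F := ⊥
  exact instTopologicalSpaceSubtype

end

variable (F) in
lemma topo_facts : CompactSpace (BB F) ∧ T2Space (BB F) ∧ BorelSpace (BB F) ∧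
    SecondCountableTopology (BB F) ∧ (∀ i j a, IsClopen {X : BB F | X.1 i j = a}) ∧ ∀ i j a, MeasurableSet {X : BB F | X.1 i j = a} := by
  letI : TopologicalSpace F := ⊥
  haveI : DiscreteTopology F := ⟨rfl⟩
  letI : MeasurableSpace F := ⊤
  haveI : BorelSpace F := ⟨(borel_eq_top_of_discrete).symm⟩
  have hcont : ∀ i j, Continuous (fun X : ℕ → ℕ → F => X i j) := fun i j =>
    (continuous_apply j).comp (continuous_apply i)
  have hcl : IsClosed {X : ℕ → ℕ → F | (∀ i j : ℕ, j < i → X i j = 0) ∧ ∀ i : ℕ, X i i ≠ 0} := by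
    simp only [Set.setOf_and, Set.setOf_forall]
    refine IsClosed.inter ?_ ?_
    · refine isClosed_iInter fun i => isClosed_iInter fun j => isClosed_iInter fun _ => ?_
      exact (isClosed_discrete ({0} : Set F)).preimage (hcont i j)
    · refine isClosed_iInter fun i => ?_
      exact (isClosed_discrete ({0}ᶜ : Set F)).preimage (hcont i i)
  refine ⟨?_, ?_, ?_, ?_, ?_, ?_⟩
  · exact isCompact_iff_compactSpace.1 hcl.isCompact
  · exact inferInstanceAs (T2Space {X : ℕ → ℕ → F // _})
  · exact inferInstanceAs (BorelSpace {X : ℕ → ℕ → F // _})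
  · exact TopologicalSpace.Subtype.secondCountableTopology {X : ℕ → ℕ → F | (∀ i j : ℕ, j < i → X i j = 0) ∧ ∀ i : ℕ, X i i ≠ 0}
  · intro i j a
    exact (isClopen_discrete ({a} : Set F)).preimage ((hcont i j).comp continuous_subtype_val)
  · intro i j a
    have : Measurable (fun X : {X : ℕ → ℕ → F // (∀ i j : ℕ, j < i → X i j = 0) ∧ ∀ i : ℕ, X i i ≠ 0} => X.1 i j) :=
      (measurable_pi_apply j).comp ((measurable_pi_apply i).comp measurable_subtype_coe)
    exact this (show MeasurableSet ({a} : Set F) from trivial)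

lemma cyl_eq {n : ℕ} (g : GLn F n) : Cyl F g = ⋂ i : Fin n, ⋂ j : Fin n, {X : BB F | X.1 i j = (g : Matrix (Fin n) (Fin n) F) i j} := by
  ext X; simp [Cyl]

lemma clopen_Cyl {n : ℕ} (g : GLn F n) : IsClopen (Cyl F g) := by
  rw [cyl_eq]
  exact isClopen_iInter_of_finite fun i => isClopen_iInter_of_finite fun j => (topo_facts F).2.2.2.2.1 _ _ _

lemma meas_Cyl {n : ℕ} (g : GLn F n) : MeasurableSet (Cyl F g) := by
  rw [cyl_eq]
  exact MeasurableSet.iInter fun i => MeasurableSet.iInter fun j => (topo_facts F).2.2.2.2.2 _ _ _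

open scoped Classical in
lemma exists_measure (p : ∀ n, GLn F n → ℝ) (h0 : ∀ n g, IsUT F g → 0 ≤ p n g)
    (hcons : ∀ n g, IsUT F g → p n g = ∑ h ∈ ExtSet F g, p (n+1) h) (h1 : p 0 1 = 1) :
    ∃ ϱ : Measure (BB F), IsProbabilityMeasure ϱ ∧ ∀ n (g : GLn F n), IsUT F g → (ϱ (Cyl F g)).toReal = p n g := by
  obtain ⟨i1, i2, i3, i4, -, -⟩ := topo_facts F
  set μ : ℕ → Measure (BB F) := fun m => ∑ h ∈ UTset F m, ENNReal.ofReal (p m h) • Measure.dirac (pad h) with hμ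
  have hμC : ∀ (m : ℕ) (C : Set (BB F)), MeasurableSet C → μ m C = ENNReal.ofReal (∑ h ∈ UTset F m, (if pad h ∈ C then p m h else 0)) := by
    intro m C hC
    rw [ENNReal.ofReal_sum_of_nonneg]
    · simp only [hμ, Measure.coe_finset_sum, Finset.sum_apply, Measure.smul_apply, Measure.dirac_apply' _ hC, smul_eq_mul]
      refine Finset.sum_congr rfl fun h _ => ?_
      by_cases hh : pad h ∈ C <;> simp [hh]
    · intro h hh
      split_ifs
      · exact h0 m h ((mem_UTset h).1 hh)
      · exact le_rfl
  have hut0 : ∀ g : GLn F 0, g = 1 := fun g => Subsingleton.elim _ _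
  have hprob : ∀ m, IsProbabilityMeasure (μ m) := by
    intro m
    refine ⟨?_⟩
    rw [hμC m _ MeasurableSet.univ, s_eq p hcons Set.univ 0 (fun _ _ _ => by simp) m (Nat.zero_le m)]
    have : UTset F 0 = {1} := by
      ext g; rw [mem_UTset, Finset.mem_singleton]
      exact ⟨fun _ => hut0 g, fun _ i => i.elim0⟩
    rw [this]; simp [h1]
  let P : ℕ → ProbabilityMeasure (BB F) := fun m => ⟨μ m, hprob m⟩
  let U : Ultrafilter (ProbabilityMeasure (BB F)) := (hyperfilter ℕ).map P
  haveI : T3Space (BB F) := inferInstance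
  haveI : MetrizableSpace (BB F) := inferInstance
  haveI : CompactSpace (ProbabilityMeasure (BB F)) := inferInstance
  have hlim : Tendsto P (hyperfilter ℕ : Filter ℕ) (𝓝 U.lim) := U.le_nhds_lim
  refine ⟨(U.lim : Measure (BB F)), inferInstance, fun n g hg => ?_⟩
  have h2 := ProbabilityMeasure.tendsto_measure_of_null_frontier_of_tendsto' hlim (E := Cyl F g)
    (by rw [(clopen_Cyl g).frontier_eq]; simp)
  have h3 : Tendsto (fun i => (P i : Measure (BB F)) (Cyl F g)) (hyperfilter ℕ : Filter ℕ) (𝓝 (ENNReal.ofReal (p n g))) := by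
    apply Tendsto.congr' _ tendsto_const_nhds
    have hev : ∀ᶠ m in (hyperfilter ℕ : Filter ℕ), n ≤ m := by
      have : (hyperfilter ℕ : Filter ℕ) ≤ atTop := by
        rw [← Nat.cofinite_eq_atTop]; exact hyperfilter_le_cofinite
      exact this (eventually_ge_atTop n)
    filter_upwards [hev] with m hm
    show _ = μ m _
    rw [hμC m _ (meas_Cyl g), s_eq p hcons _ n (corner_Cyl g) m hm, s_Cyl p g hg]
  rw [tendsto_nhds_unique h2 h3, ENNReal.toReal_ofReal (h0 n g hg)]

lemma exists_trunc (X : BB F) (n : ℕ) : ∃ g : GLn F n, IsUT F g ∧ X ∈ Cyl F g := by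
  obtain ⟨g, hg⟩ := ut_exists (fun i j : Fin n => X.1 i j) (fun i j hij => X.2.1 _ _ hij) (fun i => X.2.2 i)
  exact ⟨g, fun i j hij => by rw [hg]; exact X.2.1 _ _ hij, fun i j => by rw [hg]⟩

lemma unique_measure (μ ν : Measure (BB F)) [IsProbabilityMeasure μ] [IsProbabilityMeasure ν]
    (h : ∀ n (g : GLn F n), IsUT F g → (μ (Cyl F g)).toReal = (ν (Cyl F g)).toReal) : μ = ν := by
  classical
  -- sets depending on a corner
  have hcorner : ∀ n (C : Set (BB F)), Corner n C → C = ⋃ g ∈ (UTset F n).filter (fun g => Cyl F g ⊆ C), Cyl F g := by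
    intro n C hC
    ext X
    simp only [Set.mem_iUnion, Finset.mem_filter, mem_UTset, exists_prop]
    constructor
    · intro hX
      obtain ⟨g, hg, hXg⟩ := exists_trunc X n
      refine ⟨g, ⟨hg, fun Y hY => ?_⟩, hXg⟩
      refine (hC X Y fun i j hi hj => ?_).1 hX
      rw [hXg ⟨i, hi⟩ ⟨j, hj⟩, hY ⟨i, hi⟩ ⟨j, hj⟩]
    · rintro ⟨g, ⟨_, hg⟩, hX⟩
      exact hg hX
  have hmeas : ∀ n (C : Set (BB F)), Corner n C → MeasurableSet C := by
    intro n C hC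
    rw [hcorner n C hC]
    exact Finset.measurableSet_biUnion _ fun g _ => meas_Cyl g
  have hval : ∀ n (C : Set (BB F)), Corner n C → μ C = ν C := by
    intro n C hC
    have hd : Set.PairwiseDisjoint (((UTset F n).filter (fun g => Cyl F g ⊆ C) : Finset (GLn F n)) : Set (GLn F n)) (Cyl F) := by
      intro g _ g' _ hne
      rw [Function.onFun, Set.disjoint_left]
      intro X h1 h2
      exact hne (gl_ext _ _ fun i j => by rw [← h1 i j, h2 i j])
    rw [hcorner n C hC, measure_biUnion_finset hd (fun g _ => meas_Cyl g), measure_biUnion_finset hd (fun g _ => meas_Cyl g)]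
    refine Finset.sum_congr rfl fun g hg => ?_
    rw [Finset.mem_filter, mem_UTset] at hg
    exact (ENNReal.toReal_eq_toReal_iff' (measure_ne_top _ _) (measure_ne_top _ _)).1 (h n g hg.1)
  refine MeasureTheory.ext_of_generate_finite {C | ∃ n, Corner n C} ?_ ?_ (fun C ⟨n, hC⟩ => hval n C hC) (by simp)
  · apply le_antisymm
    · letI : MeasurableSpace F := ⊤
      refine (MeasurableSpace.comap_le_iff_le_map (f := (Subtype.val : {X : ℕ → ℕ → F // (∀ i j : ℕ, j < i → X i j = 0) ∧ ∀ i : ℕ, X i i ≠ 0} → _))).2 ?_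
      refine iSup_le fun i => (MeasurableSpace.comap_le_iff_le_map).2 ?_
      refine iSup_le fun j => (MeasurableSpace.comap_le_iff_le_map).2 ?_
      intro s _
      apply MeasurableSpace.measurableSet_generateFrom
      refine ⟨max i j + 1, fun X Y hXY => ?_⟩
      show X.1 i j ∈ s ↔ Y.1 i j ∈ s
      rw [hXY i j (by omega) (by omega)]
    · apply MeasurableSpace.generateFrom_le
      rintro C ⟨n, hC⟩
      exact hmeas n C hC
  · rintro C ⟨n, hC⟩ D ⟨m, hD⟩ _
    refine ⟨max n m, fun X Y hXY => ?_⟩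
    exact and_congr (hC.mono (le_max_left _ _) X Y hXY) (hD.mono (le_max_right _ _) X Y hXY)

end M1
end OV

open scoped ComplexOrder
open MeasureTheory
namespace OV
set_option linter.unusedSectionVars false
section M4a
open Matrix
variable {F : Type} [Field F] [Fintype F] [DecidableEq F]

/-- parabolic subgroup of a colouring -/
def PC (F : Type) [Field F] [Fintype F] [DecidableEq F] {n : ℕ} (c : Fin n → ℕ) : Subgroup (GLn F n) :=
  let M : Submonoid (GLn F n) :=
    { carrier := {g | ∀ i j, c j < c i → (g : Matrix (Fin n) (Fin n) F) i j = 0}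
      one_mem' := by
        intro i j h
        have : i ≠ j := by rintro rfl; exact lt_irrefl _ h
        simp [Matrix.one_apply, this]
      mul_mem' := by
        intro a b ha hb i j h
        rw [Units.val_mul, Matrix.mul_apply]
        refine Finset.sum_eq_zero fun k _ => ?_
        by_cases h1 : c k < c i
        · rw [ha i k h1, zero_mul]
        · rw [hb k j (h.trans_le (not_lt.mp h1)), mul_zero] }
  { M with
    inv_mem' := by
      intro g hg
      have h1 : g⁻¹ = g ^ (Fintype.card (GLn F n) - 1) := by
        rw [inv_eq_iff_mul_eq_one, ← pow_succ', Nat.sub_add_cancel Fintype.card_pos, pow_card_eq_one]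
      rw [h1]
      exact M.pow_mem hg _ }

lemma mem_PC {n : ℕ} (c : Fin n → ℕ) (g : GLn F n) :
    g ∈ PC F c ↔ ∀ i j, c j < c i → (g : Matrix (Fin n) (Fin n) F) i j = 0 := Iff.rfl

/-- Young subgroup of a colouring -/
def SC {n : ℕ} (c : Fin n → ℕ) : Subgroup (Equiv.Perm (Fin n)) where
  carrier := {σ | ∀ x, c (σ x) = c x}
  one_mem' := by intro x; rfl
  mul_mem' := by
    intro a b ha hb x
    rw [Equiv.Perm.mul_apply, ha, hb]
  inv_mem' := by
    intro a ha x
    have := ha (a⁻¹ x)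
    simpa using this.symm

lemma mem_SC {n : ℕ} (c : Fin n → ℕ) (σ : Equiv.Perm (Fin n)) : σ ∈ SC c ↔ ∀ x, c (σ x) = c x := Iff.rfl

lemma UT_mem_PC {n : ℕ} (c : Fin n → ℕ) (hc : Monotone c) (g : GLn F n) (hg : IsUT F g) : g ∈ PC F c := by
  intro i j h
  exact hg i j (by by_contra h1; exact absurd (hc (not_lt.mp h1)) (not_le.mpr h))

lemma UT_iff_PC {n : ℕ} (g : GLn F n) : IsUT F g ↔ g ∈ PC F (fun i : Fin n => (i : ℕ)) := Iff.rfl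

lemma UT_mul {n : ℕ} {a b : GLn F n} (ha : IsUT F a) (hb : IsUT F b) : IsUT F (a * b) := by
  rw [UT_iff_PC] at *; exact mul_mem ha hb
lemma UT_inv {n : ℕ} {a : GLn F n} (ha : IsUT F a) : IsUT F a⁻¹ := by
  rw [UT_iff_PC] at *; exact inv_mem ha

/-- permutation matrix -/
def wMat (F : Type) [Field F] {n : ℕ} (σ : Equiv.Perm (Fin n)) : Matrix (Fin n) (Fin n) F :=
  fun i j => if i = σ j then 1 else 0

lemma wMat_mul {n : ℕ} (σ τ : Equiv.Perm (Fin n)) : wMat F σ * wMat F τ = wMat F (σ * τ) := by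
  ext i j
  simp [wMat, Matrix.mul_apply]; rfl

def wGL (F : Type) [Field F] [Fintype F] [DecidableEq F] {n : ℕ} (σ : Equiv.Perm (Fin n)) : GLn F n :=
  ⟨wMat F σ, wMat F σ⁻¹, by rw [wMat_mul, mul_inv_cancel]; ext i j; simp [wMat, Matrix.one_apply]; rfl,
    by rw [wMat_mul, inv_mul_cancel]; ext i j; simp [wMat, Matrix.one_apply]; rfl⟩

lemma wGL_apply {n : ℕ} (σ : Equiv.Perm (Fin n)) (i j : Fin n) :
    (wGL F σ : Matrix (Fin n) (Fin n) F) i j = if i = σ j then 1 else 0 := rfl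

lemma wGL_mul {n : ℕ} (σ τ : Equiv.Perm (Fin n)) : wGL F (σ * τ) = wGL F σ * wGL F τ :=
  Units.ext (wMat_mul σ τ).symm

lemma wGL_mem {n : ℕ} (c : Fin n → ℕ) (σ : Equiv.Perm (Fin n)) (h : σ ∈ SC c) : wGL F σ ∈ PC F c := by
  intro i j hij
  rw [wGL_apply, if_neg]
  rintro rfl
  rw [h j] at hij
  exact lt_irrefl _ hij

lemma bruhat_aux {n : ℕ} (g : GLn F n) (k : ℕ) (hk : k ≤ n) : ∃ (a b : GLn F n) (r : Fin n → Fin n),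
    IsUT F a ∧ IsUT F b ∧ ∀ j : Fin n, (j : ℕ) < k →
      (∀ i, (a * g * b : GLn F n).1 i j = if i = r j then 1 else 0) ∧
      (∀ i, (a * g * b : GLn F n).1 (r j) i = if i = j then 1 else 0) := by
  induction k with
  | zero =>
    exact ⟨1, 1, id, (UT_iff_PC _).2 (one_mem _), (UT_iff_PC _).2 (one_mem _), fun j h => absurd h (by omega)⟩
  | succ k ih =>
    obtain ⟨a, b, r, ha, hb, hr⟩ := ih (by omega)
    set h : GLn F n := a * g * b with hh
    set K : Fin n := ⟨k, hk⟩ with hK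
    -- column K is nonzero
    have hne : ∃ i, h.1 i K ≠ 0 := by
      by_contra hcon
      push Not at hcon
      have h1 : h.1.det = 0 := Matrix.det_eq_zero_of_column_eq_zero K hcon
      exact ((Matrix.isUnit_iff_isUnit_det _).1 h.isUnit).ne_zero h1
    set T : Finset (Fin n) := Finset.univ.filter (fun i => h.1 i K ≠ 0) with hT
    have hTne : T.Nonempty := by
      obtain ⟨i, hi⟩ := hne
      exact ⟨i, by simp [hT, hi]⟩
    set s := T.max' hTne with hs
    have hsK : h.1 s K ≠ 0 := by
      have := T.max'_mem hTne
      simpa [hT] using this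
    have hlow : ∀ i, s < i → h.1 i K = 0 := by
      intro i hi
      by_contra hcon
      exact absurd (T.le_max' i (by simp [hT, hcon])) (not_le.mpr hi)
    have hrK : ∀ j : Fin n, (j : ℕ) < k → h.1 (r j) K = 0 := by
      intro j hj
      rw [(hr j hj).2 K, if_neg]
      rintro rfl
      simp [hK] at hj
    have hrs : ∀ j : Fin n, (j : ℕ) < k → r j ≠ s := by
      intro j hj he
      exact hsK (he ▸ hrK j hj)
    have hsj : ∀ j : Fin n, (j : ℕ) < k → h.1 s j = 0 := by
      intro j hj
      rw [(hr j hj).1 s, if_neg (hrs j hj).symm]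
    let u : Fin n → F := fun i => if i = s then 1 - (h.1 s K)⁻¹ else h.1 i K * (h.1 s K)⁻¹
    let A : Matrix (Fin n) (Fin n) F := fun i j => (if i = j then 1 else 0) - (if j = s then u i else 0)
    obtain ⟨α, hα⟩ := ut_exists A (by
      intro i j hij
      have h1 : i ≠ j := hij.ne'
      simp only [A, if_neg h1, zero_sub, neg_eq_zero]
      by_cases h2 : j = s
      · subst h2
        simp [u, h1, hlow i hij]
      · simp [h2]) (by
      intro i
      by_cases h2 : i = s
      · simp [A, u, h2, hsK]
      · simp [A, h2])
    have hαUT : IsUT F α := by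
      intro i j hij
      have h1 : i ≠ j := hij.ne'
      rw [hα]
      simp only [A, if_neg h1, zero_sub, neg_eq_zero]
      by_cases h2 : j = s
      · subst h2
        simp [u, h1, hlow i hij]
      · simp [h2]
    have hαh : ∀ i j, (α * h).1 i j = h.1 i j - u i * h.1 s j := by
      intro i j
      rw [Units.val_mul, hα, Matrix.mul_apply]
      simp only [A, sub_mul, Finset.sum_sub_distrib, ite_mul, one_mul, zero_mul, Finset.sum_ite_eq,
        Finset.mem_univ, if_true, Finset.sum_ite_eq']
    let v : Fin n → F := fun j => if K < j then (α * h).1 s j else 0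
    let B : Matrix (Fin n) (Fin n) F := fun i j => (if i = j then 1 else 0) - (if i = K then v j else 0)
    obtain ⟨β, hβ⟩ := ut_exists B (by
      intro i j hij
      have h1 : i ≠ j := hij.ne'
      simp only [B, if_neg h1, zero_sub, neg_eq_zero]
      by_cases h2 : i = K
      · subst h2
        simp [v, hij.le]
      · simp [h2]) (by
      intro i
      by_cases h2 : i = K
      · simp [B, v, h2]
      · simp [B, h2])
    have hβUT : IsUT F β := by
      intro i j hij
      have h1 : i ≠ j := hij.ne'
      rw [hβ]
      simp only [B, if_neg h1, zero_sub, neg_eq_zero]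
      by_cases h2 : i = K
      · subst h2
        simp [v, hij.le]
      · simp [h2]
    have hcol : ∀ i, (α * h).1 i K = if i = s then 1 else 0 := by
      intro i
      rw [hαh]
      by_cases h2 : i = s
      · simp only [u, h2, if_true]; field_simp; ring
      · simp only [u, h2, if_false]; field_simp; ring
    have hfin : ∀ i j, (α * h * β).1 i j = (α * h).1 i j - if i = s then v j else 0 := by
      intro i j
      rw [Units.val_mul (α * h), hβ, Matrix.mul_apply]
      simp only [B, mul_sub, Finset.sum_sub_distrib, mul_ite, mul_one, mul_zero, Finset.sum_ite_eq,
        Finset.mem_univ, if_true, Finset.sum_ite_eq', hcol, ite_mul, one_mul, zero_mul]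
    have hassoc : α * a * g * (b * β) = α * h * β := by rw [hh]; group
    refine ⟨α * a, b * β, Function.update r K s, UT_mul hαUT ha, UT_mul hb hβUT, ?_⟩
    rw [hassoc]
    intro j hj
    by_cases hjK : j = K
    · subst hjK
      rw [Function.update_self]
      refine ⟨fun i => ?_, fun i => ?_⟩
      · rw [hfin, hcol]; simp [v]
      · rw [hfin, if_pos rfl]
        by_cases h3 : K < i
        · simp [v, h3, h3.ne']
        · by_cases h4 : i = K
          · subst h4; simp [v, hcol]
          · have h5 : (i : ℕ) < k := by
              have h6 : (i : ℕ) ≠ k := fun h => h4 (Fin.ext h)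
              have h7 : ¬ (k < (i : ℕ)) := fun h => h3 h
              omega
            simp [v, h3, h4, hαh, hsj i h5]
    · have hjk : (j : ℕ) < k := by
        have h6 : (j : ℕ) ≠ k := fun h => hjK (Fin.ext h)
        omega
      rw [Function.update_of_ne hjK]
      refine ⟨fun i => ?_, fun i => ?_⟩
      · have h8 : ¬ K < j := fun h => absurd h (by simp [hK, Fin.lt_def]; omega)
        rw [hfin, hαh, hsj j hjk, (hr j hjk).1 i]; simp [v, h8]
      · rw [hfin, if_neg (hrs j hjk), hαh]
        simp only [u, if_neg (hrs j hjk), hrK j hjk, (hr j hjk).2 i]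
        simp

lemma bruhat {n : ℕ} (g : GLn F n) : ∃ (a b : GLn F n) (σ : Equiv.Perm (Fin n)),
    IsUT F a ∧ IsUT F b ∧ g = a * wGL F σ * b := by
  obtain ⟨a, b, r, ha, hb, hr⟩ := bruhat_aux g n le_rfl
  have hinj : Function.Injective r := by
    intro j j' hjj
    have h1 := (hr j j.2).2 j
    have h2 := (hr j' j'.2).2 j
    rw [← hjj, h1] at h2
    by_contra hne
    rw [if_pos rfl, if_neg hne] at h2
    exact one_ne_zero h2
  let σ := Equiv.ofBijective r (Finite.injective_iff_bijective.mp hinj)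
  refine ⟨a⁻¹, b⁻¹, σ, UT_inv ha, UT_inv hb, ?_⟩
  have : a * g * b = wGL F σ := by
    apply gl_ext
    intro i j
    rw [wGL_apply]
    exact (hr j j.2).1 i
  rw [← this]; group
end M4a
end OV

open scoped ComplexOrder
open MeasureTheory
namespace OV
set_option linter.unusedSectionVars false
section M4b
open Matrix
variable {F : Type} [Field F] [Fintype F] [DecidableEq F]

/-- coordinate subspace attached to a predicate -/
def csp (F : Type) [Field F] {n : ℕ} (p : Fin n → Prop) : Set (Fin n → F) := {v | ∀ x, v x ≠ 0 → p x}

lemma card_csp {n : ℕ} (p : Fin n → Prop) [DecidablePred p] :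
    Nat.card (csp F p) = Fintype.card F ^ (Finset.univ.filter p).card := by
  have e : csp F p ≃ ({x // p x} → F) :=
    { toFun := fun v x => v.1 x
      invFun := fun f => ⟨fun x => if h : p x then f ⟨x, h⟩ else 0, fun x hx => by
        by_contra h; simp [h] at hx⟩
      left_inv := by
        intro v
        ext x
        by_cases h : p x
        · simp [h]
        · have : v.1 x = 0 := by by_contra h1; exact h (v.2 x h1)
          simp [h, this]
      right_inv := by
        intro f
        ext x
        simp [x.2] }
  rw [Nat.card_congr e, Nat.card_fun, Nat.card_eq_fintype_card, Nat.card_eq_fintype_card, Fintype.card_subtype]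

lemma PC_csp {n : ℕ} (c : Fin n → ℕ) (g : GLn F n) (hg : g ∈ PC F c) (k : ℕ) (v : Fin n → F)
    (hv : v ∈ csp F (fun x => c x < k)) : g.1 *ᵥ v ∈ csp F (fun x => c x < k) := by
  intro x hx
  rw [Matrix.mulVec, dotProduct] at hx
  obtain ⟨y, -, hy⟩ := Finset.exists_ne_zero_of_sum_ne_zero hx
  have h1 := hv y (right_ne_zero_of_mul hy)
  have h2 : ¬ c y < c x := fun h => (left_ne_zero_of_mul hy) (hg x y h)
  omega

lemma PC_csp_iff {n : ℕ} (c : Fin n → ℕ) (g : GLn F n) (hg : g ∈ PC F c) (k : ℕ) (v : Fin n → F) :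
    g.1 *ᵥ v ∈ csp F (fun x => c x < k) ↔ v ∈ csp F (fun x => c x < k) := by
  refine ⟨fun h => ?_, PC_csp c g hg k v⟩
  have := PC_csp c g⁻¹ (inv_mem hg) k _ h
  rwa [Matrix.mulVec_mulVec, ← Units.val_mul, inv_mul_cancel, Units.val_one, Matrix.one_mulVec] at this

lemma wGL_mulVec {n : ℕ} (σ : Equiv.Perm (Fin n)) (v : Fin n → F) (x : Fin n) :
    ((wGL F σ).1 *ᵥ v) (σ x) = v x := by
  rw [Matrix.mulVec, dotProduct]
  have : ∀ j, (wGL F σ).1 (σ x) j = if x = j then 1 else 0 := by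
    intro j
    rw [wGL_apply]
    simp
  simp [this]

lemma count_eq {n : ℕ} (c d : Fin n → ℕ) (σ τ : Equiv.Perm (Fin n)) (p q : GLn F n) (hp : p ∈ PC F c)
    (hq : q ∈ PC F d) (h : wGL F τ = p * wGL F σ * q) (i j : ℕ) :
    (Finset.univ.filter (fun y => d y < j ∧ c (σ y) < i)).card =
      (Finset.univ.filter (fun y => d y < j ∧ c (τ y) < i)).card := by
  have key : ∀ ρ : Equiv.Perm (Fin n), ∀ v : Fin n → F,
      v ∈ csp F (fun y => d y < j ∧ c (ρ y) < i) ↔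
      (v ∈ csp F (fun y => d y < j) ∧ (wGL F ρ).1 *ᵥ v ∈ csp F (fun y => c y < i)) := by
    intro ρ v
    constructor
    · intro hv
      refine ⟨fun x hx => (hv x hx).1, fun x hx => ?_⟩
      obtain ⟨x, rfl⟩ := ρ.surjective x
      rw [wGL_mulVec] at hx
      exact (hv x hx).2
    · rintro ⟨h1, h2⟩ x hx
      refine ⟨h1 x hx, h2 (ρ x) ?_⟩
      rwa [wGL_mulVec]
  have e : Nat.card (csp F (fun y => d y < j ∧ c (τ y) < i)) = Nat.card (csp F (fun y => d y < j ∧ c (σ y) < i)) := by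
    refine Nat.card_congr
      { toFun := fun v => ⟨q.1 *ᵥ v.1, ?_⟩, invFun := fun v => ⟨(q⁻¹).1 *ᵥ v.1, ?_⟩, left_inv := ?_, right_inv := ?_ }
    · rw [key]
      obtain ⟨h1, h2⟩ := (key τ v.1).1 v.2
      refine ⟨(PC_csp_iff d q hq j _).2 h1, ?_⟩
      rw [h, Units.val_mul, Units.val_mul, ← Matrix.mulVec_mulVec, ← Matrix.mulVec_mulVec] at h2
      exact (PC_csp_iff c p hp i _).1 h2
    · rw [key]
      obtain ⟨h1, h2⟩ := (key σ v.1).1 v.2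
      refine ⟨(PC_csp_iff d q⁻¹ (inv_mem hq) j _).2 h1, ?_⟩
      rw [Matrix.mulVec_mulVec, ← Units.val_mul, h, mul_assoc, mul_inv_cancel, mul_one, Units.val_mul,
        ← Matrix.mulVec_mulVec]
      exact (PC_csp_iff c p hp i _).2 h2
    · intro v
      ext1
      simp only [Matrix.mulVec_mulVec, ← Units.val_mul, inv_mul_cancel, Units.val_one, Matrix.one_mulVec]
    · intro v
      ext1
      simp only [Matrix.mulVec_mulVec, ← Units.val_mul, mul_inv_cancel, Units.val_one, Matrix.one_mulVec]
  rw [card_csp, card_csp] at e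
  exact (Nat.pow_right_injective (Fintype.one_lt_card (α := F)) e).symm

lemma fiber_count {n : ℕ} (c d : Fin n → ℕ) (i j : ℕ) :
    ((Finset.univ.filter (fun y => d y = j ∧ c y = i)).card : ℤ) =
    (Finset.univ.filter (fun y => d y < j + 1 ∧ c y < i + 1)).card - (Finset.univ.filter (fun y => d y < j ∧ c y < i + 1)).card
    - (Finset.univ.filter (fun y => d y < j + 1 ∧ c y < i)).card + (Finset.univ.filter (fun y => d y < j ∧ c y < i)).card := by
  simp only [Finset.card_filter]
  push_cast
  rw [← Finset.sum_sub_distrib, ← Finset.sum_sub_distrib, ← Finset.sum_add_distrib]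
  refine Finset.sum_congr rfl fun y _ => ?_
  split_ifs <;> first | omega | simp

lemma wGL_double {n : ℕ} (c d : Fin n → ℕ) (σ τ : Equiv.Perm (Fin n)) (p q : GLn F n) (hp : p ∈ PC F c)
    (hq : q ∈ PC F d) (h : wGL F τ = p * wGL F σ * q) : ∃ s ∈ SC c, ∃ t ∈ SC d, τ = s * σ * t := by
  have hf : ∀ i j, (Finset.univ.filter (fun y => d y = j ∧ c (σ y) = i)).card =
      (Finset.univ.filter (fun y => d y = j ∧ c (τ y) = i)).card := by
    intro i j
    have h1 := fiber_count (c ∘ σ) d i j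
    have h2 := fiber_count (c ∘ τ) d i j
    simp only [Function.comp] at h1 h2
    have h3 := count_eq c d σ τ p q hp hq h
    simp only [h3] at h1
    exact_mod_cast h1.trans h2.symm
  let f : Fin n → ℕ × ℕ := fun y => (d y, c (σ y))
  let f' : Fin n → ℕ × ℕ := fun y => (d y, c (τ y))
  have e : ∀ γ, Nonempty ({a // f' a = γ} ≃ {b // f b = γ}) := by
    rintro ⟨j, i⟩
    refine ⟨Fintype.equivOfCardEq ?_⟩
    rw [Fintype.card_subtype, Fintype.card_subtype]
    simp only [f, f', Prod.mk.injEq]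
    exact (hf i j).symm
  let t : Equiv.Perm (Fin n) := Equiv.ofFiberEquiv (fun γ => Classical.choice (e γ))
  have ht : ∀ x, f (t x) = f' x := fun x => Equiv.ofFiberEquiv_map _ x
  have ht1 : ∀ x, d (t x) = d x := fun x => congrArg Prod.fst (ht x)
  have ht2 : ∀ x, c (σ (t x)) = c (τ x) := fun x => congrArg Prod.snd (ht x)
  refine ⟨τ * t⁻¹ * σ⁻¹, ?_, t, ht1, by group⟩
  intro x
  have := ht2 (t⁻¹ (σ⁻¹ x))
  simp at this
  simp [Equiv.Perm.mul_apply, ← this]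

/-- double coset count -/
def dcSetoid {G : Type} [Group G] (P Q : Subgroup G) : Setoid G where
  r x y := ∃ p ∈ P, ∃ q ∈ Q, y = p * x * q
  iseqv := by
    refine ⟨fun x => ⟨1, one_mem _, 1, one_mem _, by simp⟩, ?_, ?_⟩
    · rintro x y ⟨p, hp, q, hq, rfl⟩
      exact ⟨p⁻¹, inv_mem hp, q⁻¹, inv_mem hq, by group⟩
    · rintro x y z ⟨p, hp, q, hq, rfl⟩ ⟨p', hp', q', hq', rfl⟩
      exact ⟨p' * p, mul_mem hp' hp, q * q', mul_mem hq hq', by group⟩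

lemma dc_card {n : ℕ} (c d : Fin n → ℕ) (hc : Monotone c) (hd : Monotone d) :
    Nat.card (Quotient (dcSetoid (SC c) (SC d))) = Nat.card (Quotient (dcSetoid (PC F c) (PC F d))) := by
  refine Nat.card_congr (Equiv.ofBijective (Quotient.map (wGL F) ?_) ⟨?_, ?_⟩)
  · rintro σ τ ⟨p, hp, q, hq, rfl⟩
    exact ⟨_, wGL_mem c p hp, _, wGL_mem d q hq, by rw [wGL_mul, wGL_mul]⟩
  · intro x y
    refine Quotient.inductionOn₂ x y fun σ τ h => ?_
    obtain ⟨p, hp, q, hq, h⟩ := Quotient.exact h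
    exact Quotient.sound (wGL_double c d σ τ p q hp hq h)
  · intro x
    refine Quotient.inductionOn x fun g => ?_
    obtain ⟨a, b, σ, ha, hb, rfl⟩ := bruhat g
    exact ⟨Quotient.mk _ σ, Quotient.sound ⟨a, UT_mem_PC c hc a ha, b, UT_mem_PC d hd b hb, rfl⟩⟩

section perm
open scoped Classical
variable {G : Type} [Group G] [Fintype G]

/-- average over a subgroup -/
noncomputable def avgS (P : Subgroup G) (φ : G → ℂ) : ℂ := (Fintype.card P : ℂ)⁻¹ * ∑ h : P, φ h

/-- permutation character -/
noncomputable def pch (P : Subgroup G) (g : G) : ℂ :=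
  (Fintype.card P : ℂ)⁻¹ * ((Finset.univ.filter (fun x : G => x⁻¹ * g * x ∈ P)).card : ℂ)

lemma sum_subgroup (P : Subgroup G) (φ : G → ℂ) : ∑ h : P, φ h = ∑ g, if g ∈ P then φ g else 0 := by
  rw [← Finset.sum_filter]
  exact (Finset.sum_subtype _ (by simp) _).symm

lemma pch_conj (P : Subgroup G) (g h : G) : pch P (h * g * h⁻¹) = pch P g := by
  unfold pch
  congr 2
  refine Finset.card_bij (fun x _ => h⁻¹ * x) ?_ ?_ ?_
  · intro x hx
    simp only [Finset.mem_filter, Finset.mem_univ, true_and] at hx ⊢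
    convert hx using 1; group
  · intro x _ y _ hxy
    exact mul_left_cancel hxy
  · intro x hx
    refine ⟨h * x, ?_, by group⟩
    simp only [Finset.mem_filter, Finset.mem_univ, true_and] at hx ⊢
    convert hx using 1; group

lemma pch_star (P : Subgroup G) (g : G) : star (pch P g) = pch P g := by simp [pch]

lemma cip_pch (P : Subgroup G) (φ : G → ℂ) (hφ : ∀ g h, φ (h * g * h⁻¹) = φ g) : cip φ (pch P) = avgS P φ := by
  unfold cip avgS
  rw [sum_subgroup]
  have h1 : ∑ g, φ g * star (pch P g) = (Fintype.card P : ℂ)⁻¹ * ∑ x : G, ∑ g, if x⁻¹ * g * x ∈ P then φ g else 0 := by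
    rw [Finset.sum_comm, Finset.mul_sum]
    refine Finset.sum_congr rfl fun g _ => ?_
    rw [pch_star, pch, ← Finset.sum_filter, Finset.sum_const, nsmul_eq_mul]; ring
  have h2 : ∀ x : G, (∑ g, if x⁻¹ * g * x ∈ P then φ g else 0) = ∑ g, if g ∈ P then φ g else 0 := by
    intro x
    refine Fintype.sum_equiv (MulAut.conj x⁻¹).toEquiv _ _ fun g => ?_
    have := hφ g x⁻¹
    simp at this
    simp [this]
  rw [h1, Finset.sum_congr rfl (fun x _ => h2 x), Finset.sum_const, nsmul_eq_mul, Finset.card_univ]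
  have : (Fintype.card G : ℂ) ≠ 0 := by simp
  field_simp

lemma cip_pch_pch (P Q : Subgroup G) : cip (pch P) (pch Q) = Nat.card (Quotient (dcSetoid P Q)) := by
  rw [← cip_star, cip_pch P _ (fun g h => pch_conj Q g h), avgS]
  let act : MulAction (P × Q) G :=
    { smul := fun a x => a.1 * x * (a.2 : G)⁻¹
      one_smul := fun x => by change ((1 : P × Q).1 : G) * x * ((1 : P × Q).2 : G)⁻¹ = x; simp
      mul_smul := fun a b x => by
        change ((a * b).1 : G) * x * ((a * b).2 : G)⁻¹ = a.1 * (b.1 * x * (b.2 : G)⁻¹) * (a.2 : G)⁻¹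
        simp [mul_assoc] }
  have hb := MulAction.sum_card_fixedBy_eq_card_orbits_mul_card_group (P × Q) G
  have ho : Fintype.card (Quotient (MulAction.orbitRel (P × Q) G)) = Nat.card (Quotient (dcSetoid P Q)) := by
    rw [← Nat.card_eq_fintype_card]
    refine Nat.card_congr (Quotient.congrRight fun x y => ?_)
    constructor
    · rintro ⟨⟨p, q⟩, h⟩
      have h' : (p : G) * y * (q : G)⁻¹ = x := h
      exact ⟨(p : G)⁻¹, inv_mem p.2, q, q.2, by rw [← h']; group⟩
    · rintro ⟨p, hp, q, hq, rfl⟩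
      refine ⟨(⟨p⁻¹, inv_mem hp⟩, ⟨q, hq⟩), ?_⟩
      change p⁻¹ * (p * x * q) * q⁻¹ = x
      group
  rw [ho, Fintype.card_prod] at hb
  have hsum : ∑ a : P × Q, Fintype.card (MulAction.fixedBy G a) =
      ∑ p : P, (Finset.univ.filter (fun x : G => x⁻¹ * p * x ∈ Q)).card := by
    rw [Fintype.sum_prod_type]
    refine Finset.sum_congr rfl fun p _ => ?_
    have : ∀ q : Q, Fintype.card (MulAction.fixedBy G (p, q)) =
        (Finset.univ.filter (fun x : G => x⁻¹ * p * x = q)).card := by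
      intro q
      rw [← Set.toFinset_card]
      congr 1
      ext x
      simp only [Set.mem_toFinset, MulAction.mem_fixedBy, Finset.mem_filter, Finset.mem_univ, true_and]
      change (p : G) * x * (q : G)⁻¹ = x ↔ _
      rw [mul_inv_eq_iff_eq_mul, mul_assoc, inv_mul_eq_iff_eq_mul]
    simp only [this, Finset.card_filter]
    rw [Finset.sum_comm]
    refine Finset.sum_congr rfl fun x _ => ?_
    by_cases h : x⁻¹ * p * x ∈ Q
    · rw [if_pos h, Finset.sum_eq_single (⟨_, h⟩ : Q)]
      · simp
      · intro b _ hb'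
        rw [if_neg]
        intro h'
        exact hb' (Subtype.ext h'.symm)
      · simp
    · rw [if_neg h]
      refine Finset.sum_eq_zero fun q _ => ?_
      rw [if_neg]
      intro h'
      exact h (h' ▸ q.2)
  rw [hsum] at hb
  have hb' : (∑ p : P, ((Finset.univ.filter (fun x : G => x⁻¹ * p * x ∈ Q)).card : ℂ)) =
      (Nat.card (Quotient (dcSetoid P Q)) : ℂ) * ((Fintype.card P : ℂ) * (Fintype.card Q : ℂ)) := by
    exact_mod_cast hb
  simp only [pch]
  rw [← Finset.mul_sum, hb']
  have h1 : (Fintype.card P : ℂ) ≠ 0 := by simp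
  have h2 : (Fintype.card Q : ℂ) ≠ 0 := by simp
  field_simp
  simp
end perm

theorem gram_eq {n : ℕ} (c d : Fin n → ℕ) (hc : Monotone c) (hd : Monotone d) :
    cip (pch (SC c)) (pch (SC d)) = cip (pch (PC F c)) (pch (PC F d)) := by
  rw [cip_pch_pch, cip_pch_pch, dc_card (F := F) c d hc hd]
end M4b
end OV

open scoped ComplexOrder
open MeasureTheory
namespace OV
set_option linter.unusedSectionVars false
section M4c
open Matrix
variable {F : Type} [Field F] [Fintype F] [DecidableEq F]

lemma det_last {n : ℕ} (M : Matrix (Fin (n + 1)) (Fin (n + 1)) F) (h : ∀ j : Fin n, M (Fin.last n) j.castSucc = 0) :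
    M.det = M (Fin.last n) (Fin.last n) * (Matrix.det (fun i j : Fin n => M i.castSucc j.castSucc)) := by
  rw [Matrix.det_succ_row M (Fin.last n), Fin.sum_univ_castSucc]
  simp only [h]
  simp
  left
  rfl

lemma gl_det_ne {n : ℕ} (g : GLn F n) : g.1.det ≠ 0 := ((Matrix.isUnit_iff_isUnit_det _).1 g.isUnit).ne_zero

lemma exists_restr {n : ℕ} (h : GLn F (n + 1)) (hh : ∀ j : Fin n, h.1 (Fin.last n) j.castSucc = 0) :
    ∃ g : GLn F n, h ∈ ExtSet F g := by
  have h1 := gl_det_ne h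
  rw [det_last h.1 hh] at h1
  refine ⟨Matrix.GeneralLinearGroup.mkOfDetNeZero _ (right_ne_zero_of_mul h1), ?_⟩
  rw [mem_ExtSet]
  exact ⟨fun i j => rfl, hh⟩

lemma card_ExtSet {n : ℕ} (g : GLn F n) : (ExtSet F g).card = (Fintype.card F - 1) * Fintype.card F ^ n := by
  classical
  let M : (Fin n → F) × Fˣ → Matrix (Fin (n + 1)) (Fin (n + 1)) F := fun p i j =>
    Fin.lastCases (Fin.lastCases (p.2 : F) (fun _ => 0) j)
      (fun i => Fin.lastCases (p.1 i) (fun j => g.1 i j) j) i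
  have hdet : ∀ p, (M p).det ≠ 0 := by
    intro p
    rw [det_last (M p) (by intro j; simp [M])]
    have : (fun i j : Fin n => M p i.castSucc j.castSucc) = g.1 := by
      ext i j; simp [M]
    rw [this]
    refine mul_ne_zero ?_ (gl_det_ne g)
    simp [M]
  have : (ExtSet F g).card = Fintype.card ((Fin n → F) × Fˣ) := by
    rw [← Finset.card_univ]
    symm
    refine Finset.card_bij (fun p _ => Matrix.GeneralLinearGroup.mkOfDetNeZero (M p) (hdet p)) ?_ ?_ ?_
    · intro p _
      rw [mem_ExtSet]
      refine ⟨fun i j => ?_, fun j => ?_⟩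
      · change M p _ _ = _; simp [M]
      · change M p _ _ = _; simp [M]
    · intro p _ p' _ h
      have h' : M p = M p' := congrArg Units.val h
      refine Prod.ext (funext fun i => ?_) (Units.ext ?_)
      · have := congrFun (congrFun h' i.castSucc) (Fin.last n)
        simpa [M] using this
      · have := congrFun (congrFun h' (Fin.last n)) (Fin.last n)
        simpa [M] using this
    · intro h hh
      rw [mem_ExtSet] at hh
      have h1 := gl_det_ne h
      rw [det_last h.1 hh.2] at h1
      refine ⟨(fun i => h.1 i.castSucc (Fin.last n), Units.mk0 _ (left_ne_zero_of_mul h1)), Finset.mem_univ _, ?_⟩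
      apply gl_ext
      intro i j
      change M _ i j = _
      refine Fin.lastCases ?_ (fun i => ?_) i <;> refine Fin.lastCases ?_ (fun j => ?_) j
      · simp [M]
      · simp [M, hh.2 j]
      · simp [M]
      · simp [M, hh.1 i j]
  rw [this, Fintype.card_prod, Fintype.card_fun, Fintype.card_units, Fintype.card_fin, mul_comm]

lemma mem_PC_snoc {n : ℕ} (c : Fin n → ℕ) (K : ℕ) (hK : ∀ x, c x < K) (h : GLn F (n + 1)) :
    h ∈ PC F (Fin.snoc c K : Fin (n + 1) → ℕ) ↔ ∃ g ∈ PC F c, h ∈ ExtSet F g := by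
  constructor
  · intro hh
    obtain ⟨g, hg⟩ := exists_restr h (fun j => hh _ _ (by simp [hK]))
    refine ⟨g, ?_, hg⟩
    intro i j hij
    rw [mem_ExtSet] at hg
    rw [← hg.1]
    exact hh _ _ (by simpa using hij)
  · rintro ⟨g, hg, hh⟩
    rw [mem_ExtSet] at hh
    intro i j
    refine Fin.lastCases ?_ (fun i => ?_) i <;> refine Fin.lastCases ?_ (fun j => ?_) j
    · simp
    · intro _; exact hh.2 j
    · intro h1
      simp at h1
      exact absurd h1 (not_lt.mpr (hK i).le)
    · intro h1
      simp at h1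
      rw [hh.1]
      exact hg _ _ h1

open scoped Classical in
lemma sum_PC_snoc {n : ℕ} (c : Fin n → ℕ) (K : ℕ) (hK : ∀ x, c x < K) (φ : GLn F (n + 1) → ℂ) :
    ∑ h : PC F (Fin.snoc c K : Fin (n + 1) → ℕ), φ h = ∑ g : PC F c, ∑ h ∈ ExtSet F (g : GLn F n), φ h := by
  rw [← Finset.sum_biUnion]
  · symm
    refine Finset.sum_subtype _ (fun h => ?_) φ
    rw [mem_PC_snoc c K hK]
    simp
  · intro g _ g' _ hne
    rw [Function.onFun, Finset.disjoint_left]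
    intro h h1 h2
    rw [mem_ExtSet] at h1 h2
    exact hne (Subtype.ext (gl_ext _ _ fun i j => by rw [← h1.1, ← h2.1]))

lemma avg_PC_snoc {n : ℕ} (c : Fin n → ℕ) (K : ℕ) (hK : ∀ x, c x < K) (φ : GLn F n → ℂ) (φ' : GLn F (n + 1) → ℂ)
    (h : ∀ g, φ g = (((Fintype.card F : ℂ) - 1) * (Fintype.card F : ℂ) ^ n)⁻¹ * ∑ h ∈ ExtSet F g, φ' h) :
    avgS (PC F c) φ = avgS (PC F (Fin.snoc c K : Fin (n + 1) → ℕ)) φ' := by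
  classical
  have hq : (Fintype.card F : ℂ) - 1 ≠ 0 := by
    have := Fintype.one_lt_card (α := F)
    rw [sub_ne_zero]
    exact_mod_cast this.ne'
  have hq' : (Fintype.card F : ℂ) ≠ 0 := by simp
  have hcard : (Fintype.card (PC F (Fin.snoc c K : Fin (n + 1) → ℕ)) : ℂ) =
      Fintype.card (PC F c) * (((Fintype.card F : ℂ) - 1) * (Fintype.card F : ℂ) ^ n) := by
    have := sum_PC_snoc (F := F) c K hK (fun _ => 1)
    simp [card_ExtSet] at this
    rw [Nat.cast_sub Fintype.card_pos] at this
    push_cast at this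
    convert this using 1
  unfold avgS
  rw [sum_PC_snoc c K hK, hcard]
  simp only [h]
  rw [← Finset.mul_sum, mul_inv (Fintype.card (PC F c) : ℂ), mul_assoc]

/-- embedding of symmetric groups -/
noncomputable def embS (n : ℕ) (σ : Equiv.Perm (Fin n)) : Equiv.Perm (Fin (n + 1)) :=
  σ.viaFintypeEmbedding Fin.castSuccEmb

lemma embS_cast {n : ℕ} (σ : Equiv.Perm (Fin n)) (x : Fin n) : embS n σ x.castSucc = (σ x).castSucc :=
  Equiv.Perm.viaFintypeEmbedding_apply_image σ Fin.castSuccEmb x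

lemma embS_last {n : ℕ} (σ : Equiv.Perm (Fin n)) : embS n σ (Fin.last n) = Fin.last n := by
  apply Equiv.Perm.viaFintypeEmbedding_apply_notMem_range
  rintro ⟨x, hx⟩
  exact absurd hx (Fin.castSucc_lt_last x).ne

lemma embS_inj {n : ℕ} : Function.Injective (embS n) := by
  intro σ τ h
  ext x
  have := embS_cast σ x
  rw [h, embS_cast] at this
  exact congrArg Fin.val (Fin.castSucc_injective _ this.symm)

lemma exists_embS {n : ℕ} (τ : Equiv.Perm (Fin (n + 1))) (h : τ (Fin.last n) = Fin.last n) :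
    ∃ σ, embS n σ = τ := by
  have hx : ∀ x : Fin n, τ x.castSucc ≠ Fin.last n := by
    intro x hx
    rw [← h] at hx
    exact (Fin.castSucc_lt_last x).ne (τ.injective hx)
  let f : Fin n → Fin n := fun x => (τ x.castSucc).castPred (hx x)
  have hf : Function.Injective f := by
    intro x y hxy
    have := (Fin.castPred_inj).1 hxy
    exact Fin.castSucc_injective _ (τ.injective this)
  refine ⟨Equiv.ofBijective f (Finite.injective_iff_bijective.mp hf), ?_⟩
  apply Equiv.ext
  intro x
  refine Fin.lastCases ?_ (fun x => ?_) x
  · rw [embS_last, h]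
  · rw [embS_cast]; simp [f]

lemma avg_SC_snoc {n : ℕ} (c : Fin n → ℕ) (K : ℕ) (hK : ∀ x, c x < K) (f : Equiv.Perm (Fin (n + 1)) → ℂ) :
    avgS (SC c) (fun σ => f (embS n σ)) = avgS (SC (Fin.snoc c K : Fin (n + 1) → ℕ)) f := by
  classical
  have hmem : ∀ σ, σ ∈ SC c → embS n σ ∈ SC (Fin.snoc c K : Fin (n + 1) → ℕ) := by
    intro σ hσ x
    refine Fin.lastCases ?_ (fun x => ?_) x
    · rw [embS_last]
    · rw [embS_cast]; simp [hσ x]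
  let e : SC c → SC (Fin.snoc c K : Fin (n + 1) → ℕ) := fun σ => ⟨embS n σ.1, hmem σ.1 σ.2⟩
  have he : Function.Bijective e := by
    refine ⟨fun σ τ h => Subtype.ext (embS_inj (congrArg Subtype.val h)), ?_⟩
    rintro ⟨τ, hτ⟩
    have h1 : τ (Fin.last n) = Fin.last n := by
      have h2 := hτ (Fin.last n)
      by_contra h3
      obtain ⟨y, hy⟩ := Fin.exists_castSucc_eq.mpr h3
      rw [← hy] at h2
      simp at h2
      exact absurd h2 (hK y).ne
    obtain ⟨σ, rfl⟩ := exists_embS τ h1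
    refine ⟨⟨σ, fun x => ?_⟩, rfl⟩
    have := hτ x.castSucc
    rw [embS_cast] at this
    simpa using this
  unfold avgS
  rw [Fintype.card_of_bijective he]
  congr 1
  exact Fintype.sum_bijective e he _ _ (fun _ => rfl)

lemma snoc_mono {n : ℕ} (c : Fin n → ℕ) (hc : Monotone c) (K : ℕ) (hK : ∀ x, c x < K) :
    Monotone (Fin.snoc c K : Fin (n + 1) → ℕ) := by
  intro i j
  refine Fin.lastCases ?_ (fun i => ?_) i <;> refine Fin.lastCases ?_ (fun j => ?_) j
  · simp
  · intro h; exact absurd h (not_le.mpr (Fin.castSucc_lt_last j))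
  · intro _; simp [(hK i).le]
  · intro h; simpa using hc (Fin.castSucc_le_castSucc_iff.mp h)
end M4c
end OV

open scoped ComplexOrder
open MeasureTheory
namespace OV
set_option linter.unusedSectionVars false
section M5a

/-- block index of a position in a list of sizes -/
def blk : List ℕ → ℕ → ℕ
  | [], _ => 0
  | a :: t, x => if x < a then 0 else blk t (x - a) + 1

/-- position within block -/
def pos : List ℕ → ℕ → ℕ
  | [], x => x
  | a :: t, x => if x < a then x else pos t (x - a)

lemma pos_lt (l : List ℕ) : ∀ x, x < l.sum → pos l x < l.getD (blk l x) 0 := by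
  induction l with
  | nil => intro x hx; simp at hx
  | cons a t ih =>
    intro x hx
    simp only [List.sum_cons] at hx
    by_cases h : x < a
    · simp [pos, blk, h]
    · simp only [pos, blk, h, if_false, List.getD_cons_succ]
      exact ih _ (by omega)

lemma pos_add (l : List ℕ) : ∀ x, (l.take (blk l x)).sum + pos l x = x := by
  induction l with
  | nil => intro x; simp [pos]
  | cons a t ih =>
    intro x
    by_cases h : x < a
    · simp [pos, blk, h]
    · simp only [pos, blk, h, if_false, List.take_succ_cons, List.sum_cons]
      have := ih (x - a)
      omega

lemma blk_pos_mk (l : List ℕ) : ∀ i j, j < l.getD i 0 →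
    (l.take i).sum + j < l.sum ∧ blk l ((l.take i).sum + j) = i ∧ pos l ((l.take i).sum + j) = j := by
  induction l with
  | nil => intro i j h; simp at h
  | cons a t ih =>
    intro i j h
    cases i with
    | zero =>
      simp at h
      simp [blk, pos, h]; omega
    | succ i =>
      simp only [List.getD_cons_succ] at h
      obtain ⟨h1, h2, h3⟩ := ih i j h
      have e : (List.take (i + 1) (a :: t)).sum + j = a + ((t.take i).sum + j) := by
        simp; omega
      rw [e]
      have hn : ¬ (a + ((t.take i).sum + j) < a) := by omega
      simp only [blk, pos, hn, if_false, Nat.add_sub_cancel_left, h2, h3, List.sum_cons]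
      exact ⟨by omega, trivial, trivial⟩

lemma blk_lt_iff (l : List ℕ) : ∀ x i, x < l.sum → (blk l x < i ↔ x < (l.take i).sum) := by
  induction l with
  | nil => intro x i h; simp at h
  | cons a t ih =>
    intro x i hx
    cases i with
    | zero => simp
    | succ i =>
      simp only [List.sum_cons] at hx
      simp only [List.take_succ_cons, List.sum_cons]
      by_cases h : x < a
      · simp [blk, h]; omega
      · simp only [blk, h, if_false, Nat.add_lt_add_iff_right]
        rw [ih (x - a) i (by omega)]
        omega

lemma blk_mono (l : List ℕ) {x y : ℕ} (hxy : x ≤ y) (hy : y < l.sum) : blk l x ≤ blk l y := by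
  have := (blk_lt_iff l y (blk l y + 1) hy).1 (by omega)
  have h2 := (blk_lt_iff l x (blk l y + 1) (by omega)).2 (by omega)
  omega

lemma blk_lt_len (l : List ℕ) {x : ℕ} (hx : x < l.sum) : blk l x < l.length := by
  rw [blk_lt_iff l x _ hx]; simpa using hx

lemma sum_range_min (T : Finset ℕ) : ∑ i ∈ Finset.range T.card, i ≤ ∑ i ∈ T, i ∧
    (∑ i ∈ Finset.range T.card, i = ∑ i ∈ T, i → T = Finset.range T.card) := by
  induction T using Finset.induction_on_max with
  | empty => simp
  | insert a s hs ih =>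
    have ha : a ∉ s := fun h => lt_irrefl _ (hs a h)
    have hc : s.card ≤ a := by
      have : s ⊆ Finset.range a := fun x hx => Finset.mem_range.2 (hs x hx)
      simpa using Finset.card_le_card this
    rw [Finset.card_insert_of_notMem ha, Finset.sum_insert ha, Finset.sum_range_succ]
    refine ⟨by omega, fun h => ?_⟩
    have h1 : a = s.card := by omega
    have h2 := ih.2 (by omega)
    rw [Finset.range_add_one, ← h2, h1]

variable {N : ℕ}

open scoped Classical in
/-- permutations making the pair injective -/
noncomputable def Xset (c d : Fin N → ℕ) : Finset (Equiv.Perm (Fin N)) :=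
  Finset.univ.filter (fun x => Function.Injective (fun y => (c (x y), d y)))

lemma mem_Xset (c d : Fin N → ℕ) (x : Equiv.Perm (Fin N)) :
    x ∈ Xset c d ↔ Function.Injective (fun y => (c (x y), d y)) := by simp [Xset]

open scoped Classical in
/-- double coset as finset -/
noncomputable def dco (c d : Fin N → ℕ) (x : Equiv.Perm (Fin N)) : Finset (Equiv.Perm (Fin N)) :=
  Finset.univ.image (fun p : SC c × SC d => (p.1 : Equiv.Perm (Fin N)) * x * p.2)

lemma mem_dco (c d : Fin N → ℕ) (x y : Equiv.Perm (Fin N)) :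
    y ∈ dco c d x ↔ ∃ s ∈ SC c, ∃ t ∈ SC d, s * x * t = y := by
  simp [dco]

lemma dco_sub (c d : Fin N → ℕ) (x y : Equiv.Perm (Fin N)) (hx : x ∈ Xset c d) (hy : y ∈ dco c d x) :
    y ∈ Xset c d := by
  rw [mem_dco] at hy
  obtain ⟨s, hs, t, ht, rfl⟩ := hy
  rw [mem_Xset] at hx ⊢
  intro a b hab
  simp only [Equiv.Perm.mul_apply, Prod.mk.injEq] at hab
  rw [hs, hs] at hab
  have : t a = t b := hx (by simp only [Prod.mk.injEq]; exact ⟨hab.1, by rw [ht, ht]; exact hab.2⟩)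
  exact t.injective this

open scoped Classical in
lemma card_dco (c d : Fin N → ℕ) (x : Equiv.Perm (Fin N)) (hx : x ∈ Xset c d) :
    (dco c d x).card = Fintype.card (SC c) * Fintype.card (SC d) := by
  rw [dco, Finset.card_image_of_injective, Finset.card_univ, Fintype.card_prod]
  rintro ⟨s, t⟩ ⟨s', t'⟩ h
  simp only at h
  rw [mem_Xset] at hx
  have key : (t' : Equiv.Perm (Fin N)) * (t : Equiv.Perm (Fin N))⁻¹ = 1 := by
    have e : x * ((t' : Equiv.Perm (Fin N)) * (t : Equiv.Perm (Fin N))⁻¹) =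
        ((s' : Equiv.Perm (Fin N))⁻¹ * s) * x := by
      rw [mul_assoc, eq_inv_mul_iff_mul_eq, ← mul_assoc, ← mul_assoc, ← h]
      group
    apply Equiv.ext
    intro y
    apply hx
    simp only [Prod.mk.injEq]
    constructor
    · have := congrArg (fun σ : Equiv.Perm (Fin N) => c (σ y)) e
      simp only [Equiv.Perm.mul_apply] at this ⊢
      rw [this]
      exact ((SC c).mul_mem ((SC c).inv_mem s'.2) s.2) (x y)
    · exact ((SC d).mul_mem t'.2 ((SC d).inv_mem t.2)) y
  have ht : t = t' := Subtype.ext (by rw [mul_inv_eq_one] at key; exact key.symm)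
  subst ht
  have hs : s = s' := Subtype.ext (by simpa using h)
  rw [hs]

open scoped Classical in
lemma Xset_dvd (c d : Fin N → ℕ) : ∃ k : ℕ, (Xset c d).card = k * (Fintype.card (SC c) * Fintype.card (SC d)) := by
  refine ⟨((Xset c d).image (dco c d)).card, ?_⟩
  rw [Finset.card_eq_sum_card_image (dco c d) (Xset c d)]
  rw [Finset.sum_const_nat (m := Fintype.card (SC c) * Fintype.card (SC d))]
  intro b hb
  obtain ⟨x, hx, rfl⟩ := Finset.mem_image.1 hb
  rw [← card_dco c d x hx]
  congr 1
  ext y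
  rw [Finset.mem_filter]
  constructor
  · rintro ⟨hy, h⟩
    rw [← h, mem_dco]
    exact ⟨1, (SC c).one_mem, 1, (SC d).one_mem, by simp⟩
  · intro h
    refine ⟨dco_sub c d x y hx h, ?_⟩
    rw [mem_dco] at h
    obtain ⟨s, hs, t, ht, rfl⟩ := h
    ext z
    rw [mem_dco, mem_dco]
    constructor
    · rintro ⟨s', hs', t', ht', rfl⟩
      exact ⟨s' * s, (SC c).mul_mem hs' hs, t * t', (SC d).mul_mem ht ht', by group⟩
    · rintro ⟨s', hs', t', ht', rfl⟩
      exact ⟨s' * s⁻¹, (SC c).mul_mem hs' ((SC c).inv_mem hs), t⁻¹ * t', (SC d).mul_mem ((SC d).inv_mem ht) ht', by group⟩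

/-- sign-twisted permutation character -/
noncomputable def sgnf (σ : Equiv.Perm (Fin N)) : ℂ := ((Equiv.Perm.sign σ : ℤ) : ℂ)

lemma sgnf_mul (σ τ : Equiv.Perm (Fin N)) : sgnf (σ * τ) = sgnf σ * sgnf τ := by simp [sgnf]
lemma sgnf_conj (σ τ : Equiv.Perm (Fin N)) : sgnf (τ * σ * τ⁻¹) = sgnf σ := by
  rw [sgnf_mul, mul_comm, ← sgnf_mul, inv_mul_cancel_left]
lemma sgnf_star (σ : Equiv.Perm (Fin N)) : star (sgnf σ) = sgnf σ := by simp [sgnf]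

open scoped Classical in
lemma sgn_sum (c d : Fin N → ℕ) : (∑ t : Equiv.Perm (Fin N), if t ∈ SC c ∧ t ∈ SC d then sgnf t else 0) =
    if Function.Injective (fun y => (c y, d y)) then 1 else 0 := by
  split_ifs with h
  · rw [Finset.sum_eq_single 1]
    · rw [if_pos ⟨(SC c).one_mem, (SC d).one_mem⟩]; simp [sgnf]
    · intro t _ ht
      rw [if_neg]
      rintro ⟨h1, h2⟩
      apply ht
      apply Equiv.ext
      intro y
      apply h
      simp only [Prod.mk.injEq]
      exact ⟨h1 y, h2 y⟩
    · simp
  · simp only [Function.Injective, not_forall] at h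
    obtain ⟨a, b, hab, hne⟩ := h
    simp only [Prod.mk.injEq] at hab
    have hm : ∀ e : Fin N → ℕ, e a = e b → Equiv.swap a b ∈ SC e := by
      intro e he y
      by_cases h1 : y = a
      · subst h1; simp [he]
      · by_cases h2 : y = b
        · subst h2; simp [he]
        · rw [Equiv.swap_apply_of_ne_of_ne h1 h2]
    have h1 := hm c hab.1
    have h2 := hm d hab.2
    have key : (∑ t : Equiv.Perm (Fin N), if t ∈ SC c ∧ t ∈ SC d then sgnf t else 0) =
        -(∑ t : Equiv.Perm (Fin N), if t ∈ SC c ∧ t ∈ SC d then sgnf t else 0) := by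
      conv_lhs => rw [← Equiv.sum_comp (Equiv.mulLeft (Equiv.swap a b))]
      rw [← Finset.sum_neg_distrib]
      refine Finset.sum_congr rfl fun t _ => ?_
      simp only [Equiv.coe_mulLeft, Subgroup.mul_mem_cancel_left _ h1, Subgroup.mul_mem_cancel_left _ h2, sgnf_mul]
      split_ifs
      · simp [sgnf, Equiv.Perm.sign_swap hne]
      · simp
    exact self_eq_neg.1 key

open scoped Classical in
lemma cip_mix (c d : Fin N → ℕ) : cip (pch (SC c)) (fun σ => sgnf σ * pch (SC d) σ) =
    ((Xset c d).card : ℂ) / ((Fintype.card (SC c) : ℂ) * Fintype.card (SC d)) := by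
  have h1 : cip (pch (SC c)) (fun σ => sgnf σ * pch (SC d) σ) = cip (fun σ => sgnf σ * pch (SC c) σ) (pch (SC d)) := by
    simp only [cip]
    congr 1
    refine Finset.sum_congr rfl fun σ _ => ?_
    rw [star_mul', sgnf_star]; ring
  rw [h1, cip_pch _ _ (fun g h => by rw [sgnf_conj, pch_conj])]
  unfold avgS
  rw [sum_subgroup (SC d) (fun σ => sgnf σ * pch (SC c) σ)]
  have h2 : ∀ t, (if t ∈ SC d then sgnf t * pch (SC c) t else 0) =
      (Fintype.card (SC c) : ℂ)⁻¹ * ∑ x : Equiv.Perm (Fin N), if t ∈ SC (fun y => c (x y)) ∧ t ∈ SC d then sgnf t else 0 := by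
    intro t
    by_cases ht : t ∈ SC d
    · simp only [ht, if_true, and_true]
      rw [Finset.sum_ite, Finset.sum_const_zero, add_zero, Finset.sum_const, nsmul_eq_mul, pch]
      have : (Finset.univ.filter (fun x : Equiv.Perm (Fin N) => x⁻¹ * t * x ∈ SC c)).card =
          (Finset.univ.filter (fun x : Equiv.Perm (Fin N) => t ∈ SC (fun y => c (x y)))).card := by
        refine Finset.card_bij (fun x _ => x⁻¹) ?_ (fun x _ y _ h => inv_injective h) ?_
        · intro x hx
          simp only [Finset.mem_filter, Finset.mem_univ, true_and] at hx ⊢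
          intro y
          have := hx (x⁻¹ y)
          simpa using this
        · intro x hx
          refine ⟨x⁻¹, ?_, by simp⟩
          simp only [Finset.mem_filter, Finset.mem_univ, true_and] at hx ⊢
          intro y
          have := hx (x⁻¹ y)
          simpa using this
      rw [this]; ring
    · simp [ht]
  simp only [h2]
  rw [← Finset.mul_sum, Finset.sum_comm]
  simp only [sgn_sum]
  rw [Finset.sum_ite, Finset.sum_const_zero, add_zero, Finset.sum_const, nsmul_eq_mul, mul_one]
  rw [Xset]
  field_simp
end M5a
end OV

open scoped ComplexOrder
open MeasureTheory
namespace OV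
set_option linter.unusedSectionVars false
section M5b
variable {N : ℕ}

/-- the list of parts -/
noncomputable def pl (μ : Nat.Partition N) : List ℕ := μ.parts.toList
lemma pl_sum (μ : Nat.Partition N) : (pl μ).sum = N := by
  rw [pl, Multiset.sum_toList, μ.parts_sum]
/-- row coloring -/
noncomputable def cP (μ : Nat.Partition N) (x : Fin N) : ℕ := blk (pl μ) x
/-- column coloring -/
noncomputable def dP (μ : Nat.Partition N) (x : Fin N) : ℕ := pos (pl μ) x

lemma cP_mono (μ : Nat.Partition N) : Monotone (cP μ) := fun x y h =>
  blk_mono _ h (by rw [pl_sum]; exact y.2)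

lemma cP_lt (μ : Nat.Partition N) (x : Fin N) : cP μ x < (pl μ).length :=
  blk_lt_len _ (by rw [pl_sum]; exact x.2)

lemma cPdP_inj (μ : Nat.Partition N) : Function.Injective (fun y => (cP μ y, dP μ y)) := by
  intro x y h
  simp only [Prod.mk.injEq, cP, dP] at h
  have h1 := pos_add (pl μ) x
  have h2 := pos_add (pl μ) y
  rw [h.1, h.2, h2] at h1
  exact Fin.ext h1.symm

/-- row of a filling -/
noncomputable def row (c e : Fin N → ℕ) (i : ℕ) : Finset ℕ :=
  (Finset.univ.filter (fun y => c y = i)).image e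

lemma row_base (μ : Nat.Partition N) (i : ℕ) : row (cP μ) (dP μ) i = Finset.range ((pl μ).getD i 0) := by
  ext j
  simp only [row, Finset.mem_image, Finset.mem_filter, Finset.mem_univ, true_and, Finset.mem_range]
  constructor
  · rintro ⟨y, rfl, rfl⟩
    exact pos_lt _ _ (by rw [pl_sum]; exact y.2)
  · intro h
    obtain ⟨h1, h2, h3⟩ := blk_pos_mk (pl μ) i j h
    rw [pl_sum] at h1
    exact ⟨⟨_, h1⟩, h2, h3⟩

lemma row_inj (c e : Fin N → ℕ) (h : Function.Injective (fun y => (c y, e y))) (i : ℕ) :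
    Set.InjOn e (Finset.univ.filter (fun y => c y = i) : Finset (Fin N)) := by
  intro a ha b hb hab
  simp only [Finset.coe_filter, Finset.mem_univ, true_and, Set.mem_setOf_eq] at ha hb
  exact h (by simp only [Prod.mk.injEq]; exact ⟨ha.trans hb.symm, hab⟩)

lemma row_card (c e : Fin N → ℕ) (h : Function.Injective (fun y => (c y, e y))) (i : ℕ) :
    (row c e i).card = (Finset.univ.filter (fun y => c y = i)).card :=
  Finset.card_image_of_injOn (row_inj c e h i)

lemma row_sum (c e : Fin N → ℕ) (h : Function.Injective (fun y => (c y, e y))) (L : ℕ) (hL : ∀ y, c y < L)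
    (f : ℕ → ℕ) : ∑ y, f (e y) = ∑ i ∈ Finset.range L, ∑ j ∈ row c e i, f j := by
  rw [← Finset.sum_fiberwise_of_maps_to (s := Finset.univ) (t := Finset.range L) (g := c)
    (fun y _ => Finset.mem_range.2 (hL y))]
  refine Finset.sum_congr rfl fun i _ => ?_
  rw [row, Finset.sum_image (row_inj c e h i)]

lemma row_card_perm (μ : Nat.Partition N) (x : Equiv.Perm (Fin N)) (e : Fin N → ℕ)
    (h : Function.Injective (fun y => (cP μ (x y), e y))) (i : ℕ) :
    (row (fun y => cP μ (x y)) e i).card = (pl μ).getD i 0 := by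
  rw [row_card _ _ h]
  have h1 : (row (cP μ) (dP μ) i).card = (pl μ).getD i 0 := by rw [row_base, Finset.card_range]
  rw [row_card _ _ (cPdP_inj μ)] at h1
  rw [← h1]
  refine Finset.card_bij (fun y _ => x y) ?_ (fun a _ b _ h => x.injective h) ?_
  · intro y hy; simpa using hy
  · intro y hy; exact ⟨x⁻¹ y, by simpa using hy, by simp⟩

/-- potential -/
noncomputable def bP (μ : Nat.Partition N) : ℕ := ∑ y, dP μ y

lemma bP_eq (μ : Nat.Partition N) : bP μ = ∑ i ∈ Finset.range (pl μ).length, ∑ j ∈ Finset.range ((pl μ).getD i 0), j := by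
  rw [bP, row_sum (cP μ) (dP μ) (cPdP_inj μ) _ (cP_lt μ) (fun j => j)]
  simp only [row_base]

lemma bP_le (μ ρ : Nat.Partition N) (x : Equiv.Perm (Fin N)) (hx : x ∈ Xset (cP μ) (dP ρ)) :
    bP μ ≤ bP ρ ∧ (bP μ = bP ρ → ∀ i, row (fun y => cP μ (x y)) (dP ρ) i = Finset.range ((pl μ).getD i 0)) := by
  rw [mem_Xset] at hx
  have e : bP ρ = ∑ i ∈ Finset.range (pl μ).length, ∑ j ∈ row (fun y => cP μ (x y)) (dP ρ) i, j :=
    row_sum (fun y => cP μ (x y)) (dP ρ) hx _ (fun y => cP_lt μ (x y)) (fun j => j)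
  have hle : ∀ i ∈ Finset.range (pl μ).length, ∑ j ∈ Finset.range ((pl μ).getD i 0), j ≤
      ∑ j ∈ row (fun y => cP μ (x y)) (dP ρ) i, j := by
    intro i _
    have := (sum_range_min (row (fun y => cP μ (x y)) (dP ρ) i)).1
    rwa [row_card_perm μ x _ hx] at this
  rw [e, bP_eq]
  refine ⟨Finset.sum_le_sum hle, fun h i => ?_⟩
  rw [Finset.sum_eq_sum_iff_of_le hle] at h
  by_cases hi : i < (pl μ).length
  · have h1 := (sum_range_min (row (fun y => cP μ (x y)) (dP ρ) i)).2
    rw [row_card_perm μ x _ hx] at h1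
    exact h1 (h i (Finset.mem_range.2 hi))
  · have h1 := row_card_perm μ x _ hx i
    rw [List.getD_eq_default _ _ (not_lt.mp hi)] at h1 ⊢
    rw [Finset.card_eq_zero] at h1
    rw [h1]; simp

lemma countP_eq (μ : Nat.Partition N) (l : ℕ) :
    ∑ i ∈ Finset.range (pl μ).length, ∑ j ∈ Finset.range ((pl μ).getD i 0), (if j = l then 1 else 0) =
     μ.parts.countP (fun a => l < a) := by
  have h1 : μ.parts.countP (fun a => l < a) = (pl μ).countP (fun a => l < a) := by
    rw [← Multiset.coe_countP, pl, Multiset.coe_toList]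
  rw [h1]
  generalize pl μ = L
  simp only [Finset.sum_ite_eq', Finset.mem_range]
  induction L with
  | nil => simp
  | cons a t ih =>
    rw [List.length_cons, Finset.sum_range_succ', List.countP_cons]
    simp only [List.getD_cons_succ, List.getD_cons_zero, ih, decide_eq_true_eq]

lemma part_ext (μ ρ : Nat.Partition N) (h : ∀ l, μ.parts.countP (fun a => l < a) = ρ.parts.countP (fun a => l < a)) :
    μ = ρ := by
  have key : ∀ (s : Multiset ℕ) (k : ℕ), s.countP (fun a => k < a) = s.count (k + 1) + s.countP (fun a => k + 1 < a) := by
    intro s k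
    induction s using Multiset.induction_on with
    | empty => simp
    | cons a s ih =>
      rw [Multiset.countP_cons, Multiset.countP_cons, Multiset.count_cons, ih]
      by_cases h1 : k + 1 = a
      · subst h1; simp; omega
      · by_cases h2 : k < a
        · have : k + 1 < a := by omega
          simp [h1, h2, this]; omega
        · have : ¬ k + 1 < a := by omega
          simp [h1, h2, this]
  apply Nat.Partition.ext
  ext a
  cases a with
  | zero =>
    rw [Multiset.count_eq_zero_of_notMem (fun h => absurd (μ.parts_pos h) (lt_irrefl _)),
      Multiset.count_eq_zero_of_notMem (fun h => absurd (ρ.parts_pos h) (lt_irrefl _))]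
  | succ k =>
    have h1 := key μ.parts k
    have h2 := key ρ.parts k
    rw [h k, h (k + 1)] at h1
    omega

lemma Xset_tri (μ ρ : Nat.Partition N) (h : (Xset (cP μ) (dP ρ)).Nonempty) : bP μ ≤ bP ρ ∧ (bP μ = bP ρ → μ = ρ) := by
  obtain ⟨x, hx⟩ := h
  refine ⟨(bP_le μ ρ x hx).1, fun hb => part_ext _ _ fun l => ?_⟩
  have h1 := (bP_le μ ρ x hx).2 hb
  rw [mem_Xset] at hx
  have h2 := row_sum _ _ hx _ (fun y => cP_lt μ (x y)) (fun j => if j = l then 1 else 0)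
  have h3 := row_sum (cP ρ) (dP ρ) (cPdP_inj ρ) _ (cP_lt ρ) (fun j => if j = l then 1 else 0)
  simp only [h1] at h2
  simp only [row_base] at h3
  rw [← countP_eq, ← countP_eq, ← h2, ← h3]

open scoped Classical in
lemma Xset_diag (μ : Nat.Partition N) : (Xset (cP μ) (dP μ)).card =
    Fintype.card (SC (cP μ)) * Fintype.card (SC (dP μ)) := by
  have h1 : (1 : Equiv.Perm (Fin N)) ∈ Xset (cP μ) (dP μ) := by
    rw [mem_Xset]; exact cPdP_inj μ
  rw [← card_dco _ _ 1 h1]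
  congr 1
  ext x
  refine ⟨fun hx => ?_, fun hx => dco_sub _ _ _ _ h1 hx⟩
  have h2 := (bP_le μ μ x hx).2 rfl
  rw [mem_Xset] at hx
  have h3 : ∀ y, ∃ z, cP μ z = cP μ (x y) ∧ dP μ z = dP μ y := by
    intro y
    have : dP μ y ∈ row (fun y => cP μ (x y)) (dP μ) (cP μ (x y)) := by
      simp only [row, Finset.mem_image, Finset.mem_filter, Finset.mem_univ, true_and]
      exact ⟨y, rfl, rfl⟩
    rw [h2, ← row_base] at this
    simpa [row] using this
  choose t ht1 ht2 using h3
  have hinj : Function.Injective t := by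
    intro a b hab
    apply hx
    simp only [Prod.mk.injEq]
    rw [← ht1, ← ht1, ← ht2, ← ht2 b, hab]
    exact ⟨rfl, rfl⟩
  let τ : Equiv.Perm (Fin N) := Equiv.ofBijective t (Finite.injective_iff_bijective.mp hinj)
  rw [mem_dco]
  have hτ : τ ∈ SC (dP μ) := fun y => ht2 y
  refine ⟨x * τ⁻¹, ?_, τ, hτ, by simp⟩
  intro y
  have := ht1 (τ⁻¹ y)
  have h5 : t (τ⁻¹ y) = y := by
    change τ (τ⁻¹ y) = y
    simp
  rw [h5] at this
  exact this.symm

/-- the unimodular matrix -/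
noncomputable def KM (N : ℕ) : Matrix (Nat.Partition N) (Nat.Partition N) ℤ := fun μ ρ =>
  ((Xset_dvd (cP μ) (dP ρ)).choose : ℤ)

/-- sign-twisted characters -/
noncomputable def eP (ρ : Nat.Partition N) (σ : Equiv.Perm (Fin N)) : ℂ := sgnf σ * pch (SC (dP ρ)) σ

lemma KM_eq (μ ρ : Nat.Partition N) : cip (pch (SC (cP μ))) (eP ρ) = ((KM N μ ρ : ℤ) : ℂ) := by
  classical
  unfold eP
  rw [cip_mix, (Xset_dvd (cP μ) (dP ρ)).choose_spec]
  have h1 : (Fintype.card (SC (cP μ)) : ℂ) ≠ 0 := by simp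
  have h2 : (Fintype.card (SC (dP ρ)) : ℂ) ≠ 0 := by simp
  push_cast
  rw [mul_div_assoc, div_self (mul_ne_zero h1 h2), mul_one]
  simp [KM]

lemma KM_zero (μ ρ : Nat.Partition N) (h : ¬ (Xset (cP μ) (dP ρ)).Nonempty) : KM N μ ρ = 0 := by
  classical
  rw [Finset.not_nonempty_iff_eq_empty] at h
  have h1 : cip (pch (SC (cP μ))) (eP ρ) = 0 := by
    unfold eP
    rw [cip_mix, h]; simp
  rw [KM_eq] at h1
  exact_mod_cast h1

lemma KM_one (μ : Nat.Partition N) : KM N μ μ = 1 := by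
  classical
  have h1 : cip (pch (SC (cP μ))) (eP μ) = 1 := by
    unfold eP
    rw [cip_mix, Xset_diag]
    push_cast
    refine div_self (mul_ne_zero ?_ ?_) <;> simp
  rw [KM_eq] at h1
  exact_mod_cast h1

lemma KM_det : (KM N).det = 1 := by
  classical
  have ht : Matrix.BlockTriangular (KM N) (bP (N := N)) := by
    intro μ ρ h
    apply KM_zero
    intro h1
    exact absurd (Xset_tri _ _ h1).1 (not_le.mpr h)
  rw [ht.det]
  apply Finset.prod_eq_one
  intro a _
  have : (KM N).toSquareBlock bP a = 1 := by
    ext ⟨μ, hμ⟩ ⟨ρ, hρ⟩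
    rw [Matrix.toSquareBlock_def]
    by_cases h : μ = ρ
    · subst h; simp [KM_one]
    · rw [Matrix.one_apply_ne (by simpa using h)]
      apply KM_zero
      intro h1
      exact h ((Xset_tri _ _ h1).2 (hμ.trans hρ.symm))
  rw [this, Matrix.det_one]

/-- cycle type as a partition of N -/
def pt (σ : Equiv.Perm (Fin N)) : Nat.Partition N where
  parts := σ.partition.parts
  parts_pos := fun h => σ.partition.parts_pos h
  parts_sum := by rw [σ.partition.parts_sum, Fintype.card_fin]

lemma pt_conj (f : Equiv.Perm (Fin N) → ℂ) (hf : ∀ g h, f (h * g * h⁻¹) = f g) (σ τ : Equiv.Perm (Fin N))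
    (h : pt σ = pt τ) : f σ = f τ := by
  have h1 : σ.partition = τ.partition := Nat.Partition.ext (by
    have := congrArg (fun p : Nat.Partition N => p.parts) h
    exact this)
  rw [← Equiv.Perm.partition_eq_of_isConj, isConj_iff] at h1
  obtain ⟨c, rfl⟩ := h1
  exact (hf σ c).symm

/-- Combination of permutation characters. -/
noncomputable def hcomb (a : Nat.Partition N → ℂ) : Equiv.Perm (Fin N) → ℂ := ∑ μ, a μ • pch (SC (cP μ))

lemma hcomb_conj (a : Nat.Partition N → ℂ) (g h : Equiv.Perm (Fin N)) : hcomb a (h * g * h⁻¹) = hcomb a g := by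
  simp [hcomb, pch_conj]

lemma cip_hcomb (a : Nat.Partition N → ℂ) (ρ : Nat.Partition N) :
    cip (hcomb a) (eP ρ) = Matrix.vecMul a ((KM N).map (fun z : ℤ => (z : ℂ))) ρ := by
  unfold hcomb
  rw [cip_sum_left]
  simp only [cip_smul_left, KM_eq, Matrix.vecMul, dotProduct, Matrix.map_apply]

/-- inverse, integral -/
noncomputable def KI (N : ℕ) : Matrix (Nat.Partition N) (Nat.Partition N) ℤ := by
  classical exact (KM N)⁻¹

lemma KM_KI (a : Nat.Partition N → ℂ) : Matrix.vecMul (Matrix.vecMul a ((KM N).map (fun z : ℤ => (z : ℂ))))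
    ((KI N).map (fun z : ℤ => (z : ℂ))) = a := by
  classical
  have h : KM N * KI N = 1 := Matrix.mul_nonsing_inv _ (by rw [KM_det]; exact isUnit_one)
  have h2 : ((KM N).map (fun z : ℤ => (z : ℂ))) * ((KI N).map (fun z : ℤ => (z : ℂ))) = 1 := by
    have := congrArg (fun M => (Int.castRingHom ℂ).mapMatrix M) h
    rw [map_mul, map_one] at this
    exact this
  rw [Matrix.vecMul_vecMul, h2, Matrix.vecMul_one]

theorem class_span (f : Equiv.Perm (Fin N) → ℂ) (hf : ∀ g h, f (h * g * h⁻¹) = f g) : ∃ a, f = hcomb a := by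
  classical
  let s : Nat.Partition N → Equiv.Perm (Fin N) := Function.invFun pt
  have hs : ∀ σ, pt (s (pt σ)) = pt σ := fun σ => Function.invFun_eq ⟨σ, rfl⟩
  have hall : ∀ f : Equiv.Perm (Fin N) → ℂ, (∀ g h, f (h * g * h⁻¹) = f g) → ∀ σ, f (s (pt σ)) = f σ :=
    fun f hf σ => pt_conj f hf _ _ (hs σ)
  let H : (Nat.Partition N → ℂ) →ₗ[ℂ] (Nat.Partition N → ℂ) :=
    { toFun := fun a μ => hcomb a (s μ)
      map_add' := fun a b => by
        funext μ; simp [hcomb, add_mul, Finset.sum_add_distrib]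
      map_smul' := fun r a => by
        funext μ; simp [hcomb, Finset.mul_sum, mul_assoc] }
  have hinj : Function.Injective H := by
    rw [injective_iff_map_eq_zero]
    intro a ha
    have h0 : hcomb a = 0 := by
      funext σ
      rw [← hall _ (hcomb_conj a) σ]
      exact congrFun ha (pt σ)
    have h1 : Matrix.vecMul a ((KM N).map (fun z : ℤ => (z : ℂ))) = 0 := by
      funext ρ
      rw [← cip_hcomb, h0]
      simp [cip]
    rw [← KM_KI a, h1, Matrix.zero_vecMul]
  obtain ⟨a, ha⟩ := (LinearMap.injective_iff_surjective.1 hinj) (fun μ => f (s μ))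
  refine ⟨a, ?_⟩
  funext σ
  rw [← hall f hf σ, ← hall _ (hcomb_conj a) σ]
  exact (congrFun ha (pt σ)).symm

theorem irr_int (f : Equiv.Perm (Fin N) → ℂ) (hf : IsIrrChar f) :
    ∃ n : Nat.Partition N → ℤ, f = hcomb (fun μ => (n μ : ℂ)) := by
  classical
  obtain ⟨a, ha⟩ := class_span f (fun g h => hf.conj g h)
  have hInteg : ∀ ρ : Nat.Partition N, ∃ k : ℤ, cip f (eP ρ) = k := by
    intro ρ
    have hconj := fun g h => hf.conj g h
    have h1 : cip f (eP ρ) = cip (fun σ => sgnf σ * f σ) (pch (SC (dP ρ))) := by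
      simp only [cip, eP]
      congr 1
      refine Finset.sum_congr rfl fun σ _ => ?_
      rw [star_mul', sgnf_star]; ring
    rw [h1, cip_pch _ _ (fun g h => by rw [sgnf_conj, hconj])]
    obtain ⟨V, _, _, _, _, π, _, _, rfl⟩ := hf
    let π' : Representation ℂ (Equiv.Perm (Fin N)) V :=
      { toFun := fun σ => sgnf σ • π σ
        map_one' := by simp [sgnf]
        map_mul' := fun σ τ => by
          rw [sgnf_mul, map_mul]
          ext v
          simp [mul_smul, smul_comm (sgnf σ)] }
    obtain ⟨k, hk, _⟩ := avg_nat π' (SC (dP ρ))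
    refine ⟨k, ?_⟩
    rw [avgS, Int.cast_natCast, ← hk]
    congr 1
    refine Finset.sum_congr rfl fun h _ => ?_
    change _ = LinearMap.trace ℂ V (sgnf (h : Equiv.Perm (Fin N)) • π h)
    rw [map_smul]; rfl
  choose m hm using hInteg
  refine ⟨Matrix.vecMul m (KI N), ?_⟩
  have h2 : Matrix.vecMul a ((KM N).map (fun z : ℤ => (z : ℂ))) = fun ρ => (m ρ : ℂ) := by
    funext ρ
    rw [← cip_hcomb, ← ha, hm]
  have h3 := KM_KI a
  rw [h2] at h3
  rw [ha, ← h3]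
  congr 1
  funext μ
  simp [Matrix.vecMul, dotProduct]
end M5b
end OV

open scoped ComplexOrder
open MeasureTheory
namespace OV
set_option linter.unusedSectionVars false
section M8
variable {F : Type} [Field F] [Fintype F] [DecidableEq F] {N : ℕ}

/-- combination of flag characters -/
noncomputable def gcomb (F : Type) [Field F] [Fintype F] [DecidableEq F] {N : ℕ} (a : Nat.Partition N → ℂ) :
    GLn F N → ℂ := ∑ μ, a μ • pch (PC F (cP μ))

/-- the correspondence between class functions on symmetric groups and unipotent class functions -/
def IsTh (f : Equiv.Perm (Fin N) → ℂ) (φ : GLn F N → ℂ) : Prop := ∃ a, f = hcomb a ∧ φ = gcomb F a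

lemma th_cip {f f' : Equiv.Perm (Fin N) → ℂ} {φ φ' : GLn F N → ℂ} (h : IsTh f φ) (h' : IsTh f' φ') :
    cip f f' = cip φ φ' := by
  obtain ⟨a, rfl, rfl⟩ := h
  obtain ⟨b, rfl, rfl⟩ := h'
  simp only [hcomb, gcomb, cip_sum_left, cip_sum_right, cip_smul_left, cip_smul_right]
  refine Finset.sum_congr rfl fun μ _ => ?_
  congr 1
  refine Finset.sum_congr rfl fun ρ _ => ?_
  rw [gram_eq (F := F) _ _ (cP_mono ρ) (cP_mono μ)]

lemma th_add {f f' : Equiv.Perm (Fin N) → ℂ} {φ φ' : GLn F N → ℂ} (h : IsTh f φ) (h' : IsTh f' φ') :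
    IsTh (f + f') (φ + φ') := by
  obtain ⟨a, rfl, rfl⟩ := h
  obtain ⟨b, rfl, rfl⟩ := h'
  exact ⟨a + b, by simp [hcomb, add_smul, Finset.sum_add_distrib], by simp [gcomb, add_smul, Finset.sum_add_distrib]⟩

lemma th_smul (r : ℂ) {f : Equiv.Perm (Fin N) → ℂ} {φ : GLn F N → ℂ} (h : IsTh f φ) :
    IsTh (r • f) (r • φ) := by
  obtain ⟨a, rfl, rfl⟩ := h
  exact ⟨r • a, by simp [hcomb, mul_smul, Finset.smul_sum], by simp [gcomb, mul_smul, Finset.smul_sum]⟩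

lemma th_zero : IsTh (0 : Equiv.Perm (Fin N) → ℂ) (0 : GLn F N → ℂ) := ⟨0, by simp [hcomb], by simp [gcomb]⟩

lemma th_sum {ι : Type*} (s : Finset ι) (f : ι → Equiv.Perm (Fin N) → ℂ) (φ : ι → GLn F N → ℂ)
    (h : ∀ i ∈ s, IsTh (f i) (φ i)) : IsTh (∑ i ∈ s, f i) (∑ i ∈ s, φ i) := by
  classical
  induction s using Finset.induction_on with
  | empty => simpa using th_zero
  | insert a s ha ih =>
    rw [Finset.sum_insert ha, Finset.sum_insert ha]
    exact th_add (h a (Finset.mem_insert_self _ _)) (ih fun i hi => h i (Finset.mem_insert_of_mem hi))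

lemma cip_sub_self_zero {G : Type} [Group G] [Fintype G] (u v : G → ℂ)
    (h1 : cip u v = cip u u) (h2 : cip v v = cip u u) : u = v := by
  have h3 : cip v u = cip u u := by rw [← cip_star, h1, cip_star]
  have : u + (-1 : ℂ) • v = 0 := by
    apply cip_self_eq_zero
    simp only [cip_add_left, cip_add_right, cip_smul_left, cip_smul_right, h1, h2, h3]
    simp
  rw [neg_one_smul, ← sub_eq_add_neg, sub_eq_zero] at this
  exact this

lemma th_pch (c : Fin N → ℕ) (hc : Monotone c) : IsTh (pch (SC c)) (pch (PC F c)) := by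
  obtain ⟨a, ha⟩ := class_span (pch (SC c)) (fun g h => pch_conj _ g h)
  refine ⟨a, ha, ?_⟩
  have h1 : cip (pch (PC F c)) (gcomb F a) = cip (pch (SC c)) (hcomb a) := by
    simp only [hcomb, gcomb, cip_sum_right, cip_smul_right]
    refine Finset.sum_congr rfl fun μ _ => ?_
    rw [gram_eq (F := F) _ _ hc (cP_mono μ)]
  have h2 : cip (gcomb F a) (gcomb F a) = cip (hcomb a) (hcomb a) := (th_cip ⟨a, rfl, rfl⟩ ⟨a, rfl, rfl⟩).symm
  apply cip_sub_self_zero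
  · rw [h1, ← ha, gram_eq (F := F) _ _ hc hc]
  · rw [h2, ← ha, gram_eq (F := F) _ _ hc hc]

lemma th_unique {f : Equiv.Perm (Fin N) → ℂ} {φ φ' : GLn F N → ℂ} (h : IsTh f φ) (h' : IsTh f φ') : φ = φ' :=
  cip_sub_self_zero _ _ (by rw [← th_cip h h', ← th_cip h h]) (by rw [← th_cip h' h', ← th_cip h h])

lemma th_conj {f : Equiv.Perm (Fin N) → ℂ} {φ : GLn F N → ℂ} (h : IsTh f φ) (g k : GLn F N) : φ (k * g * k⁻¹) = φ g := by
  obtain ⟨a, rfl, rfl⟩ := h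
  simp [gcomb, pch_conj]

lemma th_conjS {f : Equiv.Perm (Fin N) → ℂ} {φ : GLn F N → ℂ} (h : IsTh f φ) (g k : Equiv.Perm (Fin N)) :
    f (k * g * k⁻¹) = f g := by
  obtain ⟨a, rfl, rfl⟩ := h
  exact hcomb_conj a g k

/-- evaluation functional -/
noncomputable def theta (g : GLn F N) : (Equiv.Perm (Fin N) → ℂ) →ₗ[ℂ] ℂ where
  toFun f := gcomb F (Matrix.vecMul (fun ρ => cip f (eP ρ)) ((KI N).map (fun z : ℤ => (z : ℂ)))) g
  map_add' f f' := by
    have : (fun ρ : Nat.Partition N => cip (f + f') (eP ρ)) = (fun ρ => cip f (eP ρ)) + fun ρ => cip f' (eP ρ) := by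
      funext ρ; simp [cip_add_left]
    rw [this, Matrix.add_vecMul]
    simp [gcomb, add_mul, Finset.sum_add_distrib]
  map_smul' r f := by
    have : (fun ρ : Nat.Partition N => cip (r • f) (eP ρ)) = r • (fun ρ => cip f (eP ρ)) := by
      funext ρ; simp [cip_smul_left]
    rw [this, Matrix.smul_vecMul]
    simp [gcomb, mul_assoc, Finset.mul_sum]

lemma theta_eq {f : Equiv.Perm (Fin N) → ℂ} {φ : GLn F N → ℂ} (h : IsTh f φ) (g : GLn F N) : theta g f = φ g := by
  obtain ⟨a, rfl, rfl⟩ := h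
  change gcomb F _ g = _
  simp only [cip_hcomb]
  rw [KM_KI]

lemma theta_bound (g : GLn F N) : ∃ C : ℝ, 0 ≤ C ∧ ∀ f, ∀ B : ℝ, 0 ≤ B → (∀ σ, ‖f σ‖ ≤ B) → ‖theta g f‖ ≤ C * B := by
  refine ⟨‖LinearMap.toContinuousLinearMap (theta g)‖, norm_nonneg _, fun f B hB h => ?_⟩
  have h1 := (LinearMap.toContinuousLinearMap (theta g)).le_opNorm f
  refine h1.trans (mul_le_mul_of_nonneg_left ?_ (norm_nonneg _))
  exact (pi_norm_le_iff_of_nonneg hB).2 h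

lemma pch_triv : pch (SC (fun i : Fin N => (i : ℕ))) =
    fun g => open scoped Classical in if g = 1 then (Fintype.card (Equiv.Perm (Fin N)) : ℂ) else 0 := by
  classical
  have h : SC (fun i : Fin N => (i : ℕ)) = ⊥ := by
    rw [eq_bot_iff]
    intro σ hσ
    rw [Subgroup.mem_bot]
    exact Equiv.ext fun x => Fin.ext (hσ x)
  funext g
  unfold pch
  have hc : (Fintype.card (SC (fun i : Fin N => (i : ℕ))) : ℂ) = 1 := by
    rw [← Nat.card_eq_fintype_card, h]; simp
  rw [hc, h]
  by_cases hg : g = 1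
  · subst hg; simp
  · have : ∀ x : Equiv.Perm (Fin N), ¬ x⁻¹ * g * x = 1 := by
      intro x hx
      apply hg
      have h3 : g = x * (x⁻¹ * g * x) * x⁻¹ := by group
      rw [h3, hx]; simp
    simp only [Subgroup.mem_bot, this]
    simp [hg]

theorem unip_irr {d : ℕ} (ρ : Representation ℂ (GLn F N) (Fin d → ℂ)) (hρ : IsUnipotentIrrep F ρ) :
    ∃ f : Equiv.Perm (Fin N) → ℂ, IsIrrChar f ∧ IsTh f ρ.character := by
  classical
  obtain ⟨hirr, v, hv, hB⟩ := hρ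
  haveI : Nontrivial (Fin d → ℂ) := ⟨v, 0, hv⟩
  haveI := irr_of hirr
  have hψ := cip_irr_self ρ
  have hψc : ∀ g h, ρ.character (h * g * h⁻¹) = ρ.character g := fun g h => Representation.char_conj ρ g h
  have hid : Monotone (fun i : Fin N => (i : ℕ)) := fun _ _ h => h
  have hpair : ∃ k : ℕ, 0 < k ∧ cip ρ.character (pch (PC F (fun i : Fin N => (i : ℕ)))) = k := by
    rw [cip_pch _ _ hψc]
    obtain ⟨k, hk, hk2⟩ := avg_nat ρ (PC F (fun i : Fin N => (i : ℕ)))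
    exact ⟨k, hk2 ⟨v, hv, fun b hb => hB b hb⟩, hk⟩
  obtain ⟨k, hk0, hk⟩ := hpair
  obtain ⟨s, hs, hsum⟩ := regular_decomp (G := Equiv.Perm (Fin N))
  have hreg : pch (SC (fun i : Fin N => (i : ℕ))) = s.sum := by
    rw [pch_triv]; funext g; rw [hsum g]; congr
  have hth : ∀ f : Equiv.Perm (Fin N) → ℂ, IsIrrChar f → ∃ n : Nat.Partition N → ℤ,
    IsTh f (gcomb F (fun μ => (n μ : ℂ))) := by
    intro f hf
    obtain ⟨n, hn⟩ := irr_int f hf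
    exact ⟨n, _, hn, rfl⟩
  -- find a constituent
  have hex : ∃ f ∈ s, ∃ n : Nat.Partition N → ℤ,
    IsTh f (gcomb F (fun μ => (n μ : ℂ))) ∧ cip (gcomb F (fun μ => (n μ : ℂ))) ρ.character ≠ 0 := by
    by_contra hno
    push Not at hno
    have gen : ∀ t : Multiset (Equiv.Perm (Fin N) → ℂ), t ≤ s → ∃ Φ : GLn F N → ℂ, IsTh t.sum Φ ∧ cip Φ ρ.character = 0 := by
      intro t
      induction t using Multiset.induction_on with
      | empty => intro _; exact ⟨0, by simpa using th_zero, by simp [cip]⟩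
      | cons a t ih =>
        intro hle
        obtain ⟨Φ, h1, h2⟩ := ih ((Multiset.le_cons_self t a).trans hle)
        have ha : a ∈ s := Multiset.mem_of_le hle (Multiset.mem_cons_self a t)
        obtain ⟨n, hn⟩ := hth a (hs a ha)
        refine ⟨gcomb F (fun μ => (n μ : ℂ)) + Φ, ?_, ?_⟩
        · rw [Multiset.sum_cons]; exact th_add hn h1
        · rw [cip_add_left, hno a ha n hn, h2, add_zero]
    obtain ⟨Φ, h1, h2⟩ := gen s le_rfl
    rw [← hreg] at h1
    have h3 := th_unique (th_pch _ hid) h1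
    rw [← h3, ← cip_star, hk] at h2
    simp at h2
    omega
  obtain ⟨f, hf, n, hn, hne⟩ := hex
  set φ := gcomb F (fun μ => (n μ : ℂ)) with hφ
  have hfi := hs f hf
  have hInteg : ∃ m : ℤ, cip φ ρ.character = m := by
    have h1 : ∀ μ, ∃ j : ℕ, cip (pch (PC F (cP μ))) ρ.character = j := by
      intro μ
      obtain ⟨j, hj, _⟩ := avg_nat ρ (PC F (cP μ))
      refine ⟨j, ?_⟩
      rw [← cip_star, cip_pch _ _ hψc]
      unfold avgS
      rw [hj]; simp
    choose j hj using h1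
    refine ⟨∑ μ, n μ * j μ, ?_⟩
    rw [hφ, gcomb, cip_sum_left]
    simp [cip_smul_left, hj]
  obtain ⟨m, hm⟩ := hInteg
  have hm0 : m ≠ 0 := by rintro rfl; apply hne; rw [hm]; simp
  have h11 : cip φ φ = 1 := by rw [← th_cip hn hn]; exact hfi.norm_one
  have heq := cip_int_eq φ ρ.character h11 hψ m hm hm0
  -- sign
  have hfid : cip φ (pch (PC F (fun i : Fin N => (i : ℕ)))) = f 1 := by
    rw [← th_cip hn (th_pch _ hid), pch_triv]
    simp only [cip]
    rw [Finset.sum_eq_single 1]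
    · simp
      field_simp
    · intro g _ hg; simp [hg]
    · simp
  obtain ⟨r, hr0, hr⟩ := hfi.one_pos
  rw [heq, cip_smul_left, hk, hr] at hfid
  have hZ : m * k = r := by exact_mod_cast hfid
  have hmpos : 0 < m := by
    by_contra h
    have : m * k ≤ 0 := mul_nonpos_of_nonpos_of_nonneg (by omega) (by omega)
    omega
  have hm2 : m * m = 1 := by
    have := h11
    rw [heq, cip_smul_left, cip_smul_right, hψ] at this
    simp at this
    exact_mod_cast this
  have hm1 : m = 1 := by nlinarith
  refine ⟨f, hfi, ?_⟩
  rw [hm1] at heq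
  simp at heq
  rw [← heq]; exact hn

/-- positive decomposition -/
theorem pos_decomp (φ : GLn F N → ℂ) (k : ℕ) (c : Fin k → ℂ) (d : Fin k → ℕ)
    (ρ : (i : Fin k) → Representation ℂ (GLn F N) (Fin (d i) → ℂ)) (hρ : ∀ i, IsUnipotentIrrep F (ρ i))
    (hφ : φ = ∑ i, c i • (ρ i).character)
    (hpos : ∀ x : GLn F N → ℂ, 0 ≤ ∑ g, ∑ h, star (x g) * x h * φ (g⁻¹ * h)) :
    ∃ (T : Finset (GLn F N → ℂ)) (w : (GLn F N → ℂ) → ℂ) (f : (GLn F N → ℂ) → Equiv.Perm (Fin N) → ℂ),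
      (∀ ψ ∈ T, 0 ≤ w ψ ∧ IsIrrChar (f ψ)) ∧ IsTh (∑ ψ ∈ T, w ψ • f ψ) φ := by
  classical
  have hnt : ∀ i, (ρ i).IsIrreducible := by
    intro i
    obtain ⟨hirr, v, hv, hB⟩ := hρ i
    haveI : Nontrivial (Fin (d i) → ℂ) := ⟨v, 0, hv⟩
    exact irr_of hirr
  set T : Finset (GLn F N → ℂ) := Finset.univ.image (fun i => (ρ i).character) with hT
  set w : (GLn F N → ℂ) → ℂ := fun ψ => ∑ i ∈ Finset.univ.filter (fun i => (ρ i).character = ψ), c i with hw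
  have hmem : ∀ ψ ∈ T, ∃ i, (ρ i).character = ψ := by
    intro ψ h; simpa [hT] using h
  have hsum : φ = ∑ ψ ∈ T, w ψ • ψ := by
    rw [hφ, ← Finset.sum_fiberwise_of_maps_to (s := Finset.univ) (t := T) (g := fun i => (ρ i).character)
      (fun i _ => Finset.mem_image_of_mem _ (Finset.mem_univ i))]
    refine Finset.sum_congr rfl fun ψ _ => ?_
    rw [hw, Finset.sum_smul]
    refine Finset.sum_congr rfl fun i hi => ?_
    rw [(Finset.mem_filter.1 hi).2]
  have hex : ∀ ψ, ∃ f : Equiv.Perm (Fin N) → ℂ, ψ ∈ T → IsIrrChar f ∧ IsTh f ψ := by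
    intro ψ
    by_cases h : ψ ∈ T
    · obtain ⟨i, rfl⟩ := hmem ψ h
      obtain ⟨f, hf⟩ := unip_irr (ρ i) (hρ i)
      exact ⟨f, fun _ => hf⟩
    · exact ⟨0, fun h' => absurd h' h⟩
  choose f hf using hex
  refine ⟨T, w, f, fun ψ hψ => ⟨?_, (hf ψ hψ).1⟩, ?_⟩
  · obtain ⟨i, rfl⟩ := hmem ψ hψ
    have h1 := cip_posdef φ hpos (ρ i)
    have h2 : cip φ (ρ i).character = w (ρ i).character := by
      rw [hsum, cip_sum_left, Finset.sum_eq_single (ρ i).character]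
      · rw [cip_smul_left]
        haveI := hnt i
        rw [cip_irr_self, mul_one]
      · intro ψ' h' hne
        obtain ⟨j, rfl⟩ := hmem ψ' h'
        haveI := hnt i
        haveI := hnt j
        rw [cip_smul_left]
        rcases cip_irr (ρ j) (ρ i) with h | h
        · rw [h, mul_zero]
        · exact absurd h.1 hne
      · intro h; exact absurd hψ h
    rwa [h2] at h1
  · rw [hsum]
    exact th_sum T _ _ (fun ψ hψ => th_smul _ (hf ψ hψ).2)

lemma embS_mul {n : ℕ} (σ τ : Equiv.Perm (Fin n)) : embS n (σ * τ) = embS n σ * embS n τ := by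
  apply Equiv.ext
  intro x
  refine Fin.lastCases ?_ (fun x => ?_) x
  · simp [embS_last]
  · simp [embS_cast]

lemma embS_inv {n : ℕ} (σ : Equiv.Perm (Fin n)) : embS n σ⁻¹ = (embS n σ)⁻¹ := by
  rw [eq_inv_iff_mul_eq_one, ← embS_mul, inv_mul_cancel]
  apply Equiv.ext
  intro x
  refine Fin.lastCases ?_ (fun x => ?_) x
  · simp [embS_last]
  · simp [embS_cast]

lemma hcomb_ext (f f' : Equiv.Perm (Fin N) → ℂ) (hf : ∀ g h, f (h * g * h⁻¹) = f g)
    (hf' : ∀ g h, f' (h * g * h⁻¹) = f' g) (h : ∀ μ : Nat.Partition N, cip f (pch (SC (cP μ))) = cip f' (pch (SC (cP μ)))) :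
    f = f' := by
  obtain ⟨a, ha⟩ := class_span f hf
  obtain ⟨b, hb⟩ := class_span f' hf'
  have key : ∀ e : Nat.Partition N → ℂ, cip f (hcomb e) = cip f' (hcomb e) := by
    intro e
    simp only [hcomb, cip_sum_right, cip_smul_right, h]
  have ka := key a
  have kb := key b
  rw [← ha] at ka
  rw [← hb] at kb
  have : cip f f' = cip f f := by rw [← cip_star, ← ka, cip_self_star]
  exact cip_sub_self_zero _ _ this (by rw [← kb, this])
where
  cip_self_star : star (cip f f) = cip f f := cip_star f f

theorem th_restrict {n : ℕ} {f : Equiv.Perm (Fin n) → ℂ} {φ : GLn F n → ℂ} {f' : Equiv.Perm (Fin (n + 1)) → ℂ}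
    {φ' : GLn F (n + 1) → ℂ} (h : IsTh f φ) (h' : IsTh f' φ')
    (hext : ∀ g, φ g = (((Fintype.card F : ℂ) - 1) * (Fintype.card F : ℂ) ^ n)⁻¹ * ∑ h ∈ ExtSet F g, φ' h) :
    f = fun σ => f' (embS n σ) := by
  have hc' : ∀ g h, (fun σ => f' (embS n σ)) (h * g * h⁻¹) = (fun σ => f' (embS n σ)) g := by
    intro g k
    simp only [embS_mul, embS_inv]
    exact th_conjS h' _ _
  apply hcomb_ext _ _ (th_conjS h) hc'
  intro μ
  set K := (pl μ).length
  have hK := cP_lt μ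
  have hmono := snoc_mono (cP μ) (cP_mono μ) K hK
  rw [th_cip h (th_pch (F := F) _ (cP_mono μ)), cip_pch _ _ (th_conj h), avg_PC_snoc (cP μ) K hK φ φ' hext,
    ← cip_pch _ _ (th_conj h'), ← th_cip h' (th_pch (F := F) _ hmono), cip_pch _ _ (th_conjS h'),
    ← avg_SC_snoc (cP μ) K hK, cip_pch _ _ hc']
end M8
end OV

open scoped ComplexOrder
open MeasureTheory
namespace OV
set_option linter.unusedSectionVars false
section M9a
open scoped Classical
variable {Λ : Type} [PartialOrder Λ] [BoundedOrder Λ] [Fintype Λ] (r : Λ → ℕ) (p : Λ → Prop)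

/-- rank-graded summation operator -/
noncomputable def Hop (a : ℕ) : ({y // p y} → ℂ) →ₗ[ℂ] ({y // p y} → ℂ) where
  toFun u x := ∑ y : {y // p y}, if x.1 ≤ y.1 ∧ r y.1 = r x.1 + a then u y else 0
  map_add' u v := by
    funext x
    simp only [Pi.add_apply]
    rw [← Finset.sum_add_distrib]
    exact Finset.sum_congr rfl fun y _ => by split_ifs <;> simp
  map_smul' c u := by
    funext x
    simp only [Pi.smul_apply, smul_eq_mul, RingHom.id_apply]
    rw [Finset.mul_sum]
    exact Finset.sum_congr rfl fun y _ => by split_ifs <;> simp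

lemma Hop_apply (a : ℕ) (u : {y // p y} → ℂ) (x : {y // p y}) :
    Hop r p a u x = ∑ y : {y // p y}, if x.1 ≤ y.1 ∧ r y.1 = r x.1 + a then u y else 0 := rfl

/-- delta at the top -/
noncomputable def dtop : {y // p y} → ℂ := fun x => if x.1 = ⊤ then 1 else 0

/-- iterated operators on delta -/
noncomputable def Hl : List ℕ → ({y // p y} → ℂ)
  | [] => dtop p
  | a :: l => Hop r p a (Hl l)

/-- weighted chain sums -/
noncomputable def Nw : List ℕ → {y // p y} → (List {y // p y} → ℂ) → ℂ
  | [], x, φ => if x.1 = ⊤ then φ [] else 0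
  | a :: l, x, φ => ∑ y : {y // p y}, if x.1 ≤ y.1 ∧ r y.1 = r x.1 + a then Nw l y (fun t => φ (y :: t)) else 0

/-- chains with prescribed rank increments -/
def isch : List ℕ → Λ → List Λ → Prop
  | [], x, [] => x = ⊤
  | a :: l, x, y :: t => x ≤ y ∧ r y = r x + a ∧ isch l y t
  | _, _, _ => False

lemma Nw_const (l : List ℕ) : ∀ (x : {y // p y}) (c : ℂ), Nw r p l x (fun _ => c) = c * Hl r p l x := by
  induction l with
  | nil => intro x c; simp [Nw, Hl, dtop]
  | cons a l ih =>
    intro x c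
    simp only [Nw, Hl, ih, Hop_apply, Finset.mul_sum]
    exact Finset.sum_congr rfl fun y _ => by split_ifs <;> simp

lemma Nw_sum {ι : Type} (s : Finset ι) (l : List ℕ) : ∀ (x : {y // p y}) (φ : ι → List {y // p y} → ℂ),
    Nw r p l x (fun t => ∑ i ∈ s, φ i t) = ∑ i ∈ s, Nw r p l x (φ i) := by
  induction l with
  | nil => intro x φ; simp only [Nw]; split_ifs <;> simp
  | cons a l ih =>
    intro x φ
    simp only [Nw]
    rw [Finset.sum_comm]
    refine Finset.sum_congr rfl fun y _ => ?_
    split_ifs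
    · exact ih y (fun i t => φ i (y :: t))
    · simp

lemma Nw_congr (l : List ℕ) : ∀ (x : {y // p y}) (φ ψ : List {y // p y} → ℂ),
    (∀ t, isch r l x.1 (t.map Subtype.val) → φ t = ψ t) → Nw r p l x φ = Nw r p l x ψ := by
  induction l with
  | nil =>
    intro x φ ψ h
    simp only [Nw]
    split_ifs with h1
    · exact h [] h1
    · rfl
  | cons a l ih =>
    intro x φ ψ h
    simp only [Nw]
    refine Finset.sum_congr rfl fun y _ => ?_
    split_ifs with h1
    · exact ih y _ _ fun t ht => h (y :: t) ⟨h1.1, h1.2, ht⟩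
    · rfl

lemma Nw_ind (l : List ℕ) : ∀ (x : {y // p y}) (t : List Λ),
    Nw r p l x (fun s => if s.map Subtype.val = t then 1 else 0) =
      if isch r l x.1 t ∧ ∀ y ∈ t, p y then 1 else 0 := by
  induction l with
  | nil =>
    intro x t
    cases t with
    | nil => simp [Nw, isch]
    | cons b t => simp [Nw, isch]
  | cons a l ih =>
    intro x t
    cases t with
    | nil => simp only [Nw, isch]; simp [Nw_const]
    | cons b t =>
      simp only [Nw, List.map_cons, List.cons.injEq]
      by_cases hb : p b
      · rw [Finset.sum_eq_single ⟨b, hb⟩]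
        · simp only [true_and, ih, isch]
          split_ifs <;> simp_all
        · intro y _ hy
          have : ¬ y.1 = b := fun h => hy (Subtype.ext h)
          simp only [this, false_and, if_false]
          rw [Nw_const]; simp
        · simp
      · rw [Finset.sum_eq_zero, if_neg]
        · rintro ⟨_, h⟩; exact hb (h b (by simp))
        · intro y _
          have : ¬ y.1 = b := fun h => hb (h ▸ y.2)
          simp only [this, false_and, if_false]
          rw [Nw_const]; simp

lemma isch_sum (hr : True) (l : List ℕ) : ∀ (x : Λ) (t : List Λ), isch r l x t → r x + l.sum = r (⊤ : Λ) := by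
  induction l with
  | nil =>
    intro x t h
    cases t with
    | nil => simp [isch] at h; simp [h]
    | cons b t => simp [isch] at h
  | cons a l ih =>
    intro x t h
    cases t with
    | nil => simp [isch] at h
    | cons b t =>
      simp only [isch] at h
      have := ih b t h.2.2
      rw [← this, h.2.1]; simp; omega

lemma Hl_zero (l : List ℕ) (x : {y // p y}) (h : r x.1 + l.sum ≠ r (⊤ : Λ)) : Hl r p l x = 0 := by
  have h1 := Nw_const r p l x 1
  rw [one_mul] at h1
  rw [← h1, Nw_congr r p l x (fun _ => 1) (fun _ => 0), Nw_const, zero_mul]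
  intro t ht
  exact absurd (isch_sum r trivial l _ _ ht) h

variable {G : Type} [Group G] [Fintype G] (act : G → Λ → Λ) (V : ℕ → Λ)

/-- base chain -/
def bch : ℕ → List ℕ → List Λ
  | _, [] => []
  | s, a :: l => V (s + a) :: bch (s + a) l

lemma mem_bch (l : List ℕ) : ∀ (s : ℕ) (y : Λ), y ∈ bch V s l ↔ ∃ i, i < l.length ∧ y = V (s + (l.take (i + 1)).sum) := by
  induction l with
  | nil => intro s y; simp [bch]
  | cons a l ih =>
    intro s y
    simp only [bch, List.mem_cons, ih]
    constructor
    · rintro (h | ⟨i, hi, h⟩)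
      · exact ⟨0, by simp, by simpa using h⟩
      · exact ⟨i + 1, by simpa using hi, by rw [h]; simp [add_assoc]⟩
    · rintro ⟨i, hi, h⟩
      cases i with
      | zero => left; simpa using h
      | succ i => right; exact ⟨i, by simpa using hi, by rw [h]; simp [add_assoc]⟩

lemma chain_base (n : ℕ) (hV : ∀ s s', s ≤ s' → V s ≤ V s') (hrV : ∀ s, s ≤ n → r (V s) = s) (hn : V n = ⊤)
    (hact : ∀ h x y, x ≤ y → act h x ≤ act h y) (hrank : ∀ h x, r (act h x) = r x) (htop : ∀ h, act h ⊤ = ⊤) (h : G)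
    (l : List ℕ) : ∀ s, s + l.sum = n → isch r l (act h (V s)) ((bch V s l).map (act h)) := by
  induction l with
  | nil => intro s hs; simp at hs; subst hs; simp [bch, isch, hn, htop]
  | cons a l ih =>
    intro s hs
    simp at hs
    simp only [bch, List.map_cons, isch, hrank]
    refine ⟨hact _ _ _ (hV _ _ (by omega)), ?_, ih _ (by omega)⟩
    rw [hrV _ (by omega), hrV _ (by omega)]

lemma chain_trans (n : ℕ) (l : List ℕ) : ∀ (t : List Λ) (x : Λ) (s : ℕ), r x = s → s + l.sum = n → isch r l x t →
    ∃ D : ℕ → Λ, (∀ j, s ≤ j → j < n → j < r (D j)) ∧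
      ∀ h : G, (∀ z s', s ≤ s' → s' ≤ n → (∀ j, s ≤ j → j < s' → D j ≤ z) → x ≤ z → r z = s' → act h (V s') = z) →
        (bch V s l).map (act h) = t := by
  induction l with
  | nil =>
    intro t x s hx hs ht
    refine ⟨fun _ => x, fun j h1 h2 => by simp at hs; omega, fun h _ => ?_⟩
    cases t with
    | nil => simp [bch]
    | cons b t => simp [isch] at ht
  | cons a l ih =>
    intro t x s hx hs ht
    cases t with
    | nil => simp [isch] at ht
    | cons y t =>
      simp only [isch] at ht
      obtain ⟨h1, h2, h3⟩ := ht
      simp only [List.sum_cons] at hs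
      obtain ⟨D, hD1, hD2⟩ := ih t y (s + a) (by omega) (by omega) h3
      refine ⟨fun j => if j < s + a then y else D j, fun j hj1 hj2 => ?_, fun h hh => ?_⟩
      · dsimp only
        split_ifs with hc
        · omega
        · exact hD1 j (by omega) hj2
      · simp only [bch, List.map_cons]
        rw [hD2 h, hh y (s + a) (by omega) (by omega) (fun j _ hj => by simp [hj]) h1 (by omega)]
        intro z s' hs1 hs2 hz hyz hrz
        refine hh z s' (by omega) hs2 (fun j hj1 hj2 => ?_) (h1.trans hyz) hrz
        dsimp only
        split_ifs with hc
        · exact hyz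
        · exact hz j (by omega) hj2

theorem fixed_chain (n : ℕ) (hV : ∀ s s', s ≤ s' → V s ≤ V s') (hrV : ∀ s, s ≤ n → r (V s) = s) (hn : V n = ⊤)
    (hV0 : V 0 = ⊥)
    (hact : ∀ h x y, x ≤ y → act h x ≤ act h y) (hrank : ∀ h x, r (act h x) = r x)
    (htop : ∀ h, act h ⊤ = ⊤) (hbot : ∀ h, act h ⊥ = ⊥)
    (hone : ∀ x, act 1 x = x) (hmul : ∀ g h x, act (g * h) x = act g (act h x))
    (htr : ∀ D : ℕ → Λ, (∀ j < n, j < r (D j)) → ∃ h : G, ∀ z s', s' ≤ n → (∀ j < s', D j ≤ z) → r z = s' →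
      act h (V s') = z)
    (l : List ℕ) (hl : l.sum = n) (P : Subgroup G) (hP : ∀ h, h ∈ P ↔ ∀ y ∈ bch V 0 l, act h y = y)
    (g : G) (hb : act g ⊥ = ⊥) :
    Hl r (fun y => act g y = y) l ⟨⊥, hb⟩ = pch P g := by
  set p : Λ → Prop := fun y => act g y = y with hp
  have key : Nw r p l ⟨⊥, hb⟩ (fun s => ∑ h : G, if s.map Subtype.val = (bch V 0 l).map (act h) then (1 : ℂ) else 0) =
      ((Finset.univ.filter (fun h : G => h⁻¹ * g * h ∈ P)).card : ℂ) := by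
    rw [Nw_sum, Finset.card_filter]
    push_cast
    refine Finset.sum_congr rfl fun h _ => ?_
    rw [Nw_ind]
    have h1 := chain_base r act V n hV hrV hn hact hrank htop h l 0 (by omega)
    rw [hV0, hbot] at h1
    have h2 : (∀ y ∈ (bch V 0 l).map (act h), p y) ↔ h⁻¹ * g * h ∈ P := by
      rw [hP]
      simp only [List.mem_map, forall_exists_index, and_imp, forall_apply_eq_imp_iff₂, hp]
      refine forall₂_congr fun y _ => ?_
      rw [hmul, hmul]
      constructor
      · intro e; rw [e, ← hmul, inv_mul_cancel, hone]
      · intro e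
        have := congrArg (act h) e
        rwa [← hmul, mul_inv_cancel, hone] at this
    simp only [h1, h2, true_and]
  have hc : Nw r p l ⟨⊥, hb⟩ (fun s => ∑ h : G, if s.map Subtype.val = (bch V 0 l).map (act h) then (1 : ℂ) else 0) =
      Nw r p l ⟨⊥, hb⟩ (fun _ => (Fintype.card P : ℂ)) := by
    apply Nw_congr
    intro t ht
    have hr0 : r (⊥ : Λ) = 0 := by rw [← hV0]; exact hrV 0 (by omega)
    obtain ⟨D, hD1, hD2⟩ := chain_trans r act V n l _ _ 0 hr0 (by omega) ht
    obtain ⟨h0, hh0⟩ := htr D (fun j hj => hD1 j (by omega) hj)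
    have e0 := hD2 h0 (fun z s' _ h2 h3 _ h5 => hh0 z s' h2 (fun j hj => h3 j (by omega) hj) h5)
    rw [← e0]
    rw [← Finset.sum_filter, Finset.sum_const, nsmul_eq_mul, mul_one]
    congr 1
    rw [← Finset.card_univ]
    symm
    refine Finset.card_bij (fun (q : P) _ => h0 * (q : G)) ?_ ?_ ?_
    · intro q _
      simp only [Finset.mem_filter, Finset.mem_univ, true_and, List.map_inj_left]
      intro y hy
      rw [hmul, (hP q).1 q.2 y hy]
    · intro a _ b _ h
      exact Subtype.ext (mul_left_cancel h)
    · intro h hh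
      simp only [Finset.mem_filter, Finset.mem_univ, true_and, List.map_inj_left] at hh
      refine ⟨⟨h0⁻¹ * h, ?_⟩, Finset.mem_univ _, by simp⟩
      rw [hP]
      intro y hy
      rw [hmul, ← hh y hy, ← hmul, inv_mul_cancel, hone]
  rw [hc, Nw_const] at key
  have hne : (Fintype.card P : ℂ) ≠ 0 := by simp
  rw [pch, ← key, inv_mul_cancel_left₀ hne]
end M9a
end OV

open scoped ComplexOrder
open MeasureTheory
namespace OV
set_option linter.unusedSectionVars false
section M9b
open Module
variable {F : Type} [Field F] [Fintype F] [DecidableEq F] {n : ℕ}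

/-- action on subsets -/
def actS (σ : Equiv.Perm (Fin n)) (S : Finset (Fin n)) : Finset (Fin n) := S.map σ.toEmbedding

lemma mem_actS (σ : Equiv.Perm (Fin n)) (S : Finset (Fin n)) (x : Fin n) : σ x ∈ actS σ S ↔ x ∈ S := by
  simp [actS]

/-- standard subsets -/
def VS (n : ℕ) (s : ℕ) : Finset (Fin n) := Finset.univ.filter (fun x => (x : ℕ) < s)

lemma card_VS (s : ℕ) (hs : s ≤ n) : (VS n s).card = s := by
  have h : VS n s = (Finset.univ : Finset (Fin s)).map (Fin.castLEEmb hs) := by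
    ext x
    simp only [VS, Finset.mem_filter, Finset.mem_univ, true_and, Finset.mem_map]
    constructor
    · intro h; exact ⟨⟨x, h⟩, rfl⟩
    · rintro ⟨y, rfl⟩; exact y.2
  rw [h]; simp

theorem fixS (l : List ℕ) (hl : l.sum = n) (σ : Equiv.Perm (Fin n)) (hb : actS σ ⊥ = ⊥) :
    Hl Finset.card (fun y => actS σ y = y) l ⟨⊥, hb⟩ = pch (SC (fun x : Fin n => blk l x)) σ := by
  refine fixed_chain Finset.card actS (VS n) n ?_ card_VS ?_ ?_ ?_ ?_ ?_ ?_ ?_ ?_ ?_ l hl _ ?_ σ hb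
  · intro s s' h x; simp only [VS, Finset.mem_filter, Finset.mem_univ, true_and]; omega
  · ext x; simp [VS]
  · ext x; simp [VS]
  · intro h x y hxy; exact Finset.map_subset_map.2 hxy
  · intro h x; exact Finset.card_map _
  · intro h; ext x; simp [actS]
  · intro h; ext x; simp [actS]
  · intro x; ext y; simp [actS]; rfl
  · intro g h x; ext y
    simp [actS]; rfl
  · intro D hD
    obtain ⟨v, hv1, hv2⟩ := (Finset.all_card_le_biUnion_card_iff_exists_injective (fun j : Fin n => D j)).1 (by
      intro s
      rcases s.eq_empty_or_nonempty with rfl | hs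
      · simp
      · have h1 : s.card ≤ (s.max' hs : ℕ) + 1 := by
          have : s ⊆ VS n ((s.max' hs : ℕ) + 1) := by
            intro x hx
            simp only [VS, Finset.mem_filter, Finset.mem_univ, true_and]
            have := Fin.le_def.1 (s.le_max' x hx)
            omega
          have h2 := Finset.card_le_card this
          rwa [card_VS _ (by omega)] at h2
        have h3 := hD (s.max' hs) (Fin.is_lt _)
        refine h1.trans (le_trans h3 (Finset.card_le_card ?_))
        exact Finset.subset_biUnion_of_mem (fun j : Fin n => D j) (s.max'_mem hs))
    refine ⟨Equiv.ofBijective v (Finite.injective_iff_bijective.1 hv1), fun z s' hs' hz hr => ?_⟩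
    apply Finset.eq_of_subset_of_card_le
    · intro x hx
      simp only [actS, Finset.mem_map] at hx
      obtain ⟨y, hy, rfl⟩ := hx
      exact hz y (by simpa [VS] using hy) (hv2 y)
    · rw [hr, actS, Finset.card_map, card_VS _ hs']
  · intro h
    rw [mem_SC]
    simp only [mem_bch, zero_add]
    constructor
    · rintro hh y ⟨i, hi, rfl⟩
      apply Finset.eq_of_subset_of_card_le
      · intro x hx
        simp only [actS, Finset.mem_map] at hx
        obtain ⟨y, hy, rfl⟩ := hx
        simp only [VS, Finset.mem_filter, Finset.mem_univ, true_and] at hy ⊢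
        rw [← blk_lt_iff l _ _ (by omega)] at hy ⊢
        simpa [hh] using hy
      · simp [actS]
    · intro hh
      have key : ∀ x : Fin n, ∀ i, i < l.length → (blk l (h x) < i + 1 ↔ blk l x < i + 1) := by
        intro x i hi
        have := hh _ ⟨i, hi, rfl⟩
        rw [blk_lt_iff l _ _ (by omega), blk_lt_iff l _ _ (by omega)]
        have h2 := mem_actS h (VS n ((l.take (i+1)).sum)) x
        rw [this] at h2
        simpa [VS] using h2
      intro x
      have h1 := key x (blk l x) (blk_lt_len l (by omega))
      have h2 := key x (blk l (h x)) (blk_lt_len l (by omega))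
      omega

/-- action on subspaces -/
def actG (g : GLn F n) (U : Submodule F (Fin n → F)) : Submodule F (Fin n → F) := U.map (Matrix.mulVecLin g.1)

noncomputable instance : Fintype (Submodule F (Fin n → F)) := Fintype.ofFinite _

/-- standard subspaces -/
def VG (F : Type) [Field F] (n : ℕ) (s : ℕ) : Submodule F (Fin n → F) where
  carrier := csp F (fun x => (x : ℕ) < s)
  add_mem' := by
    intro a b ha hb x hx
    by_contra h
    exact hx (by
      have h1 : a x = 0 := by by_contra h1; exact h (ha x h1)
      have h2 : b x = 0 := by by_contra h1; exact h (hb x h1)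
      simp [h1, h2])
  zero_mem' := by intro x hx; simp at hx
  smul_mem' := by
    intro c a ha x hx
    exact ha x (by intro h; simp [h] at hx)

lemma mem_VG (s : ℕ) (v : Fin n → F) : v ∈ VG F n s ↔ ∀ x, v x ≠ 0 → (x : ℕ) < s := Iff.rfl

lemma card_VG (s : ℕ) (hs : s ≤ n) : finrank F (VG F n s) = s := by
  have h1 : Nat.card (VG F n s) = Fintype.card F ^ s := by
    have := card_csp (F := F) (fun x : Fin n => (x : ℕ) < s)
    have h2 := card_VS s hs
    unfold VS at h2
    rw [h2] at this
    exact this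
  have h2 := Module.natCard_eq_pow_finrank (K := F) (V := VG F n s)
  rw [h1, Nat.card_eq_fintype_card] at h2
  exact (Nat.pow_right_injective (Fintype.one_lt_card (α := F)) h2).symm

lemma actG_one (x : Submodule F (Fin n → F)) : actG 1 x = x := by
  simp [actG]

lemma actG_mul (g h : GLn F n) (x : Submodule F (Fin n → F)) : actG (g * h) x = actG g (actG h x) := by
  simp only [actG, Units.val_mul, Matrix.mulVecLin_mul, Submodule.map_comp]

lemma actG_rank (h : GLn F n) (x : Submodule F (Fin n → F)) : finrank F (actG h x) = finrank F x := by
  apply le_antisymm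
  · exact Submodule.finrank_map_le _ _
  · have : x = actG h⁻¹ (actG h x) := by rw [← actG_mul, inv_mul_cancel, actG_one]
    conv_lhs => rw [this]
    exact Submodule.finrank_map_le _ _

lemma actG_mono (h : GLn F n) (x y : Submodule F (Fin n → F)) (hxy : x ≤ y) : actG h x ≤ actG h y :=
  Submodule.map_mono hxy

lemma actG_top (h : GLn F n) : actG h ⊤ = (⊤ : Submodule F (Fin n → F)) := by
  apply Submodule.eq_of_le_of_finrank_eq le_top
  rw [actG_rank]

lemma exists_indep (D : ℕ → Submodule F (Fin n → F)) (hD : ∀ j < n, j < finrank F (D j)) :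
    ∀ m, m ≤ n → ∃ v : Fin m → (Fin n → F), LinearIndependent F v ∧ ∀ j : Fin m, v j ∈ D j := by
  intro m
  induction m with
  | zero => intro _; exact ⟨Fin.elim0, linearIndependent_empty_type, fun j => j.elim0⟩
  | succ m ih =>
    intro hm
    obtain ⟨v, hv1, hv2⟩ := ih (by omega)
    have h1 := finrank_span_eq_card hv1
    have : ∃ x ∈ D m, x ∉ Submodule.span F (Set.range v) := by
      by_contra hc
      push Not at hc
      have := Submodule.finrank_mono (show D m ≤ _ from hc)
      rw [h1, Fintype.card_fin] at this
      have := hD m (by omega)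
      omega
    obtain ⟨x, hx1, hx2⟩ := this
    refine ⟨Fin.snoc v x, hv1.finSnoc hx2, fun j => ?_⟩
    refine Fin.lastCases ?_ (fun j => ?_) j
    · simpa using hx1
    · simpa using hv2 j

theorem fixG (l : List ℕ) (hl : l.sum = n) (g : GLn F n) (hb : actG g ⊥ = ⊥) :
    Hl (fun U : Submodule F (Fin n → F) => finrank F U) (fun y => actG g y = y) l ⟨⊥, hb⟩ =
      pch (PC F (fun x : Fin n => blk l x)) g := by
  refine fixed_chain (fun U : Submodule F (Fin n → F) => finrank F U) actG (VG F n) n ?_ card_VG ?_ ?_ actG_mono actG_rank actG_top ?_ actG_one actG_mul ?_ l hl _ ?_ g hb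
  · intro s s' h x; simp only [mem_VG]; intro hh x hx; have := hh x hx; omega
  · ext x; simp [mem_VG]
  · ext x; simp [mem_VG, funext_iff]
  · intro h; simp [actG]
  · intro D hD
    obtain ⟨v, hv1, hv2⟩ := exists_indep D hD n le_rfl
    have hu : IsUnit (Matrix.of fun i j => v j i) := by
      rw [← Matrix.linearIndependent_cols_iff_isUnit]
      exact hv1
    obtain ⟨h, hh⟩ := hu
    refine ⟨h, fun z s' hs' hz hr => ?_⟩
    apply Submodule.eq_of_le_of_finrank_eq
    · rintro _ ⟨x, hx, rfl⟩
      have h1 : Matrix.mulVecLin h.1 x = ∑ j, x j • v j := by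
        rw [hh]; ext i
        simp [Matrix.mulVec, dotProduct, mul_comm]
      rw [h1]
      refine Submodule.sum_mem _ fun j _ => ?_
      by_cases hj : x j = 0
      · simp [hj]
      · exact Submodule.smul_mem _ _ (hz j (hx j hj) (hv2 j))
    · rw [actG_rank, card_VG _ hs', hr]
  · intro h
    simp only [mem_bch, zero_add]
    constructor
    · rintro hh y ⟨i, hi, rfl⟩
      apply Submodule.eq_of_le_of_finrank_eq
      · rintro _ ⟨x, hx, rfl⟩
        have := PC_csp _ h hh (i + 1) x (by
          intro y hy
          exact (blk_lt_iff l _ _ (by omega)).2 (hx y hy))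
        intro y hy
        exact (blk_lt_iff l _ _ (by omega)).1 (this y hy)
      · exact actG_rank _ _
    · intro hh
      rw [mem_PC]
      intro i j hij
      by_contra hne
      have hj : blk l j < l.length := blk_lt_len l (by omega)
      have h1 := hh _ ⟨blk l j, hj, rfl⟩
      have h2 : Matrix.mulVec h.1 (Pi.single j 1) ∈ VG F n (l.take (blk l j + 1)).sum := by
        rw [← h1]
        refine ⟨Pi.single j 1, ?_, rfl⟩
        intro y hy
        have : y = j := by by_contra hc; simp [hc] at hy
        subst this
        exact (blk_lt_iff l _ _ (by omega)).1 (by omega)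
      have h3 := h2 i (by simpa using hne)
      have h4 := (blk_lt_iff l i (blk l j + 1) (by omega)).2 h3
      omega

lemma actS_bot (σ : Equiv.Perm (Fin n)) : actS σ ⊥ = ⊥ := by simp [actS]
lemma actG_bot (g : GLn F n) : actG g ⊥ = ⊥ := by simp [actG]

theorem th_Hl (l : List ℕ) : IsTh (fun σ : Equiv.Perm (Fin n) => Hl Finset.card (fun y => actS σ y = y) l ⟨⊥, actS_bot σ⟩)
    (fun g : GLn F n => Hl (fun U : Submodule F (Fin n → F) => finrank F U) (fun y => actG g y = y) l ⟨⊥, actG_bot g⟩) := by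
  by_cases hl : l.sum = n
  · have := th_pch (F := F) (fun x : Fin n => blk l x) (fun x y h => blk_mono l (Fin.le_def.1 h) (by omega))
    convert this using 1
    · funext σ; exact fixS l hl σ _
    · funext g; exact fixG l hl g _
  · convert th_zero (F := F) using 1
    · funext σ
      apply Hl_zero
      simpa using hl
    · funext g
      apply Hl_zero
      simpa using hl
end M9b
end OV

open scoped ComplexOrder
open MeasureTheory
namespace OV
set_option linter.unusedSectionVars false
section M9c
open scoped Classical

lemma exists_mu {L : Type} [PartialOrder L] [Fintype L] (x : L) :
    ∃ m : L → ℤ, m x = 1 ∧ ∀ y, x < y → (∑ z, if x ≤ z ∧ z ≤ y then m z else 0) = 0 := by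
  letI : LocallyFiniteOrder L := Fintype.toLocallyFiniteOrder
  refine ⟨fun z => IncidenceAlgebra.mu ℤ x z, by simp, fun y hy => ?_⟩
  have := IncidenceAlgebra.sum_Icc_mu_right (𝕜 := ℤ) x y
  rw [if_neg hy.ne] at this
  rw [← Finset.sum_filter, ← this]
  apply Finset.sum_congr _ (fun _ _ => rfl)
  ext z; simp

lemma weisner {L : Type} [SemilatticeSup L] [Fintype L] (x a : L) (hxa : x < a) (m : L → ℤ)
    (hm : ∀ y, x < y → (∑ z, if x ≤ z ∧ z ≤ y then m z else 0) = 0) (y : L) : a ≤ y →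
    (∑ z, if x ≤ z ∧ z ⊔ a = y then m z else 0) = 0 := by
  induction y using (wellFounded_lt (α := L)).induction with
  | _ y ih =>
  intro hay
  have h1 := hm y (hxa.trans_le hay)
  have h2 : (∑ z, if x ≤ z ∧ z ≤ y then m z else 0) =
      ∑ y', if a ≤ y' ∧ y' ≤ y then (∑ z, if x ≤ z ∧ z ⊔ a = y' then m z else 0) else 0 := by
    have : ∀ y', (if a ≤ y' ∧ y' ≤ y then (∑ z, if x ≤ z ∧ z ⊔ a = y' then m z else 0) else 0) =
        ∑ z, if z ⊔ a = y' then (if x ≤ z ∧ z ≤ y then m z else 0) else 0 := by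
      intro y'
      split_ifs with h
      · refine Finset.sum_congr rfl fun z _ => ?_
        by_cases h3 : z ⊔ a = y'
        · have : z ≤ y := le_trans (h3 ▸ le_sup_left) h.2
          simp [h3, this]
        · simp [h3]
      · symm
        apply Finset.sum_eq_zero
        intro z _
        split_ifs with h3 h4
        · exact absurd ⟨h3 ▸ le_sup_right, h3 ▸ sup_le h4.2 hay⟩ h
        · rfl
        · rfl
    simp only [this]
    rw [Finset.sum_comm]
    simp
  rw [h1] at h2
  rw [Finset.sum_eq_single y] at h2
  · rw [if_pos ⟨hay, le_rfl⟩] at h2; exact h2.symm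
  · intro y' _ hne
    split_ifs with h
    · exact ih y' (lt_of_le_of_ne h.2 hne) h.1
    · rfl
  · simp

lemma mu_sign {L : Type} [SemilatticeSup L] [Fintype L] (r : L → ℕ)
    (H : ∀ x y : L, x < y → ∃ a, x < a ∧ a ≤ y ∧ ∀ z, x ≤ z → z < y → z ⊔ a = y → r y = r z + 1)
    (x : L) (m : L → ℤ) (h1 : m x = 1)
    (hm : ∀ y, x < y → (∑ z, if x ≤ z ∧ z ≤ y then m z else 0) = 0) (y : L) : x ≤ y →
    0 ≤ (-1) ^ (r y + r x) * m y := by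
  induction y using (wellFounded_lt (α := L)).induction with
  | _ y ih =>
  intro hxy
  rcases hxy.eq_or_lt with rfl | hlt
  · rw [h1, ← two_mul, pow_mul]; simp
  · obtain ⟨a, ha1, ha2, ha3⟩ := H x y hlt
    have h2 := weisner x a ha1 m hm y ha2
    rw [← Finset.add_sum_erase _ _ (Finset.mem_univ y), if_pos ⟨hxy, sup_eq_left.2 ha2⟩] at h2
    rw [eq_neg_of_add_eq_zero_left h2, mul_neg, Finset.mul_sum, ← Finset.sum_neg_distrib]
    refine Finset.sum_nonneg fun z hz => ?_
    split_ifs with h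
    · have hzy : z < y := lt_of_le_of_ne (h.2 ▸ le_sup_left) (Finset.ne_of_mem_erase hz)
      have h3 := ha3 z h.1 hzy h.2
      have h4 := ih z hzy h.1
      rw [h3, show r z + 1 + r x = (r z + r x) + 1 by ring, pow_succ]
      linarith
    · simp

lemma pos_inv {L : Type} [SemilatticeSup L] [Fintype L] (r : L → ℕ) (hr : ∀ x y, x ≤ y → r x ≤ r y)
    (H : ∀ x y : L, x < y → ∃ a, x < a ∧ a ≤ y ∧ ∀ z, x ≤ z → z < y → z ⊔ a = y → r y = r z + 1)
    (w : ℝ) (hw : 0 ≤ w) (u u' : L → ℂ)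
    (hT : ∀ x, (∑ y, if x ≤ y then (-(w : ℂ)) ^ (r y - r x) * u' y else 0) = u x) (hu : ∀ x, 0 ≤ u x) (x : L) : 0 ≤ u' x := by
  obtain ⟨m, h1, hm⟩ := exists_mu x
  have key : u' x = ∑ y, if x ≤ y then (m y : ℂ) * (-(w : ℂ)) ^ (r y - r x) * u y else 0 := by
    have e : ∀ y, (if x ≤ y then (m y : ℂ) * (-(w : ℂ)) ^ (r y - r x) * u y else 0) =
        ∑ z, (if x ≤ z then (-(w : ℂ)) ^ (r z - r x) * u' z else 0) * (((if x ≤ y ∧ y ≤ z then m y else 0 : ℤ)) : ℂ) := by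
      intro y
      split_ifs with h
      · rw [← hT y, Finset.mul_sum]
        refine Finset.sum_congr rfl fun z _ => ?_
        by_cases h2 : y ≤ z
        · simp only [h2, if_true, h.trans h2, h, true_and]
          have : r z - r x = (r y - r x) + (r z - r y) := by
            have := hr _ _ h; have := hr _ _ h2; omega
          rw [this, pow_add]; ring
        · simp [h2]
      · symm
        apply Finset.sum_eq_zero; intro z _; simp [h]
    simp only [e]
    rw [Finset.sum_comm]
    simp only [← Finset.mul_sum, ← Int.cast_sum]
    rw [Finset.sum_eq_single x]
    · have : (∑ y, if x ≤ y ∧ y ≤ x then m y else 0) = 1 := by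
        rw [Finset.sum_eq_single x]
        · simp [h1]
        · intro b _ hb; rw [if_neg]; rintro ⟨h2, h3⟩; exact hb (le_antisymm h3 h2)
        · simp
      rw [this]; simp
    · intro z _ hz
      by_cases h : x ≤ z
      · rw [hm z (lt_of_le_of_ne h (Ne.symm hz))]; simp
      · simp [h]
    · simp
  rw [key]
  refine Finset.sum_nonneg fun y _ => ?_
  split_ifs with h
  · refine mul_nonneg ?_ (hu y)
    have h2 := mu_sign r H x m h1 hm y h
    have h3 : (m y : ℂ) * (-(w : ℂ)) ^ (r y - r x) = (((((-1) ^ (r y + r x) * m y : ℤ) : ℝ) * w ^ (r y - r x) : ℝ) : ℂ) := by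
      have h4 : r y + r x = (r y - r x) + 2 * r x := by have := hr _ _ h; omega
      rw [neg_pow, h4, pow_add, pow_mul]
      push_cast
      simp; ring
    rw [h3]
    exact_mod_cast mul_nonneg (by exact_mod_cast h2) (pow_nonneg hw _)
  · exact le_rfl

section T
variable {Λ : Type} [PartialOrder Λ] [BoundedOrder Λ] [Fintype Λ] (r : Λ → ℕ) (p : Λ → Prop)

/-- generating operator -/
noncomputable def Tp (n : ℕ) (w : ℂ) : ({y // p y} → ℂ) →ₗ[ℂ] ({y // p y} → ℂ) :=
  ∑ a ∈ Finset.range (n + 1), w ^ a • Hop r p a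

lemma Tp_apply (n : ℕ) (hn : ∀ x, r x ≤ n) (hr : ∀ x y, x ≤ y → r x ≤ r y) (w : ℂ) (u : {y // p y} → ℂ) (x : {y // p y}) :
    Tp r p n w u x = ∑ y : {y // p y}, if x ≤ y then w ^ (r y.1 - r x.1) * u y else 0 := by
  simp only [Tp, LinearMap.sum_apply, LinearMap.smul_apply, Finset.sum_apply, Pi.smul_apply, Hop_apply, smul_eq_mul,
    Finset.mul_sum]
  rw [Finset.sum_comm]
  refine Finset.sum_congr rfl fun y _ => ?_
  by_cases h : x.1 ≤ y.1
  · rw [Finset.sum_eq_single (r y.1 - r x.1)]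
    · have := hr _ _ h
      rw [if_pos ⟨h, by omega⟩, if_pos (show x ≤ y from h)]
    · intro a _ ha
      rw [if_neg, mul_zero]
      rintro ⟨_, h2⟩; omega
    · intro h2
      have := hn y.1
      simp at h2; omega
  · rw [if_neg (show ¬ x ≤ y from h)]
    apply Finset.sum_eq_zero; intro a _; simp [h]

lemma Tp_inj (n : ℕ) (hn : ∀ x, r x ≤ n) (hr : ∀ x y, x ≤ y → r x ≤ r y) (w : ℂ) : Function.Injective (Tp r p n w) := by
  rw [injective_iff_map_eq_zero]
  intro u hu
  funext x
  induction x using (wellFounded_gt (α := {y // p y})).induction with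
  | _ x ih =>
  have h1 := congrFun hu x
  rw [Tp_apply r p n hn hr, Finset.sum_eq_single x] at h1
  · simpa using h1
  · intro y _ hy
    split_ifs with h
    · rw [ih y (lt_of_le_of_ne h (Ne.symm hy))]; simp
    · rfl
  · simp
end T
end M9c
end OV

open scoped ComplexOrder
open MeasureTheory
namespace OV
set_option linter.unusedSectionVars false
section M9d
open scoped Classical
open Module
variable {F : Type} [Field F] [Fintype F] [DecidableEq F] {n : ℕ}

lemma UT_step (g : GLn F n) (hg : IsUT F g) (k : ℕ) (hk : k < n) (v : Fin n → F) (hv : v ∈ VG F n (k + 1)) :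
    Matrix.mulVec g.1 v - g.1 ⟨k, hk⟩ ⟨k, hk⟩ • v ∈ VG F n k := by
  rw [mem_VG] at *
  intro i hi
  by_contra hik
  apply hi
  have h1 : Matrix.mulVec g.1 v i = g.1 i ⟨k, hk⟩ * v ⟨k, hk⟩ := by
    rw [Matrix.mulVec, dotProduct, Finset.sum_eq_single ⟨k, hk⟩]
    · intro j _ hj
      by_cases h0 : v j = 0
      · simp [h0]
      · have := hv j h0
        have h3 : (j : ℕ) ≠ k := fun h => hj (Fin.ext h)
        rw [hg i j (by rw [Fin.lt_def]; omega), zero_mul]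
    · simp
  rw [Pi.sub_apply, h1, Pi.smul_apply, smul_eq_mul]
  rcases (not_lt.1 hik).eq_or_lt with h | h
  · have : i = ⟨k, hk⟩ := Fin.ext h.symm
    rw [this]; ring
  · rw [hg i ⟨k, hk⟩ (by rw [Fin.lt_def]; exact h)]
    have : v i = 0 := by by_contra hc; have := hv i hc; omega
    rw [this]; ring

lemma actG_le_iff (g : GLn F n) (U : Submodule F (Fin n → F)) (h : actG g U ≤ U) : actG g U = U :=
  Submodule.eq_of_le_of_finrank_eq h (actG_rank g U)

lemma actG_sup (g : GLn F n) (U V : Submodule F (Fin n → F)) : actG g (U ⊔ V) = actG g U ⊔ actG g V :=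
  Submodule.map_sup _ _ _

lemma UT_atom (g : GLn F n) (hg : IsUT F g) (x y : Submodule F (Fin n → F)) (hx : actG g x = x) (hy : actG g y = y)
    (hxy : x < y) : ∃ a, actG g a = a ∧ x < a ∧ a ≤ y ∧ ∀ z, x ≤ z → z < y → z ⊔ a = y →
      finrank F y = finrank F z + 1 := by
  have hex : ∃ k, ∃ v, v ∈ y ∧ v ∈ VG F n k ∧ v ∉ x := by
    obtain ⟨v, hv1, hv2⟩ := SetLike.exists_of_lt hxy
    exact ⟨n, v, hv1, fun i _ => i.2, hv2⟩
  obtain ⟨v, hv1, hv2, hv3⟩ := Nat.find_spec hex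
  have hmin := fun m => Nat.find_min hex (m := m)
  set k := Nat.find hex with hk
  obtain ⟨k', hk'⟩ : ∃ k', k = k' + 1 := by
    cases h : k with
    | zero =>
      exfalso
      apply hv3
      have : v = 0 := by
        funext i; by_contra hc; have := hv2 i hc; rw [h] at this; omega
      rw [this]; exact x.zero_mem
    | succ k' => exact ⟨k', rfl⟩
  have hkn : k' < n := by
    by_contra hc
    exact hmin n (by omega) ⟨v, hv1, fun i _ => i.2, hv3⟩
  have h1 := UT_step g hg k' hkn v (hk' ▸ hv2)
  have hgy : Matrix.mulVec g.1 v ∈ y := by rw [← hy]; exact ⟨v, hv1, rfl⟩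
  have h2 : Matrix.mulVec g.1 v - g.1 ⟨k', hkn⟩ ⟨k', hkn⟩ • v ∈ x := by
    by_contra hc
    exact hmin k' (by omega) ⟨_, y.sub_mem hgy (y.smul_mem _ hv1), h1, hc⟩
  refine ⟨x ⊔ Submodule.span F {v}, ?_, ?_, ?_, ?_⟩
  · apply actG_le_iff
    rw [actG_sup, hx]
    refine sup_le le_sup_left ?_
    rw [actG, Submodule.map_span, Set.image_singleton, Submodule.span_le, Set.singleton_subset_iff]
    have : Matrix.mulVecLin g.1 v = (Matrix.mulVec g.1 v - g.1 ⟨k', hkn⟩ ⟨k', hkn⟩ • v) + g.1 ⟨k', hkn⟩ ⟨k', hkn⟩ • v := by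
      simp
    rw [this]
    exact Submodule.add_mem_sup h2 (Submodule.smul_mem _ _ (Submodule.mem_span_singleton_self v))
  · refine lt_of_le_of_ne le_sup_left fun h => hv3 ?_
    rw [h]; exact Submodule.mem_sup_right (Submodule.mem_span_singleton_self v)
  · refine sup_le hxy.le ?_
    rw [Submodule.span_le, Set.singleton_subset_iff]; exact hv1
  · intro z hz hzy hs
    have h3 : z ⊔ Submodule.span F {v} = y := by
      rw [← sup_assoc, sup_eq_left.2 hz] at hs; exact hs
    have h4 := Submodule.finrank_add_le_finrank_add_finrank z (Submodule.span F {v})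
    rw [h3] at h4
    have h5 := Submodule.finrank_lt_finrank_of_lt hzy
    have h6 := finrank_span_le_card (R := F) ({v} : Set (Fin n → F))
    simp at h6
    omega

theorem UT_pos (g : GLn F n) (hg : IsUT F g) (w : ℝ) (hw : 0 ≤ w)
    (u u' : {U : Submodule F (Fin n → F) // actG g U = U} → ℂ)
    (hT : Tp (fun U : Submodule F (Fin n → F) => finrank F U) (fun U => actG g U = U) n (-(w : ℂ)) u' = u)
    (hu : ∀ x, 0 ≤ u x) (x) : 0 ≤ u' x := by
  letI : SemilatticeSup {U : Submodule F (Fin n → F) // actG g U = U} :=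
    Subtype.semilatticeSup (fun {U V} hU hV => by rw [actG_sup, hU, hV])
  refine pos_inv (fun U : {U : Submodule F (Fin n → F) // actG g U = U} => finrank F U.1) (fun a b h => Submodule.finrank_mono h) ?_ w hw u u' ?_ hu x
  · intro a b hab
    obtain ⟨c, hc1, hc2, hc3, hc4⟩ := UT_atom g hg a.1 b.1 a.2 b.2 hab
    exact ⟨⟨c, hc1⟩, hc2, hc3, fun z h1 h2 h3 => hc4 z.1 h1 h2 (congrArg Subtype.val h3)⟩
  · intro a
    rw [← hT, Tp_apply]
    · rfl
    · intro x
      have := Submodule.finrank_le x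
      simpa using this
    · exact fun a b h => Submodule.finrank_mono h

/-- orbits -/
abbrev Orb (σ : Equiv.Perm (Fin n)) := Quotient (Equiv.Perm.SameCycle.setoid σ)

/-- orbit of a point -/
def orb (σ : Equiv.Perm (Fin n)) (x : Fin n) : Orb σ := Quotient.mk _ x

lemma orb_eq (σ : Equiv.Perm (Fin n)) (x y : Fin n) : orb σ x = orb σ y ↔ σ.SameCycle x y := by
  rw [orb, orb, Quotient.eq]; rfl

noncomputable instance (σ : Equiv.Perm (Fin n)) : Fintype (Orb σ) := Fintype.ofFinite _

/-- orbit size -/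
noncomputable def osz (σ : Equiv.Perm (Fin n)) (o : Orb σ) : ℕ := (Finset.univ.filter (fun x => orb σ x = o)).card

/-- the set of orbits missing S -/
noncomputable def oc (σ : Equiv.Perm (Fin n)) (S : Finset (Fin n)) : Finset (Orb σ) :=
  Finset.univ.filter (fun o => ∀ x, orb σ x = o → x ∉ S)

/-- union of orbits -/
noncomputable def ou (σ : Equiv.Perm (Fin n)) (A : Finset (Orb σ)) : Finset (Fin n) :=
  Finset.univ.filter (fun x => orb σ x ∈ A)

lemma inv_orb (σ : Equiv.Perm (Fin n)) (S : Finset (Fin n)) (hS : actS σ S = S) (x y : Fin n) (h : orb σ x = orb σ y)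
    (hx : x ∈ S) : y ∈ S := by
  rw [orb_eq] at h
  have h1 : ∀ z, σ z ∈ S ↔ z ∈ S := fun z => by
    have := mem_actS σ S z; rwa [hS] at this
  obtain ⟨k, -, hk⟩ := h.exists_pow_eq'
  rw [← hk]
  clear hk
  induction k with
  | zero => simpa using hx
  | succ k ih => rw [pow_succ', Equiv.Perm.mul_apply, h1]; exact ih

lemma orb_apply (σ : Equiv.Perm (Fin n)) (x : Fin n) : orb σ (σ x) = orb σ x := by
  rw [orb_eq]; exact (Equiv.Perm.sameCycle_apply_left).2 (Equiv.Perm.SameCycle.refl _ _)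

lemma act_ou (σ : Equiv.Perm (Fin n)) (A : Finset (Orb σ)) : actS σ (ou σ A) = ou σ A := by
  apply Finset.eq_of_subset_of_card_le
  · intro x hx
    simp only [actS, Finset.mem_map] at hx
    obtain ⟨y, hy, rfl⟩ := hx
    simp only [ou, Finset.mem_filter, Finset.mem_univ, true_and] at hy ⊢
    simpa [orb_apply] using hy
  · simp [actS]

lemma card_ou (σ : Equiv.Perm (Fin n)) (A : Finset (Orb σ)) : (ou σ A).card = ∑ o ∈ A, osz σ o := by
  rw [ou, Finset.card_eq_sum_card_fiberwise (t := A) (f := orb σ)]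
  · refine Finset.sum_congr rfl fun o ho => ?_
    rw [osz]
    congr 1
    ext x
    simp only [Finset.mem_filter, Finset.mem_univ, true_and]
    constructor
    · exact fun h => h.2
    · exact fun h => ⟨h ▸ ho, h⟩
  · intro x hx; simpa using hx

lemma ou_oc (σ : Equiv.Perm (Fin n)) (S : Finset (Fin n)) (hS : actS σ S = S) : ou σ (oc σ S) = Sᶜ := by
  ext x
  simp only [ou, oc, Finset.mem_filter, Finset.mem_univ, true_and, Finset.mem_compl]
  constructor
  · exact fun h => h x rfl
  · intro h y hy hyS; exact h (inv_orb σ S hS y x hy hyS)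

lemma oc_ou (σ : Equiv.Perm (Fin n)) (A : Finset (Orb σ)) : oc σ (ou σ A)ᶜ = A := by
  ext o
  simp only [ou, oc, Finset.mem_filter, Finset.mem_univ, true_and, Finset.mem_compl, not_not]
  constructor
  · intro h
    obtain ⟨x, hx⟩ := Quotient.exists_rep o
    have : orb σ x = o := hx
    rw [← this]; exact h x this
  · rintro h x rfl; exact h

lemma act_compl (σ : Equiv.Perm (Fin n)) (S : Finset (Fin n)) (hS : actS σ S = S) : actS σ Sᶜ = Sᶜ := by
  rw [← ou_oc σ S hS, act_ou]

/-- product formula -/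
noncomputable def pf (σ : Equiv.Perm (Fin n)) (f : ℕ → ℂ) : {S : Finset (Fin n) // actS σ S = S} → ℂ :=
  fun S => ∏ o ∈ oc σ S.1, f (osz σ o)

theorem Tp_pf (σ : Equiv.Perm (Fin n)) (f : ℕ → ℂ) (w : ℂ) :
    Tp Finset.card (fun S => actS σ S = S) n w (pf σ f) = pf σ (fun k => f k + w ^ k) := by
  funext S
  rw [Tp_apply Finset.card _ n (fun x => by simpa using Finset.card_le_univ x) (fun x y h => Finset.card_le_card h)]
  trans ∑ y ∈ Finset.univ.filter (fun y => S ≤ y), w ^ (y.1.card - S.1.card) * pf σ f y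
  · rw [Finset.sum_filter]
    refine Finset.sum_congr (by ext y; simp) fun y _ => ?_
    congr 1
  simp only [pf]
  rw [Finset.prod_add]
  refine Finset.sum_bij' (fun T _ => oc σ T.1) (fun A _ => ⟨(ou σ A)ᶜ, act_compl σ _ (act_ou σ A)⟩) ?_ ?_ ?_ ?_ ?_
  · intro T hT
    simp only [Finset.mem_filter, Finset.mem_univ, true_and] at hT
    rw [Finset.mem_powerset]
    intro o
    simp only [oc, Finset.mem_filter, Finset.mem_univ, true_and]
    exact fun h x hx hxS => h x hx (hT hxS)
  · intro A hA
    simp only [Finset.mem_filter, Finset.mem_univ, true_and]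
    rw [Finset.mem_powerset] at hA
    change S.1 ⊆ (ou σ A)ᶜ
    intro x hx
    simp only [ou, Finset.mem_compl, Finset.mem_filter, Finset.mem_univ, true_and]
    intro h
    have := hA h
    simp only [oc, Finset.mem_filter, Finset.mem_univ, true_and] at this
    exact this x rfl hx
  · intro T _
    apply Subtype.ext
    change (ou σ (oc σ T.1))ᶜ = T.1
    rw [ou_oc σ _ T.2, compl_compl]
  · intro A _
    exact oc_ou σ A
  · intro T hT
    simp only [Finset.mem_filter, Finset.mem_univ, true_and] at hT
    have hsub : oc σ T.1 ⊆ oc σ S.1 := by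
      intro o
      simp only [oc, Finset.mem_filter, Finset.mem_univ, true_and]
      exact fun h x hx hxS => h x hx (hT hxS)
    rw [mul_comm]
    congr 1
    rw [Finset.prod_pow_eq_pow_sum]
    congr 1
    have h1 := card_ou σ (oc σ T.1)
    have h2 := card_ou σ (oc σ S.1)
    rw [ou_oc σ _ T.2, Finset.card_compl] at h1
    rw [ou_oc σ _ S.2, Finset.card_compl] at h2
    have h3 := Finset.sum_sdiff (f := osz σ) hsub
    have h4 := Finset.card_le_univ T.1
    have h5 := Finset.card_le_univ S.1
    have h6 := Finset.card_le_card (show S.1 ⊆ T.1 from hT)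
    omega

lemma pf_zero (σ : Equiv.Perm (Fin n)) : pf σ (fun _ => 0) = dtop (fun S => actS σ S = S) := by
  funext S
  simp only [pf, dtop]
  have := ou_oc σ S.1 S.2
  by_cases h : oc σ S.1 = ∅
  · have h2 : S.1 = ⊤ := by
      rw [h] at this
      have h3 : (S.1)ᶜ = ∅ := by rw [← this]; simp [ou]
      simpa using h3
    rw [if_pos h2, h]; simp
  · have h2 : S.1 ≠ ⊤ := by
      intro h2
      apply h
      rw [h2]
      have : (⊤ : Finset (Fin n))= (ou σ ∅)ᶜ := by ext x; simp [ou]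
      rw [this, oc_ou]
    rw [if_neg h2, Finset.prod_const, zero_pow]
    simpa using h

lemma pf_bot (σ : Equiv.Perm (Fin n)) (f : ℕ → ℂ) (hf : f 1 = 1) :
    pf σ f ⟨⊥, actS_bot σ⟩ = (σ.cycleType.map f).prod := by
  have h0 : oc σ ⊥ = Finset.univ := by ext o; simp [oc]
  simp only [pf, h0]
  rw [Equiv.Perm.cycleType, Multiset.map_map]
  change _ = ∏ c ∈ σ.cycleFactorsFinset, _
  have hs : ∀ x, x ∈ σ.support → (σ.cycleOf x).support.card = osz σ (orb σ x) := by
    intro x hx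
    rw [osz]
    congr 1
    ext y
    rw [Equiv.Perm.mem_support_cycleOf_iff]
    simp only [hx, and_true, Finset.mem_filter, Finset.mem_univ, true_and, orb_eq]
    exact Equiv.Perm.sameCycle_comm
  have hns : ∀ x, x ∉ σ.support → osz σ (orb σ x) = 1 := by
    intro x hx
    rw [osz, Finset.card_eq_one]
    refine ⟨x, ?_⟩
    ext y
    simp only [Finset.mem_filter, Finset.mem_univ, true_and, orb_eq, Finset.mem_singleton]
    have hx' : σ x = x := by simpa using hx
    constructor
    · intro h
      have := (Equiv.Perm.SameCycle.eq_of_left h.symm hx')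
      exact this.symm
    · rintro rfl; exact Equiv.Perm.SameCycle.refl _ _
  rw [← Finset.prod_filter_mul_prod_filter_not Finset.univ (fun o => ∃ x ∈ σ.support, orb σ x = o)]
  rw [Finset.prod_eq_one (s := Finset.univ.filter (fun o => ¬ ∃ x ∈ σ.support, orb σ x = o)), mul_one]
  · symm
    refine Finset.prod_bij (fun c hc => orb σ (Classical.choose (Equiv.Perm.mem_cycleFactorsFinset_iff.1 hc).1.nonempty_support)) ?_ ?_ ?_ ?_
    · intro c hc
      have h1 := Classical.choose_spec (Equiv.Perm.mem_cycleFactorsFinset_iff.1 hc).1.nonempty_support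
      simp only [Finset.mem_filter, Finset.mem_univ, true_and]
      exact ⟨_, Equiv.Perm.mem_cycleFactorsFinset_support_le hc h1, rfl⟩
    · intro c hc d hd h
      have h1 := Classical.choose_spec (Equiv.Perm.mem_cycleFactorsFinset_iff.1 hc).1.nonempty_support
      have h2 := Classical.choose_spec (Equiv.Perm.mem_cycleFactorsFinset_iff.1 hd).1.nonempty_support
      rw [orb_eq] at h
      rw [Equiv.Perm.cycle_is_cycleOf h1 hc, Equiv.Perm.cycle_is_cycleOf h2 hd]
      exact h.cycleOf_eq
    · intro o ho
      simp only [Finset.mem_filter, Finset.mem_univ, true_and] at ho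
      obtain ⟨x, hx, rfl⟩ := ho
      have hc := Equiv.Perm.cycleOf_mem_cycleFactorsFinset_iff.2 hx
      refine ⟨_, hc, ?_⟩
      have h1 := Classical.choose_spec (Equiv.Perm.mem_cycleFactorsFinset_iff.1 hc).1.nonempty_support
      rw [Equiv.Perm.mem_support_cycleOf_iff] at h1
      rw [orb_eq]
      exact h1.1.symm
    · intro c hc
      have h1 := Classical.choose_spec (Equiv.Perm.mem_cycleFactorsFinset_iff.1 hc).1.nonempty_support
      rw [← hs _ (Equiv.Perm.mem_cycleFactorsFinset_support_le hc h1), ← Equiv.Perm.cycle_is_cycleOf h1 hc]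
      rfl
  · intro o ho
    simp only [Finset.mem_filter, Finset.mem_univ, true_and] at ho
    obtain ⟨x, hx⟩ := Quotient.exists_rep o
    have hx : orb σ x = o := hx
    subst hx
    rw [hns x (fun h => ho ⟨x, h, rfl⟩), hf]
end M9d
end OV

open scoped ComplexOrder
open MeasureTheory
namespace OV
set_option linter.unusedSectionVars false
section M9e
open scoped Classical
open Module
variable {F : Type} [Field F] [Fintype F] [DecidableEq F] {n : ℕ}

/-- functions on fixed sets and fixed subspaces -/
abbrev WW (F : Type) [Field F] [Fintype F] [DecidableEq F] (n : ℕ) :=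
  ((σ : Equiv.Perm (Fin n)) → ({S : Finset (Fin n) // actS σ S = S} → ℂ)) ×
  ((g : GLn F n) → ({U : Submodule F (Fin n → F) // actG g U = U} → ℂ))

/-- operators on the total space -/
noncomputable def HW (a : ℕ) : WW F n →ₗ[ℂ] WW F n :=
  LinearMap.prodMap (LinearMap.pi fun σ => (Hop Finset.card (fun S => actS σ S = S) a).comp (LinearMap.proj σ))
    (LinearMap.pi fun g => (Hop (fun U : Submodule F (Fin n → F) => finrank F U) (fun U => actG g U = U) a).comp
      (LinearMap.proj g))

/-- generating operators on the total space -/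
noncomputable def TW (w : ℂ) : WW F n →ₗ[ℂ] WW F n :=
  ∑ a ∈ Finset.range (n + 1), w ^ a • HW a

lemma TW_fst (w : ℂ) (u : WW F n) (σ) : (TW w u).1 σ = Tp Finset.card (fun S => actS σ S = S) n w (u.1 σ) := by
  simp [TW, Tp, HW, LinearMap.sum_apply, Prod.fst_sum, Finset.sum_apply]

lemma TW_snd (w : ℂ) (u : WW F n) (g) : (TW w u).2 g =
    Tp (fun U : Submodule F (Fin n → F) => finrank F U) (fun U => actG g U = U) n w (u.2 g) := by
  simp [TW, Tp, HW, LinearMap.sum_apply, Prod.snd_sum, Finset.sum_apply]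

lemma rk_le (x : Submodule F (Fin n → F)) : finrank F x ≤ n := by
  have := Submodule.finrank_le x
  simpa using this

lemma rk_mono (x y : Submodule F (Fin n → F)) (h : x ≤ y) : finrank F x ≤ finrank F y := Submodule.finrank_mono h

lemma TpS_inj (σ : Equiv.Perm (Fin n)) (w : ℂ) : Function.Injective (Tp Finset.card (fun S => actS σ S = S) n w) :=
  Tp_inj _ _ n (fun x => by simpa using Finset.card_le_univ x) (fun x y h => Finset.card_le_card h) w

lemma TW_inj (w : ℂ) : Function.Injective (TW w : WW F n →ₗ[ℂ] WW F n) := by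
  intro u v h
  apply Prod.ext
  · funext σ
    apply TpS_inj σ w
    rw [← TW_fst, ← TW_fst, h]
  · funext g
    apply Tp_inj (fun U : Submodule F (Fin n → F) => finrank F U) (fun U => actG g U = U) n rk_le rk_mono w
    rw [← TW_snd, ← TW_snd, h]

/-- vectors of iterated operators -/
noncomputable def hlW (l : List ℕ) : WW F n :=
  (fun σ => Hl Finset.card (fun S => actS σ S = S) l,
    fun g => Hl (fun U : Submodule F (Fin n → F) => finrank F U) (fun U => actG g U = U) l)

/-- the span -/
noncomputable def MW (F : Type) [Field F] [Fintype F] [DecidableEq F] (n : ℕ) : Submodule ℂ (WW F n) :=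
  Submodule.span ℂ (Set.range hlW)

lemma HW_mem (a : ℕ) (u : WW F n) (hu : u ∈ MW F n) : HW a u ∈ MW F n := by
  have : MW F n ≤ (MW F n).comap (HW a) := by
    rw [MW, Submodule.span_le]
    rintro _ ⟨l, rfl⟩
    exact Submodule.subset_span ⟨a :: l, rfl⟩
  exact this hu

lemma TW_mem (w : ℂ) (u : WW F n) (hu : u ∈ MW F n) : TW w u ∈ MW F n := by
  simp only [TW, LinearMap.sum_apply, LinearMap.smul_apply]
  exact Submodule.sum_mem _ fun a _ => Submodule.smul_mem _ _ (HW_mem a u hu)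

lemma TW_surj (w : ℂ) (u : WW F n) (hu : u ∈ MW F n) : ∃ v ∈ MW F n, TW w v = u := by
  have h1 : Function.Injective ((TW w : WW F n →ₗ[ℂ] WW F n).restrict (p := MW F n) (q := MW F n) (TW_mem w)) := by
    intro a b hab
    apply Subtype.ext
    apply TW_inj w
    exact congrArg Subtype.val hab
  obtain ⟨v, hv⟩ := LinearMap.injective_iff_surjective.1 h1 ⟨u, hu⟩
  exact ⟨v.1, v.2, congrArg Subtype.val hv⟩

lemma th_MW (u : WW F n) (hu : u ∈ MW F n) :
    IsTh (fun σ => u.1 σ ⟨⊥, actS_bot σ⟩) (fun g : GLn F n => u.2 g ⟨⊥, actG_bot g⟩) := by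
  induction hu using Submodule.span_induction with
  | mem x hx => obtain ⟨l, rfl⟩ := hx; exact th_Hl l
  | zero => exact th_zero
  | add x y _ _ hx hy => exact th_add hx hy
  | smul a x _ hx => exact th_smul a hx

theorem main_ws (ws : List (Bool × ℝ)) (h0 : ∀ p ∈ ws, 0 ≤ p.2) :
    ∃ u ∈ MW F n, (∀ σ, u.1 σ = pf σ (fun k => ((psum k ws : ℝ) : ℂ))) ∧ ∀ g, IsUT F g → ∀ x, 0 ≤ u.2 g x := by
  induction ws with
  | nil =>
    refine ⟨hlW [], Submodule.subset_span ⟨[], rfl⟩, fun σ => ?_, fun g _ x => ?_⟩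
    · have : (fun k => ((psum k [] : ℝ) : ℂ)) = fun _ => 0 := by funext k; simp [psum]
      rw [this, pf_zero]; rfl
    · simp only [hlW, Hl, dtop]
      split_ifs <;> simp
  | cons pr ws ih =>
    obtain ⟨u, hu, h1, h2⟩ := ih (fun p hp => h0 p (List.mem_cons_of_mem _ hp))
    have hw := h0 pr List.mem_cons_self
    obtain ⟨b, w⟩ := pr
    simp only at hw
    cases b with
    | true =>
      refine ⟨TW w u, TW_mem _ u hu, fun σ => ?_, fun g hg x => ?_⟩
      · rw [TW_fst, h1, Tp_pf]
        congr 1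
        funext k
        simp [psum, add_comm]
      · rw [TW_snd, Tp_apply _ _ n rk_le rk_mono]
        refine Finset.sum_nonneg fun y _ => ?_
        split_ifs
        · refine mul_nonneg ?_ (h2 g hg y)
          exact_mod_cast pow_nonneg hw _
        · exact le_rfl
    | false =>
      obtain ⟨v, hv, hvu⟩ := TW_surj (-(w : ℂ)) u hu
      refine ⟨v, hv, fun σ => ?_, fun g hg x => ?_⟩
      · apply TpS_inj σ (-(w : ℂ))
        rw [← TW_fst, hvu, h1, Tp_pf]
        congr 1
        funext k
        simp [psum]
        rw [neg_pow (w : ℂ) k]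
        ring
      · refine UT_pos g hg w hw (u.2 g) (v.2 g) ?_ (h2 g hg) x
        rw [← TW_snd, hvu]

theorem th_ws (ws : List (Bool × ℝ)) (h0 : ∀ p ∈ ws, 0 ≤ p.2) (h1 : (ws.map Prod.snd).sum = 1) :
    ∃ φ : GLn F n → ℂ, IsTh (fun σ : Equiv.Perm (Fin n) => (((σ.cycleType.map (fun k => psum k ws)).prod : ℝ) : ℂ)) φ ∧
      ∀ g, IsUT F g → 0 ≤ φ g := by
  obtain ⟨u, hu, h2, h3⟩ := main_ws (F := F) (n := n) ws h0
  refine ⟨_, ?_, fun g hg => h3 g hg ⟨⊥, actG_bot g⟩⟩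
  convert th_MW u hu using 1
  funext σ
  rw [h2, pf_bot]
  · rw [← Complex.ofRealHom_eq_coe, map_multiset_prod, Multiset.map_map]; rfl
  · have : psum 1 ws = (ws.map Prod.snd).sum := by
      simp [psum]
      try rfl
    rw [this, h1]; simp
end M9e
end OV

open scoped ComplexOrder
open MeasureTheory
namespace OV
set_option linter.unusedSectionVars false
section M10
open scoped Classical
variable {F : Type} [Field F] [Fintype F] [DecidableEq F]

lemma embS_cycleType {n : ℕ} (σ : Equiv.Perm (Fin n)) : (embS n σ).cycleType = σ.cycleType := by
  unfold embS Equiv.Perm.viaFintypeEmbedding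
  exact Equiv.Perm.cycleType_extendDomain _

/-- iterated embedding -/
noncomputable def embI (n : ℕ) : (k : ℕ) → Equiv.Perm (Fin n) → Equiv.Perm (Fin (n + k))
  | 0, σ => σ
  | k + 1, σ => embS (n + k) (embI n k σ)

lemma embI_cycleType (n k : ℕ) (σ : Equiv.Perm (Fin n)) : (embI n k σ).cycleType = σ.cycleType := by
  induction k with
  | zero => rfl
  | succ k ih => rw [embI, embS_cycleType, ih]

lemma embI_card (n k : ℕ) (σ : Equiv.Perm (Fin n)) : (embI n k σ).support.card ≤ n := by
  rw [← Equiv.Perm.sum_cycleType, embI_cycleType, Equiv.Perm.sum_cycleType]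
  simpa using Finset.card_le_univ σ.support

lemma embI_one (n k : ℕ) : embI n k 1 = 1 := by
  rw [← Equiv.Perm.cycleType_eq_zero, embI_cycleType]; simp

lemma th_deg_zero {f : Equiv.Perm (Fin 0) → ℂ} {φ : GLn F 0 → ℂ} (h : IsTh f φ) : f 1 = φ 1 := by
  have hc : Monotone (fun i : Fin 0 => (0 : ℕ)) := fun i => i.elim0
  have h1 := th_cip h (th_pch (F := F) _ hc)
  rw [cip_pch _ _ (fun g k => th_conjS h g k), cip_pch _ _ (fun g k => th_conj h g k)] at h1
  have h2 : ∀ (G : Type) [Group G] [Fintype G] [Subsingleton G] (P : Subgroup G) (u : G → ℂ), avgS P u = u 1 := by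
    intro G _ _ _ P u
    unfold avgS
    have : ∀ h : P, u h = u 1 := fun h => congrArg u (Subsingleton.elim _ _)
    simp only [this, Finset.sum_const, Finset.card_univ, nsmul_eq_mul]
    rw [inv_mul_cancel_left₀]
    exact_mod_cast Fintype.card_ne_zero
  haveI : Subsingleton (GLn F 0) := ⟨fun a b => Units.ext (Subsingleton.elim _ _)⟩
  rwa [h2, h2] at h1

/-- approximation by a single irreducible -/
lemma approx_one {n N : ℕ} (hN : 0 < N) (e : Equiv.Perm (Fin n) → Equiv.Perm (Fin N))
    (he : ∀ σ, (e σ).cycleType = σ.cycleType)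
    (g : GLn F n) (hg : IsUT F g) (C : ℝ)
    (hC : ∀ f, ∀ B : ℝ, 0 ≤ B → (∀ σ, ‖f σ‖ ≤ B) → ‖theta g f‖ ≤ C * B)
    (f : Equiv.Perm (Fin N) → ℂ) (hf : IsIrrChar f) :
    ∃ z : ℂ, 0 ≤ z ∧ ‖theta g (fun σ => f (e σ)) - z‖ ≤ (f 1).re * (C * ((4 * (n : ℝ) ^ 3 + 2 * n) * n / N)) := by
  obtain ⟨V, _, _, _, _, ρ, h1, h2, rfl⟩ := hf
  obtain ⟨ws, w0, w1, hw⟩ := weights_of_irrep ρ hN h1 h2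
  obtain ⟨φ, hφ, hφ0⟩ := th_ws (F := F) (n := n) ws w0 w1
  have hd : (Module.finrank ℂ V : ℂ) ≠ 0 := by
    exact_mod_cast (Module.finrank_pos (R := ℂ) (M := V)).ne'
  refine ⟨(Module.finrank ℂ V : ℂ) * φ g, mul_nonneg (by exact_mod_cast Nat.zero_le _) (hφ0 g hg), ?_⟩
  have hB : (0 : ℝ) ≤ (4 * (n : ℝ) ^ 3 + 2 * n) * n / N := by positivity
  have key := hC ((fun σ => nchar ρ (e σ)) - fun σ : Equiv.Perm (Fin n) => (((σ.cycleType.map (fun k => psum k ws)).prod : ℝ) : ℂ)) _ hB (by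
    intro σ
    have := hw n (e σ) (by
      rw [← Equiv.Perm.sum_cycleType, he, Equiv.Perm.sum_cycleType]
      simpa using Finset.card_le_univ σ.support)
    rw [he] at this
    exact this)
  rw [map_sub, theta_eq hφ] at key
  have hch : (fun σ => ρ.character (e σ)) = (Module.finrank ℂ V : ℂ) • fun σ => nchar ρ (e σ) := by
    funext σ
    simp only [Pi.smul_apply, smul_eq_mul, nchar, Representation.character]
    field_simp
  rw [hch, map_smul, smul_eq_mul, ← mul_sub, norm_mul, Representation.char_one]
  simpa using mul_le_mul_of_nonneg_left key (Nat.cast_nonneg (Module.finrank ℂ V))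

theorem th_pos (φ : ∀ n, GLn F n → ℂ)
    (hext : ∀ n (g : GLn F n), φ n g = (((Fintype.card F : ℂ) - 1) * (Fintype.card F : ℂ) ^ n)⁻¹ * ∑ h ∈ ExtSet F g, φ (n + 1) h)
    (h1 : φ 0 1 = 1)
    (hdec : ∀ N, ∃ (T : Finset (GLn F N → ℂ)) (w : (GLn F N → ℂ) → ℂ) (f : (GLn F N → ℂ) → Equiv.Perm (Fin N) → ℂ),
      (∀ ψ ∈ T, 0 ≤ w ψ ∧ IsIrrChar (f ψ)) ∧ IsTh (∑ ψ ∈ T, w ψ • f ψ) (φ N))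
    (n : ℕ) (g : GLn F n) (hg : IsUT F g) : 0 ≤ φ n g := by
  choose T w f hf hth using hdec
  let fT : ∀ N, Equiv.Perm (Fin N) → ℂ := fun N => ∑ ψ ∈ T N, w N ψ • f N ψ
  have hr : ∀ m, fT m = fun σ => fT (m + 1) (embS m σ) := fun m => th_restrict (hth m) (hth (m + 1)) (hext m)
  have hrI : ∀ m k, fT m = fun σ => fT (m + k) (embI m k σ) := by
    intro m k
    induction k with
    | zero => rfl
    | succ k ih =>
      rw [ih]; funext σ
      rw [hr (m + k)]; rfl
  have hone : ∀ N, fT N 1 = 1 := by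
    intro N
    induction N with
    | zero => rw [← h1]; exact th_deg_zero (hth 0)
    | succ N ih =>
      have h := congrFun (hr N) 1
      have h2 := embI_one N 1
      rw [show embI N 1 1 = embS N 1 from rfl] at h2
      rw [h2, ih] at h
      exact h.symm
  obtain ⟨C, hC0, hC⟩ := theta_bound g
  have happ : ∀ k : ℕ, ∃ z : ℂ, 0 ≤ z ∧ ‖φ n g - z‖ ≤ C * ((4 * (n : ℝ) ^ 3 + 2 * n) * n / ((n + (k + 1) : ℕ) : ℝ)) := by
    intro k
    set N := n + (k + 1) with hNdef
    have hN : 0 < N := by omega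
    choose! z hz0 hz using fun (ψ : GLn F N → ℂ) (hψ : ψ ∈ T N) =>
      approx_one hN (embI n (k + 1)) (embI_cycleType n (k + 1)) g hg C hC (f N ψ) (hf N ψ hψ).2
    refine ⟨∑ ψ ∈ T N, w N ψ * z ψ, Finset.sum_nonneg fun ψ hψ => mul_nonneg (hf N ψ hψ).1 (hz0 ψ hψ), ?_⟩
    have e1 : φ n g = ∑ ψ ∈ T N, w N ψ * theta g (fun σ => f N ψ (embI n (k + 1) σ)) := by
      rw [← theta_eq (hth n) g]
      change theta g (fT n) = _
      rw [hrI n (k + 1)]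
      have : (fun σ => fT (n + (k + 1)) (embI n (k + 1) σ)) =
          ∑ ψ ∈ T N, w N ψ • fun σ => f N ψ (embI n (k + 1) σ) := by
        funext σ; simp [fT, Finset.sum_apply]; rfl
      rw [this, map_sum]
      simp
    rw [e1, ← Finset.sum_sub_distrib]
    simp only [← mul_sub]
    refine (norm_sum_le _ _).trans ?_
    have e2 : ∑ ψ ∈ T N, (w N ψ).re * (f N ψ 1).re = 1 := by
      have := congrArg Complex.re (hone N)
      simp only [fT, Finset.sum_apply, Pi.smul_apply, smul_eq_mul, Complex.re_sum, Complex.one_re] at this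
      rw [← this]
      refine Finset.sum_congr rfl fun ψ hψ => ?_
      have := (Complex.nonneg_iff.1 (hf N ψ hψ).1).2
      rw [Complex.mul_re, ← this]; ring
    calc _ ≤ ∑ ψ ∈ T N, ((w N ψ).re * (f N ψ 1).re) * (C * ((4 * (n : ℝ) ^ 3 + 2 * n) * n / N)) := by
          refine Finset.sum_le_sum fun ψ hψ => ?_
          rw [norm_mul, mul_assoc, show ‖w N ψ‖ = (w N ψ).re from congrArg Complex.re (Complex.norm_of_nonneg' (hf N ψ hψ).1)]
          exact mul_le_mul_of_nonneg_left (hz ψ hψ) (Complex.nonneg_iff.1 (hf N ψ hψ).1).1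
      _ = _ := by rw [← Finset.sum_mul, e2, one_mul]
  choose z hz0 hz using happ
  have hlim : Filter.Tendsto z Filter.atTop (nhds (φ n g)) := by
    rw [tendsto_iff_norm_sub_tendsto_zero]
    refine squeeze_zero (fun _ => norm_nonneg _) (fun k => (norm_sub_rev _ _).trans_le (hz k)) ?_
    rw [show (0 : ℝ) = C * 0 by simp]
    refine Filter.Tendsto.const_mul _ ?_
    have h3 : Filter.Tendsto (fun k : ℕ => n + (k + 1)) Filter.atTop Filter.atTop :=
      Filter.tendsto_atTop_mono (fun k => by simp only [id]; omega) Filter.tendsto_id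
    exact (tendsto_const_div_atTop_nhds_zero_nat ((4 * (n : ℝ) ^ 3 + 2 * n) * n)).comp h3
  exact ge_of_tendsto' hlim hz0

lemma exp_id (n : ℕ) : (n + 1) * (n + 1 - 1) / 2 = n * (n - 1) / 2 + n := by
  have := Nat.triangle_succ n
  simpa [mul_comm] using this

end M10
end OV

open scoped ComplexOrder
open MeasureTheory
namespace OV
set_option linter.unusedSectionVars false
section M11
open scoped Classical
variable {F : Type} [Field F] [Fintype F] [DecidableEq F]

lemma paraEmb_single {n : ℕ} (g : GLn F n) : paraEmb F n (MonoidAlgebra.single g 1) =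
    ((((Fintype.card F : ℂ) - 1) * (Fintype.card F : ℂ) ^ n)⁻¹ •
      ∑ h ∈ ExtSet F g, MonoidAlgebra.single h (1 : ℂ)) := by
  simp [paraEmb]

lemma charFun_single {n d : ℕ} (ρ : Representation ℂ (GLn F n) (Fin d → ℂ)) (g : GLn F n) :
    _root_.charFun F ρ (MonoidAlgebra.single g 1) = ρ.character g := by
  simp [_root_.charFun, Representation.character]

lemma UT_ext {n : ℕ} {g : GLn F n} (hg : IsUT F g) {h : GLn F (n + 1)} (hh : h ∈ ExtSet F g) : IsUT F h := by
  rw [mem_ExtSet] at hh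
  intro i j hij
  induction i using Fin.lastCases with
  | last =>
    induction j using Fin.lastCases with
    | last => exact absurd hij (lt_irrefl _)
    | cast j => exact hh.2 j
  | cast i =>
    induction j using Fin.lastCases with
    | last => exact absurd hij (not_lt.2 (Fin.le_last _))
    | cast j => rw [hh.1]; exact hg i j (by simpa using hij)

end M11
end OV

open OV

/-- **Theorem 4.1** (identification of unipotent traces with probability measures on `𝔹`).
Here `A`, together with the compatible system `ι` of injective multiplicative linear maps
from the group algebras `ℂ[GL(n,q)]` (along the parabolic embeddings) whose images exhaust `A`,
realizes the Schwartz–Bruhat algebra `A(GLB)` with its canonical involution; `χ` is an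
extreme unipotent trace normalized by `χ(I_B) = 1`. Then there is a unique Borel probability
measure `ϱ` on `𝔹` with `χ(I_g) = ϱ(Cyl_g)` for all upper-triangular `g ∈ GL(n,q)`,
where `I_g = (q-1)^{-n} q^{-n(n-1)/2}·[e_g]`. -/
theorem unipotent_trace_gives_probability_measure
    (A : Type) [NonUnitalRing A] [Module ℂ A] [SMulCommClass ℂ A A] [IsScalarTower ℂ A A]
    [StarRing A] [StarModule ℂ A]
    (ι : ∀ n : ℕ, GA F n →ₗ[ℂ] A)
    (hcomp : ∀ n : ℕ, (ι (n + 1)).comp (paraEmb F n) = ι n)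
    (hmul : ∀ (n : ℕ) (a b : GA F n), ι n (a * b) = ι n a * ι n b)
    (hinj : ∀ n : ℕ, Function.Injective (ι n))
    (hexhaust : ∀ x : A, ∃ (n : ℕ) (a : GA F n), ι n a = x)
    (hstar : ∀ (n : ℕ) (g : GLn F n),
      star (ι n (MonoidAlgebra.single g 1)) = ι n (MonoidAlgebra.single g⁻¹ 1))
    (χ : A →ₗ[ℂ] ℂ)
    (hextreme : IsExtremeTrace χ)
    (hunip : ∀ n : ℕ, IsUnipotentFunctional F (fun a => χ (ι n a)))
    (hnorm : χ (ι 0 1) = 1) :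
    ∃! ϱ : Measure (BB F), IsProbabilityMeasure ϱ ∧
      ∀ (n : ℕ) (g : GLn F n), IsUT F g →
        χ (((((Fintype.card F : ℂ) - 1) ^ n * (Fintype.card F : ℂ) ^ (n * (n - 1) / 2))⁻¹) •
            ι n (MonoidAlgebra.single g 1))
          = ((ϱ (Cyl F g)).toReal : ℂ) := by
  classical
  have hq1 : (1 : ℝ) < Fintype.card F := by exact_mod_cast Fintype.one_lt_card (α := F)
  let φ : ∀ n, GLn F n → ℂ := fun n g => χ (ι n (MonoidAlgebra.single g 1))
  have hext : ∀ n (g : GLn F n), φ n g =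
      (((Fintype.card F : ℂ) - 1) * (Fintype.card F : ℂ) ^ n)⁻¹ * ∑ h ∈ ExtSet F g, φ (n + 1) h := by
    intro n g
    simp only [φ]
    rw [← hcomp n, LinearMap.comp_apply, paraEmb_single]
    simp only [map_smul, map_sum, smul_eq_mul]
  have hφ1 : φ 0 1 = 1 := hnorm
  have hdec : ∀ N, ∃ (T : Finset (GLn F N → ℂ)) (w : (GLn F N → ℂ) → ℂ) (f : (GLn F N → ℂ) → Equiv.Perm (Fin N) → ℂ),
      (∀ ψ ∈ T, 0 ≤ w ψ ∧ IsIrrChar (f ψ)) ∧ IsTh (∑ ψ ∈ T, w ψ • f ψ) (φ N) := by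
    intro N
    obtain ⟨k, c, d, ρ, hρ, hsum⟩ := hunip N
    refine pos_decomp (φ N) k c d ρ hρ ?_ ?_
    · funext g
      have := hsum (MonoidAlgebra.single g 1)
      simp only [charFun_single] at this
      simpa [φ] using this
    · intro x
      have h := hextreme.1.2 (ι N (∑ g, x g • MonoidAlgebra.single g (1 : ℂ)))
      have e : χ (star (ι N (∑ g, x g • MonoidAlgebra.single g (1 : ℂ))) * ι N (∑ g, x g • MonoidAlgebra.single g (1 : ℂ)))
          = ∑ g, ∑ h, star (x g) * x h * φ N (g⁻¹ * h) := by
        simp only [map_sum, map_smul, star_sum, star_smul, hstar, Finset.sum_mul, Finset.mul_sum, smul_mul_assoc,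
          mul_smul_comm, ← hmul, MonoidAlgebra.single_mul_single, mul_one, smul_eq_mul]
        rw [Finset.sum_comm]
        refine Finset.sum_congr rfl fun g _ => Finset.sum_congr rfl fun h _ => ?_
        simp only [φ]; ring
      rwa [e] at h
  have hpos := th_pos φ hext hφ1 hdec
  let s : ℕ → ℝ := fun n => ((Fintype.card F : ℝ) - 1) ^ n * (Fintype.card F : ℝ) ^ (n * (n - 1) / 2)
  have hs : ∀ n, 0 < s n := fun n => mul_pos (pow_pos (by linarith) _) (pow_pos (by linarith) _)
  have hsS : ∀ n, s (n + 1) = s n * (((Fintype.card F : ℝ) - 1) * (Fintype.card F : ℝ) ^ n) := by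
    intro n
    simp only [s, exp_id, pow_add, pow_succ]; ring
  have hsC : ∀ n, ((Fintype.card F : ℂ) - 1) ^ n * (Fintype.card F : ℂ) ^ (n * (n - 1) / 2) = ((s n : ℝ) : ℂ) := by
    intro n; simp [s]
  let p : ∀ n, GLn F n → ℝ := fun n g => (s n)⁻¹ * (φ n g).re
  have hval : ∀ n (g : GLn F n), IsUT F g →
      χ (((((Fintype.card F : ℂ) - 1) ^ n * (Fintype.card F : ℂ) ^ (n * (n - 1) / 2))⁻¹) •
            ι n (MonoidAlgebra.single g 1)) = ((p n g : ℝ) : ℂ) := by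
    intro n g hg
    rw [hsC, map_smul, smul_eq_mul]
    have h2 : ((φ n g).re : ℂ) = φ n g := by
      refine Complex.ext (by simp) ?_
      simpa using (Complex.nonneg_iff.1 (hpos n g hg)).2
    simp only [p]
    push_cast
    rw [h2]
  obtain ⟨ϱ, hϱ, hϱ2⟩ := exists_measure p
    (fun n g hg => mul_nonneg (inv_nonneg.2 (hs n).le) (Complex.nonneg_iff.1 (hpos n g hg)).1)
    (by
      intro n g hg
      have h2 : (φ n g).re = (((Fintype.card F : ℝ) - 1) * (Fintype.card F : ℝ) ^ n)⁻¹ * ∑ h ∈ ExtSet F g, (φ (n + 1) h).re := by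
        have h3 := congrArg Complex.re (hext n g)
        rw [show (((Fintype.card F : ℂ) - 1) * (Fintype.card F : ℂ) ^ n)⁻¹ =
          (((((Fintype.card F : ℝ) - 1) * (Fintype.card F : ℝ) ^ n)⁻¹ : ℝ) : ℂ) by push_cast; rfl] at h3
        rwa [Complex.re_ofReal_mul, Complex.re_sum] at h3
      simp only [p, ← Finset.mul_sum]
      rw [h2, hsS, mul_inv (s n), mul_assoc])
    (by simp [p, s, hφ1])
  refine ⟨ϱ, ⟨hϱ, fun n g hg => by rw [hval n g hg, hϱ2 n g hg]⟩, ?_⟩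
  rintro ν ⟨hν, hν2⟩
  haveI := hν
  haveI := hϱ
  apply unique_measure
  intro n g hg
  have h1 := hν2 n g hg
  rw [hval n g hg] at h1
  rw [hϱ2 n g hg]
  exact_mod_cast h1.symm
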